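/- There exists a function E(m,n,d), independent of N and of K, with the following property: for every algebraically closed field K, every N, and every m × n matrix 𝓜 over R = K[x_1,…,x_N] whose entries have degree at most d, if M ⊆ R^m is the column space of 𝓜, then there is an irredundant primary decomposition M = Q_1 ∩ … ∩ Q_t in R^m such that: t ≤ E(m,n,d); for each i the submodule Q_i is P_i-coprimary (i.e., the set of associated primes of R^m/Q_i is {P_i}); each prime ideal P_i is generated by at most E(m,n,d) polynomials of degree at most E(m,n,d); each Q_i is generated by at most E(m,n,d) elements of R^m whose entries have degree at most E(m,n,d); and P_i^{E(m,n,d)} · R^m ⊆ Q_i for each i. Irredundant means that the primes P_1,…,P_t are pairwise distinct and that for each j the intersection of the Q_i over i ≠ j is strictly larger than M. -/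

import Mathlib

universe u

namespace Ultra

open Filter

/-- The fixed nonprincipal ultrafilter on `ℕ`. -/
noncomputable abbrev U : Ultrafilter ℕ := hyperfilter ℕ

section UP

variable {A A' : ℕ → Type u} [∀ i, CommRing (A i)] [∀ i, CommRing (A' i)]

/-- The ideal of sequences vanishing almost everywhere. -/
def upIdeal (A : ℕ → Type u) [∀ i, CommRing (A i)] : Ideal (∀ i, A i) where
  carrier := {f | ∀ᶠ i in U, f i = 0}
  zero_mem' := Eventually.of_forall fun _ => rfl
  add_mem' {a b} ha hb := by
    filter_upwards [ha, hb] with i h1 h2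
    simp [h1, h2]
  smul_mem' c x hx := by
    filter_upwards [hx] with i h
    simp [h]

/-- The ultraproduct of a sequence of commutative rings. -/
def UP (A : ℕ → Type u) [∀ i, CommRing (A i)] : Type u := (∀ i, A i) ⧸ upIdeal A

noncomputable instance : CommRing (UP A) := inferInstanceAs (CommRing ((∀ i, A i) ⧸ upIdeal A))

/-- The class of a sequence in the ultraproduct. -/
noncomputable def mk : (∀ i, A i) →+* UP A := Ideal.Quotient.mk (upIdeal A)

theorem mk_surjective : Function.Surjective (mk : (∀ i, A i) →+* UP A) :=
  Ideal.Quotient.mk_surjective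

theorem mk_eq_zero {f : ∀ i, A i} : mk f = 0 ↔ ∀ᶠ i in U, f i = 0 :=
  Ideal.Quotient.eq_zero_iff_mem

theorem mk_eq_mk {f g : ∀ i, A i} : mk f = mk g ↔ ∀ᶠ i in U, f i = g i := by
  rw [← sub_eq_zero, ← map_sub, mk_eq_zero]
  simp [sub_eq_zero]

/-- A chosen representing sequence. -/
noncomputable def rep (z : UP A) : ∀ i, A i := (mk_surjective z).choose

@[simp] theorem mk_rep (z : UP A) : mk (rep z) = z := (mk_surjective z).choose_spec

theorem rep_mk (f : ∀ i, A i) : ∀ᶠ i in U, rep (mk f) i = f i := mk_eq_mk.1 (mk_rep _)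

theorem rep_zero : ∀ᶠ i in U, rep (0 : UP A) i = 0 := mk_eq_zero.1 (mk_rep 0)

theorem rep_one : ∀ᶠ i in U, rep (1 : UP A) i = 1 := by
  have := rep_mk (A := A) 1
  rwa [map_one] at this

theorem rep_add (z w : UP A) : ∀ᶠ i in U, rep (z + w) i = rep z i + rep w i := by
  have : mk (rep (z + w)) = mk (rep z + rep w) := by simp
  exact mk_eq_mk.1 this

theorem rep_mul (z w : UP A) : ∀ᶠ i in U, rep (z * w) i = rep z i * rep w i := by
  have : mk (rep (z * w)) = mk (rep z * rep w) := by simp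
  exact mk_eq_mk.1 this

theorem eq_zero_iff {z : UP A} : z = 0 ↔ ∀ᶠ i in U, rep z i = 0 := by
  rw [← mk_eq_zero, mk_rep]

theorem ne_zero_iff {z : UP A} : z ≠ 0 ↔ ∀ᶠ i in U, rep z i ≠ 0 := by
  rw [Ne, eq_zero_iff, ← Ultrafilter.eventually_not]

instance [∀ i, Nontrivial (A i)] : Nontrivial (UP A) := by
  refine ⟨0, 1, fun h => ?_⟩
  rw [← map_zero mk, ← map_one mk, mk_eq_mk] at h
  obtain ⟨i, hi⟩ := h.exists
  exact zero_ne_one hi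

instance [∀ i, IsDomain (A i)] : IsDomain (UP A) := by
  have : NoZeroDivisors (UP A) := ⟨fun {a b} h => by
    rw [eq_zero_iff] at h
    rw [eq_zero_iff, eq_zero_iff, ← Ultrafilter.eventually_or]
    filter_upwards [h, rep_mul a b] with i h1 h2
    rw [h1] at h2
    exact mul_eq_zero.1 h2.symm⟩
  exact NoZeroDivisors.to_isDomain _

/-- The map of ultraproducts induced by a sequence of additive maps. -/
noncomputable def amap (φ : ∀ i, A i →+ A' i) : UP A →+ UP A' where
  toFun z := mk fun i => φ i (rep z i)
  map_zero' := by
    rw [mk_eq_zero]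
    filter_upwards [rep_zero (A := A)] with i h
    rw [h, map_zero]
  map_add' z w := by
    rw [← map_add, mk_eq_mk]
    filter_upwards [rep_add z w] with i h
    simp [h]

theorem amap_mk (φ : ∀ i, A i →+ A' i) (f : ∀ i, A i) :
    amap φ (mk f) = mk fun i => φ i (f i) := by
  refine mk_eq_mk.2 ?_
  filter_upwards [rep_mk f] with i h
  rw [h]

/-- The ring homomorphism of ultraproducts induced by a sequence of ring homomorphisms. -/
noncomputable def rmap (φ : ∀ i, A i →+* A' i) : UP A →+* UP A' :=
  { amap (fun i => (φ i : A i →+ A' i)) with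
    map_one' := by
      refine (mk_eq_mk.2 ?_).trans (map_one mk)
      filter_upwards [rep_one (A := A)] with i h
      simp [h]
    map_mul' := fun z w => by
      refine (mk_eq_mk.2 ?_).trans (map_mul mk _ _)
      filter_upwards [rep_mul z w] with i h
      simp [h] }

theorem rmap_mk (φ : ∀ i, A i →+* A' i) (f : ∀ i, A i) :
    rmap φ (mk f) = mk fun i => φ i (f i) :=
  amap_mk _ f

theorem rmap_eq (φ : ∀ i, A i →+* A' i) (z : UP A) :
    rmap φ z = mk fun i => φ i (rep z i) := rfl

end UP

noncomputable instance (K : ℕ → Type u) [∀ i, Field (K i)] : Field (UP K) :=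
  { (inferInstance : CommRing (UP K)), (inferInstance : Nontrivial (UP K)) with
    inv := fun z => mk fun i => (rep z i)⁻¹
    mul_inv_cancel := fun a ha => by
      rw [ne_zero_iff] at ha
      rw [← map_one mk]
      nth_rewrite 1 [← mk_rep a]
      rw [← map_mul, mk_eq_mk]
      filter_upwards [ha] with i h
      simp [h]
    inv_zero := by
      change mk _ = 0
      rw [mk_eq_zero]
      filter_upwards [rep_zero (A := K)] with i h
      rw [h, inv_zero]
    nnqsmul := _
    nnqsmul_def := fun _ _ => rfl
    qsmul := _
    qsmul_def := fun _ _ => rfl }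

section Poly

variable (K : ℕ → Type u) [∀ i, Field (K i)]

/-- The ultraproduct of polynomial rings. -/
abbrev Fl (n : ℕ → ℕ) : Type u := UP fun i => MvPolynomial (Fin (n i)) (K i)

noncomputable instance (n : ℕ → ℕ) : Algebra (UP K) (Fl K n) :=
  (rmap fun _ => MvPolynomial.C).toAlgebra

theorem algebraMap_mk (n : ℕ → ℕ) (c : ∀ i, K i) :
    algebraMap (UP K) (Fl K n) (mk c) = mk fun i => MvPolynomial.C (c i) :=
  rmap_mk _ c

theorem mk_smul_mk (n : ℕ → ℕ) (c : ∀ i, K i) (f : ∀ i, MvPolynomial (Fin (n i)) (K i)) :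
    (mk c : UP K) • (mk f : Fl K n) = mk fun i => c i • f i := by
  rw [Algebra.smul_def, algebraMap_mk, ← map_mul, mk_eq_mk]
  exact Eventually.of_forall fun i => by simp [MvPolynomial.smul_eq_C_mul]

variable {K}

/-- Elements of the ultraproduct represented by polynomials of degree at most `d`. -/
def DegLE {n : ℕ → ℕ} (d : ℕ) (z : Fl K n) : Prop :=
  ∀ᶠ i in U, (rep z i).totalDegree ≤ d

theorem degLE_mk {n : ℕ → ℕ} {d : ℕ} {f : ∀ i, MvPolynomial (Fin (n i)) (K i)} :
    DegLE d (mk f) ↔ ∀ᶠ i in U, (f i).totalDegree ≤ d := by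
  constructor <;> intro h
  · filter_upwards [h, rep_mk f] with i h1 h2
    rwa [← h2]
  · filter_upwards [h, rep_mk f] with i h1 h2
    rwa [h2]

theorem DegLE.mono {n : ℕ → ℕ} {d e : ℕ} (h : d ≤ e) {z : Fl K n} (hz : DegLE d z) :
    DegLE e z :=
  Eventually.mono hz fun _ hi => hi.trans h

theorem DegLE.add {n : ℕ → ℕ} {d : ℕ} {z w : Fl K n} (hz : DegLE d z) (hw : DegLE d w) :
    DegLE d (z + w) := by
  filter_upwards [hz, hw, rep_add z w] with i h1 h2 h3
  rw [h3]
  exact (MvPolynomial.totalDegree_add _ _).trans (max_le h1 h2)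

theorem DegLE.mul {n : ℕ → ℕ} {d e : ℕ} {z w : Fl K n} (hz : DegLE d z) (hw : DegLE e w) :
    DegLE (d + e) (z * w) := by
  filter_upwards [hz, hw, rep_mul z w] with i h1 h2 h3
  rw [h3]
  exact (MvPolynomial.totalDegree_mul _ _).trans (add_le_add h1 h2)

theorem degLE_algebraMap {n : ℕ → ℕ} (c : UP K) : DegLE 0 (algebraMap (UP K) (Fl K n) c) := by
  rw [← mk_rep c, algebraMap_mk, degLE_mk]
  exact Eventually.of_forall fun i => by simp

variable (K) in
/-- The subalgebra of elements represented by polynomials of bounded degree. -/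
noncomputable def Bd (n : ℕ → ℕ) : Subalgebra (UP K) (Fl K n) where
  carrier := {z | ∃ d, DegLE d z}
  add_mem' := by
    rintro a b ⟨d, hd⟩ ⟨e, he⟩
    exact ⟨max d e, (hd.mono (le_max_left _ _)).add (he.mono (le_max_right _ _))⟩
  mul_mem' := by
    rintro a b ⟨d, hd⟩ ⟨e, he⟩
    exact ⟨d + e, hd.mul he⟩
  algebraMap_mem' c := ⟨0, degLE_algebraMap c⟩

theorem mem_Bd {n : ℕ → ℕ} {z : Fl K n} : z ∈ Bd K n ↔ ∃ d, DegLE d z := Iff.rfl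

end Poly

section PerField

open MvPolynomial

theorem exists_pow_eq_of_pderiv_eq_zero {σ k : Type*} [Field k] (p : ℕ) [Fact p.Prime] [CharP k p]
    (hroot : ∀ c : k, ∃ r, r ^ p = c) (F : MvPolynomial σ k) (hF : ∀ t, pderiv t F = 0) :
    ∃ G : MvPolynomial σ k, G ^ p = F := by
  choose r hr using hroot
  have key : ∀ m ∈ F.support, ∃ m' : σ →₀ ℕ, m = p • m' := by
    intro m hm
    have hdiv : ∀ t, p ∣ m t := by
      intro t
      by_cases h0 : m t = 0
      · simp [h0]
      have h1 := congrArg (coeff (m - Finsupp.single t 1)) (hF t)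
      rw [coeff_pderiv, coeff_zero] at h1
      have h2 : m - Finsupp.single t 1 + Finsupp.single t 1 = m := by
        ext s
        by_cases hs : s = t
        · subst hs; simp; omega
        · simp [Ne.symm hs]
      rw [h2] at h1
      have h3 : coeff m F ≠ 0 := mem_support_iff.1 hm
      have h4 : ((m t : ℕ) : k) = 0 := by
        rcases mul_eq_zero.1 h1 with h | h
        · exact absurd h h3
        · have : (m - Finsupp.single t 1 : σ →₀ ℕ) t + 1 = m t := by simp; omega
          rw [← this]
          push_cast
          exact h
      exact (CharP.cast_eq_zero_iff k p _).1 h4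
    refine ⟨m.mapRange (fun a => a / p) (by simp), ?_⟩
    ext t
    simp [Nat.mul_div_cancel' (hdiv t)]
  choose! m' hm' using key
  refine ⟨∑ m ∈ F.support, monomial (m' m) (r (coeff m F)), ?_⟩
  rw [sum_pow_char p]
  conv_rhs => rw [F.as_sum]
  refine Finset.sum_congr rfl fun m hm => ?_
  rw [monomial_pow, hr, ← hm' m hm]

theorem homogeneousComponent_mul_eq_sum {σ k : Type*} [CommRing k] (a : ℕ)
    (f g : MvPolynomial σ k) :
    homogeneousComponent a (f * g) = ∑ x ∈ Finset.HasAntidiagonal.antidiagonal a,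
      homogeneousComponent x.1 f * homogeneousComponent x.2 g := by
  classical
  ext d
  rw [coeff_homogeneousComponent, coeff_sum, coeff_mul]
  simp_rw [coeff_mul, coeff_homogeneousComponent]
  rw [Finset.sum_comm]
  have key : ∀ y ∈ Finset.HasAntidiagonal.antidiagonal d,
      (∑ x ∈ Finset.HasAntidiagonal.antidiagonal a, (if y.1.degree = x.1 then coeff y.1 f else 0) *
        (if y.2.degree = x.2 then coeff y.2 g else 0)) =
      if d.degree = a then coeff y.1 f * coeff y.2 g else 0 := by
    intro y hy
    have hd : y.1.degree + y.2.degree = d.degree := by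
      rw [← map_add, Finset.HasAntidiagonal.mem_antidiagonal.1 hy]
    split_ifs with h
    · rw [Finset.sum_eq_single (y.1.degree, y.2.degree)]
      · simp
      · rintro ⟨b, c⟩ - hne
        by_cases h1 : y.1.degree = b
        · have h2 : y.2.degree ≠ c := fun h2 => hne (by rw [← h1, ← h2])
          simp [h2]
        · simp [h1]
      · intro hn
        exact absurd (Finset.HasAntidiagonal.mem_antidiagonal.2 (hd.trans h)) hn
    · refine Finset.sum_eq_zero fun x hx => ?_
      by_cases h1 : y.1.degree = x.1
      · have h2 : y.2.degree ≠ x.2 := fun h2 => h (by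
          rw [← hd, h1, h2, Finset.HasAntidiagonal.mem_antidiagonal.1 hx])
        simp [h2]
      · simp [h1]
  rw [Finset.sum_congr rfl key]
  split_ifs <;> simp

theorem totalDegree_X_le_one {σ k : Type*} [CommRing k] (j : σ) :
    (X j : MvPolynomial σ k).totalDegree ≤ 1 := by
  have := totalDegree_monomial_le (R := k) (Finsupp.single j 1) 1
  rwa [Finsupp.sum_single_index rfl] at this

/-- Translation of the variables of a polynomial ring. -/
noncomputable def shift {σ k : Type*} [CommRing k] (v : σ → k) :
    MvPolynomial σ k →ₐ[k] MvPolynomial σ k :=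
  aeval fun j => X j + C (v j)

theorem constantCoeff_shift {σ k : Type*} [CommRing k] (v : σ → k) (f : MvPolynomial σ k) :
    constantCoeff (shift v f) = eval v f := by
  have : (constantCoeff.comp (shift v : MvPolynomial σ k →+* MvPolynomial σ k)) = eval v := by
    apply ringHom_ext <;> simp [shift]
  exact congrArg (fun φ => φ f) this

theorem homogeneousComponent_mul_top {σ k : Type*} [CommRing k] {a b : ℕ}
    {f g : MvPolynomial σ k} (hf : f.totalDegree ≤ a) (hg : g.totalDegree ≤ b) :
    homogeneousComponent (a + b) (f * g) =
      homogeneousComponent a f * homogeneousComponent b g := by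
  rw [homogeneousComponent_mul_eq_sum, Finset.sum_eq_single (a, b)]
  · rintro ⟨c, d⟩ hcd hne
    rw [Finset.HasAntidiagonal.mem_antidiagonal] at hcd
    simp only at hcd ⊢
    by_cases h : a < c
    · rw [homogeneousComponent_eq_zero _ _ (hf.trans_lt h), zero_mul]
    · rw [homogeneousComponent_eq_zero d g, mul_zero]
      refine hg.trans_lt ?_
      by_contra h2
      exact hne (by ext <;> simp <;> omega)
  · intro h
    exact absurd (Finset.HasAntidiagonal.mem_antidiagonal.2 (Eq.refl (a + b))) h

theorem shift_top {σ k : Type*} [CommRing k] (v : σ → k) (a : ℕ) (f : MvPolynomial σ k)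
    (hf : f.totalDegree ≤ a) : (shift v f).totalDegree ≤ a ∧
      homogeneousComponent a (shift v f) = homogeneousComponent a f := by
  have hX : ∀ j, (X j + C (v j) : MvPolynomial σ k).totalDegree ≤ 1 := fun j =>
    (totalDegree_add _ _).trans (max_le (totalDegree_X_le_one j) (by simp))
  have hX' : ∀ j, (shift v (X j)).totalDegree ≤ 1 ∧
      homogeneousComponent 1 (shift v (X j)) = homogeneousComponent 1 (X j) := fun j => by
    refine ⟨by simpa [shift] using hX j, ?_⟩
    have : homogeneousComponent 1 (C (v j) : MvPolynomial σ k) = 0 :=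
      homogeneousComponent_eq_zero _ _ (by simp)
    simp [shift, this]
  have hmon : ∀ (s : σ →₀ ℕ) (c : k), (shift v (monomial s c)).totalDegree ≤ s.degree ∧
      homogeneousComponent s.degree (shift v (monomial s c)) =
        homogeneousComponent s.degree (monomial s c) := by
    intro s
    induction s using Finsupp.induction_linear with
    | zero => intro c; simp [shift]
    | add s t hs ht =>
      intro c
      have e : (monomial (s + t) c : MvPolynomial σ k) = monomial s c * monomial t 1 := by
        rw [monomial_mul, mul_one]
      have d1 : (monomial s c : MvPolynomial σ k).totalDegree ≤ s.degree :=
        totalDegree_monomial_le _ _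
      have d2 : (monomial t 1 : MvPolynomial σ k).totalDegree ≤ t.degree :=
        totalDegree_monomial_le _ _
      rw [e, map_mul, map_add]
      refine ⟨(totalDegree_mul _ _).trans (add_le_add (hs c).1 (ht 1).1), ?_⟩
      rw [homogeneousComponent_mul_top (hs c).1 (ht 1).1, (hs c).2, (ht 1).2,
        homogeneousComponent_mul_top d1 d2]
    | single j l =>
      intro c
      rw [Finsupp.degree_single]
      induction l with
      | zero => simp [shift]
      | succ l ih =>
        have e : (monomial (Finsupp.single j (l + 1)) c : MvPolynomial σ k) =
            monomial (Finsupp.single j l) c * X j := by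
          rw [X, monomial_mul, mul_one, ← Finsupp.single_add]
        have d1 : (monomial (Finsupp.single j l) c : MvPolynomial σ k).totalDegree ≤ l := by
          simpa using totalDegree_monomial_le (Finsupp.single j l) c
        rw [e, map_mul]
        refine ⟨(totalDegree_mul _ _).trans (add_le_add ih.1 (hX' j).1), ?_⟩
        rw [homogeneousComponent_mul_top ih.1 (hX' j).1, ih.2, (hX' j).2,
          homogeneousComponent_mul_top d1 (totalDegree_X_le_one j)]
  have hmon' : ∀ (s : σ →₀ ℕ) (c : k), s.degree ≤ a →
      (shift v (monomial s c)).totalDegree ≤ a ∧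
      homogeneousComponent a (shift v (monomial s c)) =
        homogeneousComponent a (monomial s c) := by
    intro s c h
    refine ⟨(hmon s c).1.trans h, ?_⟩
    rcases h.eq_or_lt with h | h
    · rw [← h]; exact (hmon s c).2
    · rw [homogeneousComponent_eq_zero _ _ ((hmon s c).1.trans_lt h),
        homogeneousComponent_eq_zero _ _ ((totalDegree_monomial_le s c).trans_lt h)]
  have hs : ∀ s ∈ f.support, s.degree ≤ a := fun s hs =>
    (le_totalDegree hs).trans hf
  rw [f.as_sum, map_sum, map_sum, map_sum]
  refine ⟨totalDegree_finsetSum_le fun s h => (hmon' s _ (hs s h)).1, ?_⟩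
  exact Finset.sum_congr rfl fun s h => (hmon' s _ (hs s h)).2

end PerField

section Abstract

open MvPolynomial

theorem totalDegree_pow_eq {σ k : Type*} [Field k] (G : MvPolynomial σ k) (p : ℕ) :
    (G ^ p).totalDegree = p * G.totalDegree := by
  by_cases hG : G = 0
  · subst hG
    cases p <;> simp
  induction p with
  | zero => simp
  | succ p ih =>
    rw [pow_succ, totalDegree_mul_of_isDomain (pow_ne_zero _ hG) hG, ih]
    ring

theorem derivation_chain {k A T : Type*} [Field k] [CommRing A] [Algebra k A] [Fintype T]
    (e : A →ₐ[k] k) (δ : A →ₗ[k] k) (hδ : ∀ f g, δ (f * g) = e f * δ g + e g * δ f)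
    (y : T → A) (F : MvPolynomial T k) :
    δ (aeval y F) = ∑ t, e (aeval y (pderiv t F)) * δ (y t) := by
  classical
  have h1 : δ 1 = 0 := by
    have := hδ 1 1
    simp only [mul_one, map_one, one_mul] at this
    linear_combination -this
  induction F using MvPolynomial.induction_on with
  | C c =>
    simp [Algebra.algebraMap_eq_smul_one, h1]
  | add p q hp hq =>
    simp only [map_add, hp, hq, ← Finset.sum_add_distrib, add_mul]
  | mul_X p s hp =>
    rw [map_mul, hδ, hp]
    simp only [pderiv_mul, map_add, map_mul, aeval_X, pderiv_X, add_mul,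
      Finset.sum_add_distrib, Finset.mul_sum]
    rw [add_comm]
    congr 1
    · exact Finset.sum_congr rfl fun t _ => by ring
    · rw [Finset.sum_eq_single s]
      · simp
      · intro t _ ht
        simp [Ne.symm ht]
      · simp

variable {k A V : Type*} [Field k] [CommRing A] [IsDomain A] [Algebra k A]

theorem eq_zero_of_aeval_eq_zero {T : Type*} [Fintype T] (e : V → A →ₐ[k] k)
    (h_eval : ∀ f, (∀ v, e v f = 0) → f = 0)
    (hroot : ∀ p : ℕ, p.Prime → CharP k p → ∀ c : k, ∃ r, r ^ p = c)
    (y : T → A) (w : T → ℕ) (δ : T → V → A →ₗ[k] k)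
    (hδ : ∀ t v f g, δ t v (f * g) = e v f * δ t v g + e v g * δ t v f)
    (hδ1 : ∀ t v, δ t v (y t) = 1)
    (hδ0 : ∀ s t v, s ≠ t → w s ≤ w t → δ t v (y s) = 0)
    (F : MvPolynomial T k) (hF : aeval y F = 0) : F = 0 := by
  induction hd : F.totalDegree using Nat.strong_induction_on generalizing F with
  | _ d ih =>
  by_cases hd0 : d = 0
  · subst hd0
    rw [totalDegree_eq_zero_iff_eq_C] at hd
    rw [hd, aeval_C, map_eq_zero_iff _ (algebraMap k A).injective] at hF
    rw [hd, hF, map_zero]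
  have hmain : ∀ N, ∀ t, Finset.univ.sup w ≤ w t + N → aeval y (pderiv t F) = 0 := by
    intro N
    induction N with
    | zero =>
      intro t ht
      refine h_eval _ fun v => ?_
      have h1 := derivation_chain (e v) (δ t v) (hδ t v) y F
      rw [hF, map_zero, Finset.sum_eq_single t] at h1
      · rw [hδ1, mul_one] at h1; exact h1.symm
      · intro s _ hs
        rw [hδ0 s t v hs, mul_zero]
        exact (Finset.le_sup (f := w) (Finset.mem_univ s)).trans ht
      · simp
    | succ N ihN =>
      intro t ht
      refine h_eval _ fun v => ?_
      have h1 := derivation_chain (e v) (δ t v) (hδ t v) y F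
      rw [hF, map_zero, Finset.sum_eq_single t] at h1
      · rw [hδ1, mul_one] at h1; exact h1.symm
      · intro s _ hs
        by_cases hst : w s ≤ w t
        · rw [hδ0 s t v hs hst, mul_zero]
        · rw [ihN s (by omega), map_zero, zero_mul]
      · simp
  have hpd : ∀ t, pderiv t F = 0 := by
    intro t
    by_contra hne
    have hlt : (pderiv t F).totalDegree < d := by
      rw [totalDegree, Finset.sup_lt_iff (by simpa using Nat.pos_of_ne_zero hd0)]
      intro m hm
      have h1 : coeff (m + Finsupp.single t 1) F ≠ 0 := by
        intro h0
        rw [mem_support_iff, coeff_pderiv, h0, zero_mul] at hm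
        exact hm rfl
      have h2 := le_totalDegree (mem_support_iff.2 h1)
      rw [hd, Finsupp.sum_add_index' (fun _ => rfl) (fun _ _ _ => rfl),
        Finsupp.sum_single_index rfl] at h2
      omega
    exact hne (ih _ hlt _ (hmain _ t (Nat.le_add_left _ _)) rfl)
  obtain ⟨p, hp⟩ := CharP.exists k
  rcases CharP.char_is_prime_or_zero k p with hpp | hp0
  · have := Fact.mk hpp
    obtain ⟨G, hG⟩ := exists_pow_eq_of_pderiv_eq_zero p (hroot p hpp hp) F hpd
    have hG0 : aeval y G = 0 := by
      rw [← hG, map_pow] at hF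
      exact pow_eq_zero_iff hpp.ne_zero |>.1 hF
    have hle : p * G.totalDegree = d := by
      rw [← hd, ← hG, totalDegree_pow_eq]
    have : G = 0 := by
      refine ih G.totalDegree ?_ G hG0 rfl
      have h2 := hpp.two_le
      rcases Nat.eq_zero_or_pos G.totalDegree with h | h
      · omega
      · nlinarith
    rw [← hG, this, zero_pow hpp.ne_zero]
  · subst hp0
    have : CharZero k := CharP.charP_to_charZero k
    exfalso
    have hne : F ≠ 0 := by
      rintro rfl
      simp at hd
      omega
    obtain ⟨m, hm, hmd⟩ := Finset.exists_mem_eq_sup F.support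
      (Finset.nonempty_of_ne_empty (by simpa using hne)) (fun s => s.sum fun _ e => e)
    change F.totalDegree = _ at hmd
    have hm0 : m ≠ 0 := by
      rintro rfl
      simp at hmd
      omega
    obtain ⟨t, ht⟩ := Finsupp.ne_iff.1 hm0
    have h1 := congrArg (coeff (m - Finsupp.single t 1)) (hpd t)
    have h2 : m - Finsupp.single t 1 + Finsupp.single t 1 = m := by
      ext s
      by_cases hs : s = t
      · subst hs; simp at ht ⊢; omega
      · simp [Ne.symm hs]
    rw [coeff_pderiv, coeff_zero, h2] at h1
    rcases mul_eq_zero.1 h1 with h | h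
    · exact mem_support_iff.1 hm h
    · exact absurd h (Nat.cast_add_one_ne_zero _)

/-- The span of products of two elements of positive degree. -/
def decomposables (hc : ℕ → A →ₗ[k] A) (a : ℕ) : Submodule k A :=
  Submodule.span k {z | ∃ b c f g, b + 1 + (c + 1) = a ∧ z = hc (b + 1) f * hc (c + 1) g}

theorem exists_algebraicIndependent_of_graded {A : Type u} [CommRing A] [IsDomain A] [Algebra k A]
    (hc : ℕ → A →ₗ[k] A) (ε : A →ₐ[k] k) (τ : V → A →ₐ[k] A)
    (h_mul : ∀ a f g, hc a (f * g) =
      ∑ x ∈ Finset.HasAntidiagonal.antidiagonal a, hc x.1 f * hc x.2 g)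
    (h_zero : ∀ f, hc 0 f = algebraMap k A (ε f))
    (h_idem : ∀ a f, hc a (hc a f) = hc a f)
    (h_orth : ∀ a b f, a ≠ b → hc a (hc b f) = 0)
    (h_shift : ∀ v a b f, b ≤ a → hc a (τ v (hc b f)) = hc a (hc b f))
    (h_eval : ∀ f, (∀ v, ε (τ v f) = 0) → f = 0)
    (hroot : ∀ p : ℕ, p.Prime → CharP k p → ∀ c : k, ∃ r, r ^ p = c) :
    ∃ (J : Type u) (y : J → A), AlgebraicIndependent k y ∧ (∀ j, ∃ a f, y j = hc a f) ∧
      ∀ a f, hc a f ∈ Algebra.adjoin k (Set.range y) := by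
  classical
  let W := decomposables (k := k) hc
  let T : ∀ a, Submodule k (A ⧸ W a) := fun a => (LinearMap.range (hc a)).map (W a).mkQ
  let bas := fun a => Module.Basis.ofVectorSpace k (T a)
  let J : Type u := Σ a : ℕ, Module.Basis.ofVectorSpaceIndex k (T (a + 1))
  have hex : ∀ κ : J, ∃ f, (W (κ.1 + 1)).mkQ (hc (κ.1 + 1) f) = bas (κ.1 + 1) κ.2 := by
    rintro ⟨a, j⟩
    obtain ⟨z, ⟨f, rfl⟩, hz⟩ := (bas (a + 1) j).2
    exact ⟨f, hz⟩
  choose y0 hy0 using hex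
  let y : J → A := fun κ => hc (κ.1 + 1) (y0 κ)
  have hT : ∀ a f, (W a).mkQ (hc a f) ∈ T a := fun a f => ⟨_, ⟨f, rfl⟩, rfl⟩
  let cl : ∀ a, A →ₗ[k] T a := fun a => ((W a).mkQ ∘ₗ hc a).codRestrict (T a) (hT a)
  let q : J → A →ₗ[k] k := fun κ => (bas (κ.1 + 1)).coord κ.2 ∘ₗ cl (κ.1 + 1)
  have hcl : ∀ a f g, cl (a + 1) (f * g) = ε f • cl (a + 1) g + ε g • cl (a + 1) f := by
    intro a f g
    apply Subtype.ext
    change (W (a + 1)).mkQ (hc (a + 1) (f * g)) = ε f • (W (a + 1)).mkQ (hc (a + 1) g) +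
      ε g • (W (a + 1)).mkQ (hc (a + 1) f)
    rw [h_mul, Finset.Nat.sum_antidiagonal_succ, map_add, h_zero, ← Algebra.smul_def, map_smul]
    congr 1
    rw [map_sum, Finset.sum_eq_single (a, 0)]
    · simp only
      rw [h_zero, mul_comm, ← Algebra.smul_def, map_smul]
    · rintro ⟨b, c⟩ hbc hne
      rw [Finset.HasAntidiagonal.mem_antidiagonal] at hbc
      simp only at hbc ⊢
      obtain ⟨c, rfl⟩ : ∃ c', c = c' + 1 := by
        refine Nat.exists_eq_succ_of_ne_zero fun h0 => hne ?_
        subst h0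
        simpa using hbc
      rw [Submodule.mkQ_apply, Submodule.Quotient.mk_eq_zero]
      exact Submodule.subset_span ⟨b, c, f, g, by omega, rfl⟩
    · intro h
      exact absurd (Finset.HasAntidiagonal.mem_antidiagonal.2 (Nat.add_zero a)) h
  have hq : ∀ κ f g, q κ (f * g) = ε f * q κ g + ε g * q κ f := by
    intro κ f g
    change (bas (κ.1 + 1)).coord κ.2 (cl (κ.1 + 1) (f * g)) = _
    rw [hcl, map_add, map_smul, map_smul]
    rfl
  have hcly : ∀ κ : J, cl (κ.1 + 1) (y κ) = bas (κ.1 + 1) κ.2 := by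
    intro κ
    apply Subtype.ext
    change (W (κ.1 + 1)).mkQ (hc (κ.1 + 1) (hc (κ.1 + 1) (y0 κ))) = _
    rw [h_idem, hy0]
  have hclτ : ∀ v a (κ : J), κ.1 ≤ a → cl (a + 1) (τ v (y κ)) = cl (a + 1) (y κ) := by
    intro v a κ h
    apply Subtype.ext
    change (W (a + 1)).mkQ (hc (a + 1) (τ v (hc (κ.1 + 1) (y0 κ)))) = (W (a + 1)).mkQ (hc _ _)
    rw [h_shift v _ _ _ (by omega)]
  refine ⟨J, y, ?_, fun κ => ⟨_, _, rfl⟩, ?_⟩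
  · rw [algebraicIndependent_iff]
    intro F hF
    obtain ⟨s, G, rfl⟩ := MvPolynomial.exists_finset_rename F
    rw [aeval_rename] at hF
    have : G = 0 := by
      refine eq_zero_of_aeval_eq_zero (V := V) (fun v => ε.comp (τ v)) h_eval hroot
        (fun t : s => y t) (fun t => t.1.1) (fun t v => q t ∘ₗ (τ v).toLinearMap) ?_ ?_ ?_ G hF
      · intro t v f g
        simp [hq]
      · intro t v
        change (bas (t.1.1 + 1)).coord t.1.2 (cl (t.1.1 + 1) (τ v (y t.1))) = 1
        rw [hclτ v _ _ le_rfl, hcly]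
        simp
      · rintro ⟨⟨a, j⟩, hs⟩ ⟨⟨b, l⟩, ht⟩ v hst hw
        change (bas (b + 1)).coord l (cl (b + 1) (τ v (y ⟨a, j⟩))) = 0
        simp only at hw
        rw [hclτ v _ _ hw]
        rcases hw.eq_or_lt with h | h
        · subst h
          have h1 : j ≠ l := by
            rintro rfl
            exact hst rfl
          rw [hcly ⟨a, j⟩]
          simp [h1]
        · have : cl (b + 1) (y ⟨a, j⟩) = 0 := by
            apply Subtype.ext
            change (W (b + 1)).mkQ (hc (b + 1) (hc (a + 1) _)) = 0
            rw [h_orth _ _ _ (by omega), map_zero]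
          rw [this, map_zero]
    rw [this, map_zero]
  · intro a
    induction a using Nat.strong_induction_on with
    | _ a ih =>
    intro f
    cases a with
    | zero => rw [h_zero]; exact Subalgebra.algebraMap_mem _ _
    | succ a =>
      have hW : W (a + 1) ≤ Subalgebra.toSubmodule (Algebra.adjoin k (Set.range y)) := by
        refine Submodule.span_le.2 ?_
        rintro _ ⟨b, c, f, g, hbc, rfl⟩
        exact Subalgebra.mul_mem _ (ih _ (by omega) f) (ih _ (by omega) g)
      have h1 : (cl (a + 1) f : A ⧸ W (a + 1)) ∈
          (Subalgebra.toSubmodule (Algebra.adjoin k (Set.range y))).map (W (a + 1)).mkQ := by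
        rw [← (bas (a + 1)).linearCombination_repr (cl (a + 1) f), Finsupp.linearCombination_apply,
          Finsupp.sum, Submodule.coe_sum]
        refine Submodule.sum_mem _ fun j _ => ?_
        rw [Submodule.coe_smul]
        refine Submodule.smul_mem _ _ ⟨y ⟨a, j⟩, Algebra.subset_adjoin ⟨_, rfl⟩, ?_⟩
        exact hy0 ⟨a, j⟩
      obtain ⟨z, hz, hz'⟩ := h1
      have h2 : hc (a + 1) f - z ∈ W (a + 1) := by
        rw [← Submodule.Quotient.mk_eq_zero, ← Submodule.mkQ_apply, map_sub, hz', sub_eq_zero]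
        rfl
      have := add_mem (hW h2) hz
      simpa using this

end Abstract

section BdPoly

variable {K : ℕ → Type u} [∀ i, Field (K i)] {n : ℕ → ℕ}

/-- Homogeneous components in the ultraproduct of polynomial rings. -/
noncomputable def hcomp (a : ℕ) : Fl K n →ₗ[UP K] Fl K n :=
  { amap fun i => ((MvPolynomial.homogeneousComponent a :
      MvPolynomial (Fin (n i)) (K i) →ₗ[K i] _) : MvPolynomial (Fin (n i)) (K i) →+ _) with
    map_smul' := fun c f => by
      obtain ⟨c, rfl⟩ := mk_surjective c
      obtain ⟨f, rfl⟩ := mk_surjective f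
      change amap _ (mk c • mk f) = mk c • amap _ (mk f)
      rw [mk_smul_mk, amap_mk, amap_mk, mk_smul_mk]
      congr 1
      ext1 i
      simp }

theorem hcomp_mk (a : ℕ) (f : ∀ i, MvPolynomial (Fin (n i)) (K i)) :
    hcomp a (mk f : Fl K n) = mk fun i => MvPolynomial.homogeneousComponent a (f i) :=
  amap_mk _ f

/-- The constant coefficient in the ultraproduct of polynomial rings. -/
noncomputable def ccoeff : Fl K n →ₐ[UP K] UP K :=
  { rmap fun _ => MvPolynomial.constantCoeff with
    commutes' := fun c => by
      obtain ⟨c, rfl⟩ := mk_surjective c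
      change rmap _ _ = _
      rw [algebraMap_mk, rmap_mk]
      simp }

theorem ccoeff_mk (f : ∀ i, MvPolynomial (Fin (n i)) (K i)) :
    ccoeff (mk f : Fl K n) = mk fun i => MvPolynomial.constantCoeff (f i) :=
  rmap_mk _ f

/-- Translation of the variables in the ultraproduct of polynomial rings. -/
noncomputable def ushift (v : ∀ i, Fin (n i) → K i) : Fl K n →ₐ[UP K] Fl K n :=
  { rmap fun i => (shift (v i) : MvPolynomial (Fin (n i)) (K i) →+* _) with
    commutes' := fun c => by
      obtain ⟨c, rfl⟩ := mk_surjective c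
      change rmap _ _ = _
      rw [algebraMap_mk, rmap_mk]
      congr 1
      ext1 i
      exact (shift (v i)).commutes (c i) }

theorem ushift_mk (v : ∀ i, Fin (n i) → K i) (f : ∀ i, MvPolynomial (Fin (n i)) (K i)) :
    ushift v (mk f : Fl K n) = mk fun i => shift (v i) (f i) :=
  rmap_mk _ f

theorem degLE_hcomp (a : ℕ) (z : Fl K n) : DegLE a (hcomp a z) := by
  obtain ⟨f, rfl⟩ := mk_surjective z
  rw [hcomp_mk, degLE_mk]
  exact Eventually.of_forall fun i =>
    (MvPolynomial.homogeneousComponent_isHomogeneous a (f i)).totalDegree_le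

theorem hcomp_mul (a : ℕ) (f g : Fl K n) : hcomp a (f * g) =
    ∑ x ∈ Finset.HasAntidiagonal.antidiagonal a, hcomp x.1 f * hcomp x.2 g := by
  obtain ⟨f, rfl⟩ := mk_surjective f
  obtain ⟨g, rfl⟩ := mk_surjective g
  rw [← map_mul, hcomp_mk]
  simp_rw [hcomp_mk, ← map_mul, ← map_sum]
  congr 1
  ext1 i
  simp [homogeneousComponent_mul_eq_sum]

theorem hcomp_hcomp (a b : ℕ) (f : Fl K n) :
    hcomp a (hcomp b f) = if a = b then hcomp b f else 0 := by
  obtain ⟨f, rfl⟩ := mk_surjective f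
  rw [hcomp_mk, hcomp_mk]
  have h : ∀ i, MvPolynomial.homogeneousComponent a
      (MvPolynomial.homogeneousComponent b (f i)) =
      if a = b then MvPolynomial.homogeneousComponent b (f i) else 0 := fun i =>
    MvPolynomial.homogeneousComponent_of_mem
      (MvPolynomial.homogeneousComponent_isHomogeneous b (f i))
  simp_rw [h]
  split_ifs
  · rfl
  · exact map_zero mk

theorem hcomp_ushift (v : ∀ i, Fin (n i) → K i) (a : ℕ) {z : Fl K n} (hz : DegLE a z) :
    hcomp a (ushift v z) = hcomp a z := by
  obtain ⟨f, rfl⟩ := mk_surjective z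
  rw [ushift_mk, hcomp_mk, hcomp_mk, mk_eq_mk]
  filter_upwards [degLE_mk.1 hz] with i h
  exact (shift_top (v i) a (f i) h).2

theorem DegLE.sum_hcomp {d : ℕ} {z : Fl K n} (hz : DegLE d z) :
    ∑ a ∈ Finset.range (d + 1), hcomp a z = z := by
  obtain ⟨f, rfl⟩ := mk_surjective z
  simp_rw [hcomp_mk, ← map_sum]
  rw [mk_eq_mk]
  filter_upwards [degLE_mk.1 hz] with i h
  rw [Finset.sum_apply]
  conv_rhs => rw [← MvPolynomial.sum_homogeneousComponent (f i)]
  symm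
  refine Finset.sum_subset (Finset.range_mono (by omega)) fun a _ ha => ?_
  exact MvPolynomial.homogeneousComponent_eq_zero _ _ (by simpa using ha)

theorem eq_zero_of_ccoeff_ushift [∀ i, Infinite (K i)] (z : Fl K n)
    (h : ∀ v : ∀ i, Fin (n i) → K i, ccoeff (ushift v z) = 0) : z = 0 := by
  obtain ⟨f, rfl⟩ := mk_surjective z
  have hv : ∀ i, ∃ v : Fin (n i) → K i, MvPolynomial.eval v (f i) = 0 → f i = 0 := by
    intro i
    by_contra! hc
    have h0 : f i = 0 := MvPolynomial.funext fun v => by rw [(hc v).1, map_zero]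
    exact (hc 0).2 h0
  choose v hv using hv
  have h1 := h v
  rw [ushift_mk, ccoeff_mk, mk_eq_zero] at h1
  rw [mk_eq_zero]
  filter_upwards [h1] with i h2
  rw [constantCoeff_shift] at h2
  exact hv i h2

theorem exists_root [∀ i, IsAlgClosed (K i)] (p : ℕ) (hp : p ≠ 0) (c : UP K) :
    ∃ r, r ^ p = c := by
  obtain ⟨c, rfl⟩ := mk_surjective c
  choose r hr using fun i => IsAlgClosed.exists_pow_nat_eq (c i) (Nat.pos_of_ne_zero hp)
  refine ⟨mk r, ?_⟩
  rw [← map_pow]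
  congr 1
  ext1 i
  exact hr i

variable (K n) in
theorem exists_Bd_equiv [∀ i, IsAlgClosed (K i)] :
    ∃ J : Type u, Nonempty (MvPolynomial J (UP K) ≃ₐ[UP K] Bd K n) := by
  have : ∀ i, Infinite (K i) := fun i => IsAlgClosed.instInfinite
  have h_zero : ∀ f : Fl K n, hcomp 0 f = algebraMap (UP K) (Fl K n) (ccoeff f) := by
    intro f
    obtain ⟨f, rfl⟩ := mk_surjective f
    rw [hcomp_mk, ccoeff_mk, algebraMap_mk]
    simp [MvPolynomial.homogeneousComponent_zero, MvPolynomial.constantCoeff_eq]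
  obtain ⟨J, y, hy, hy1, hy2⟩ := exists_algebraicIndependent_of_graded (k := UP K)
    (A := Fl K n) (V := ∀ i, Fin (n i) → K i) hcomp ccoeff ushift hcomp_mul h_zero
    (fun a f => by simp [hcomp_hcomp]) (fun a b f h => by simp [hcomp_hcomp, h])
    (fun v a b f h => hcomp_ushift v a ((degLE_hcomp b f).mono h))
    eq_zero_of_ccoeff_ushift (fun p hp _ c => exists_root p hp.ne_zero c)
  refine ⟨J, ⟨hy.aevalEquiv.trans (Subalgebra.equivOfEq _ _ (le_antisymm ?_ ?_))⟩⟩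
  · refine Algebra.adjoin_le ?_
    rintro _ ⟨j, rfl⟩
    obtain ⟨a, f, h⟩ := hy1 j
    rw [h]
    exact ⟨a, degLE_hcomp a f⟩
  · rintro z ⟨d, hd⟩
    rw [← hd.sum_hcomp]
    exact sum_mem fun a _ => hy2 a z

end BdPoly

section Division

open MvPolynomial

theorem totalDegree_aeval_le {σ τ k : Type*} [CommRing k] (v : σ → MvPolynomial τ k)
    (hv : ∀ j, (v j).totalDegree ≤ 1) (f : MvPolynomial σ k) :
    (aeval v f).totalDegree ≤ f.totalDegree := by
  rw [aeval_def, eval₂_eq]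
  refine totalDegree_finsetSum_le fun s hs => ?_
  refine (totalDegree_mul _ _).trans ?_
  rw [algebraMap_eq, totalDegree_C, zero_add]
  refine (totalDegree_finsetProd _ _).trans ?_
  refine le_trans ?_ (le_totalDegree hs)
  refine Finset.sum_le_sum fun j _ => ?_
  refine (totalDegree_pow _ _).trans ?_
  exact (Nat.mul_le_mul_left _ (hv j)).trans (by simp)

theorem coeff_aeval_line {σ k : Type*} [CommRing k] (a : σ → k) (e : ℕ) (f : MvPolynomial σ k) :
    (aeval (fun j => Polynomial.C (a j) * Polynomial.X) f : Polynomial k).coeff e =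
      eval a (homogeneousComponent e f) := by
  induction f using MvPolynomial.induction_on' with
  | add p q hp hq => simp [hp, hq]
  | monomial s c =>
    rw [aeval_monomial, homogeneousComponent_of_mem (isHomogeneous_monomial (d := s) c rfl)]
    simp_rw [mul_pow]
    rw [Finsupp.prod_mul]
    have h1 : (s.prod fun j l => (Polynomial.X : Polynomial k) ^ l) = Polynomial.X ^ s.degree := by
      rw [Finsupp.prod, Finset.prod_pow_eq_pow_sum, Finsupp.degree_apply]
    have h2 : (s.prod fun j l => Polynomial.C (a j) ^ l) =
        Polynomial.C (s.prod fun j l => a j ^ l) := by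
      simp [Finsupp.prod]
    rw [h1, h2, ← mul_assoc, Polynomial.algebraMap_apply, ← Polynomial.C_mul,
      Polynomial.coeff_C_mul_X_pow]
    split_ifs <;> simp [eval_monomial]

/-- The substitution adding multiples of the first variable to the other variables. -/
noncomputable def shear {k : Type*} [CommRing k] {m : ℕ} (a : Fin m → k) :
    MvPolynomial (Fin (m + 1)) k →ₐ[k] MvPolynomial (Fin (m + 1)) k :=
  aeval (Fin.cons (X 0) fun j => X j.succ + C (a j) * X 0)

theorem shear_shear {k : Type*} [CommRing k] {m : ℕ} (a b : Fin m → k) (h : ∀ j, a j + b j = 0)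
    (f : MvPolynomial (Fin (m + 1)) k) : shear a (shear b f) = f := by
  have : (shear a).comp (shear b) = AlgHom.id k _ := by
    apply algHom_ext
    intro j
    refine Fin.cases ?_ (fun j => ?_) j
    · simp [shear]
    · simp only [shear, AlgHom.comp_apply, aeval_X, Fin.cons_succ, map_add, map_mul, Fin.cons_zero,
        algHom_C, algebraMap_eq, AlgHom.id_apply]
      rw [add_assoc, ← add_mul, ← map_add, h, map_zero, zero_mul, add_zero]
  exact congrArg (fun φ => φ f) this

theorem totalDegree_shear_le {k : Type*} [CommRing k] {m : ℕ} (a : Fin m → k)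
    (f : MvPolynomial (Fin (m + 1)) k) : (shear a f).totalDegree ≤ f.totalDegree := by
  refine totalDegree_aeval_le _ (fun j => ?_) f
  refine Fin.cases ?_ (fun j => ?_) j
  · simpa using totalDegree_X_le_one _
  · rw [Fin.cons_succ]
    refine (totalDegree_add _ _).trans (max_le (totalDegree_X_le_one _) ?_)
    refine (totalDegree_mul _ _).trans ?_
    rw [totalDegree_C, zero_add]
    exact totalDegree_X_le_one _

theorem totalDegree_shear {k : Type*} [CommRing k] {m : ℕ} (a : Fin m → k)
    (f : MvPolynomial (Fin (m + 1)) k) : (shear a f).totalDegree = f.totalDegree := by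
  refine le_antisymm (totalDegree_shear_le a f) ?_
  conv_lhs => rw [← shear_shear (-a) a (by simp) f]
  exact totalDegree_shear_le _ _

theorem finSuccEquiv_C {k : Type*} [CommRing k] {m : ℕ} (c : k) :
    finSuccEquiv k m (C c) = Polynomial.C (C c) :=
  (finSuccEquiv k m).commutes c

theorem finSuccEquiv_rename_succ {k : Type*} [CommRing k] {m : ℕ} (p : MvPolynomial (Fin m) k) :
    finSuccEquiv k m (rename Fin.succ p) = Polynomial.C p := by
  have : ((finSuccEquiv k m).toAlgHom.comp (rename Fin.succ)).toRingHom = Polynomial.C := by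
    apply ringHom_ext
    · intro c
      simp
    · intro j
      simp [MvPolynomial.finSuccEquiv_X_succ]
  exact congrArg (fun φ => φ p) this

theorem exists_shear_lead {k : Type*} [Field k] [Infinite k] {m : ℕ}
    (f : MvPolynomial (Fin (m + 1)) k) (hf : f ≠ 0) :
    ∃ (a : Fin m → k) (c : k), c ≠ 0 ∧
      (finSuccEquiv k m (shear a f)).coeff f.totalDegree = C c := by
  set e := f.totalDegree with he
  have htop : homogeneousComponent e f ≠ 0 := by
    intro h0
    obtain ⟨s, hs, hse⟩ := Finset.exists_mem_eq_sup f.support (support_nonempty.2 hf)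
      (fun s => s.sum fun _ l => l)
    have := congrArg (coeff s) h0
    rw [coeff_homogeneousComponent, if_pos, coeff_zero] at this
    · exact (mem_support_iff.1 hs) this
    · rw [he, totalDegree, hse, Finsupp.degree_apply]; rfl
  obtain ⟨v, hv⟩ : ∃ v, eval v (X 0 * homogeneousComponent e f) ≠ 0 := by
    by_contra! hc
    exact mul_ne_zero (X_ne_zero 0) htop (MvPolynomial.funext fun v => by rw [hc v, map_zero])
  rw [map_mul, eval_X, mul_ne_zero_iff] at hv
  obtain ⟨hv0, hv⟩ := hv
  let a : Fin m → k := fun j => (v 0)⁻¹ * v j.succ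
  let w : Fin (m + 1) → k := Fin.cons 1 a
  have hw : (fun j => v 0 * w j) = v := by
    ext j
    refine Fin.cases ?_ (fun j => ?_) j
    · simp [w]
    · simp [w, a, mul_inv_cancel_left₀ hv0]
  have hw0 : eval w (homogeneousComponent e f) ≠ 0 := by
    intro h0
    apply hv
    rw [← hw]
    rw [eval_eq] at h0 ⊢
    have : ∀ s ∈ (homogeneousComponent e f).support,
        coeff s (homogeneousComponent e f) * ∏ j ∈ s.support, (v 0 * w j) ^ s j =
        v 0 ^ e * (coeff s (homogeneousComponent e f) * ∏ j ∈ s.support, w j ^ s j) := by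
      intro s hs
      have hse := homogeneousComponent_isHomogeneous e f (mem_support_iff.1 hs)
      have hse' : s.degree = e := by rw [← hse, Finsupp.degree_eq_weight_one]; rfl
      rw [← hse', Finsupp.degree_apply]
      simp_rw [mul_pow, Finset.prod_mul_distrib, Finset.prod_pow_eq_pow_sum]
      ring
    rw [Finset.sum_congr rfl this, ← Finset.mul_sum, h0, mul_zero]
  refine ⟨a, eval w (homogeneousComponent e f), hw0, ?_⟩
  have hline : (Polynomial.mapRingHom constantCoeff).comp
      ((finSuccEquiv k m).toAlgHom.toRingHom.comp (shear a).toRingHom) =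
      (aeval (fun j => Polynomial.C (w j) * Polynomial.X) :
        MvPolynomial (Fin (m + 1)) k →ₐ[k] Polynomial k).toRingHom := by
    apply ringHom_ext
    · intro c
      simp [finSuccEquiv_C]
    · intro j
      refine Fin.cases ?_ (fun j => ?_) j
      · simp [shear, w, MvPolynomial.finSuccEquiv_X_zero]
      · simp [shear, w, MvPolynomial.finSuccEquiv_X_zero, MvPolynomial.finSuccEquiv_X_succ,
          finSuccEquiv_C]
  have hc := congrArg (fun φ => (φ f).coeff e) hline
  simp only [RingHom.comp_apply, Polynomial.coe_mapRingHom, Polynomial.coeff_map] at hc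
  have hc' := coeff_aeval_line w e f
  rw [← hc']
  refine Eq.trans ?_ (congrArg C hc)
  change _ = C (constantCoeff ((finSuccEquiv k m (shear a f)).coeff e))
  by_cases h0 : (finSuccEquiv k m (shear a f)).coeff e = 0
  · rw [h0, map_zero, map_zero]
  · have hdeg := totalDegree_coeff_finSuccEquiv_add_le (shear a f) e h0
    rw [totalDegree_shear] at hdeg
    exact totalDegree_eq_zero_iff_eq_C.1 (by omega)

/-- The substitution `shear a` as an automorphism. -/
noncomputable def shearEquiv {k : Type*} [CommRing k] {m : ℕ} (a : Fin m → k) :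
    MvPolynomial (Fin (m + 1)) k ≃ₐ[k] MvPolynomial (Fin (m + 1)) k :=
  AlgEquiv.ofAlgHom (shear a) (shear (-a))
    (AlgHom.ext fun f => shear_shear a (-a) (fun j => add_neg_cancel (a j)) f)
    (AlgHom.ext fun f => shear_shear (-a) a (fun j => neg_add_cancel (a j)) f)

theorem exists_linear_coordinates {k : Type*} [Field k] [Infinite k] {m : ℕ}
    (f : MvPolynomial (Fin (m + 1)) k) (hf : f ≠ 0) :
    ∃ (σ : MvPolynomial (Fin (m + 1)) k ≃ₐ[k] Polynomial (MvPolynomial (Fin m) k)) (c : k), c ≠ 0 ∧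
      (σ f).coeff f.totalDegree = C c ∧
      (∀ g i, ((σ g).coeff i).totalDegree ≤ g.totalDegree) ∧
      (∀ g i, g.totalDegree < i → (σ g).coeff i = 0) ∧
      (∀ p, (σ.symm (Polynomial.C p)).totalDegree ≤ p.totalDegree) ∧
      (σ.symm Polynomial.X).totalDegree ≤ 1 := by
  obtain ⟨a, c, hc, hlead⟩ := exists_shear_lead f hf
  obtain ⟨σ, hσ⟩ : ∃ σ, σ = (shearEquiv a).trans (finSuccEquiv k m) := ⟨_, rfl⟩
  have h1 : ∀ g, σ g = finSuccEquiv k m (shear a g) := fun g => by rw [hσ]; rfl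
  have h2 : ∀ p, σ.symm p = shear (-a) ((finSuccEquiv k m).symm p) := fun g => by rw [hσ]; rfl
  refine ⟨σ, c, hc, ?_, fun g i => ?_, fun g i hi => ?_, fun p => ?_, ?_⟩
  · rw [h1, hlead]
  · rw [h1]
    by_cases h : (finSuccEquiv k m (shear a g)).coeff i = 0
    · rw [h, totalDegree_zero]
      exact Nat.zero_le _
    · refine le_trans ?_ (totalDegree_shear_le a g)
      exact (Nat.le_add_right _ _).trans (totalDegree_coeff_finSuccEquiv_add_le _ i h)
  · rw [h1]
    by_contra h
    have := totalDegree_coeff_finSuccEquiv_add_le (shear a g) i h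
    rw [totalDegree_shear] at this
    omega
  · rw [h2, ← finSuccEquiv_rename_succ, AlgEquiv.symm_apply_apply]
    exact (totalDegree_shear_le _ _).trans (totalDegree_rename_le _ _)
  · rw [h2, ← MvPolynomial.finSuccEquiv_X_zero, AlgEquiv.symm_apply_apply]
    exact (totalDegree_shear_le _ _).trans (totalDegree_X_le_one _)

theorem exists_reduce_pow {R' R : Type*} [CommRing R'] [CommRing R] (ρ : R' →+* R) (x G : R)
    (e : ℕ) (he : 0 < e) (c : ℕ → R') (hG : G = x ^ e + ∑ l ∈ Finset.range e, ρ (c l) * x ^ l)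
    (deg : ℕ → Set R') (h0 : ∀ s, 0 ∈ deg s) (hc : ∀ l, c l ∈ deg e) (h1 : 1 ∈ deg 0)
    (hm : ∀ s t, s ≤ t → deg s ⊆ deg t)
    (hsub : ∀ s, ∀ a ∈ deg s, ∀ b ∈ deg s, a - b ∈ deg s)
    (hmul : ∀ s t, ∀ a ∈ deg s, ∀ b ∈ deg t, a * b ∈ deg (s + t)) (j : ℕ) :
    ∃ r : ℕ → R', (∀ l, r l ∈ deg (e * j)) ∧
      G ∣ x ^ j - ∑ l ∈ Finset.range e, ρ (r l) * x ^ l := by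
  obtain ⟨e, rfl⟩ : ∃ e', e = e' + 1 := ⟨e - 1, by omega⟩
  induction j with
  | zero =>
    refine ⟨fun l => if l = 0 then 1 else 0, fun l => ?_, ?_⟩
    · dsimp only
      split_ifs
      exacts [hm 0 _ (by omega) h1, h0 _]
    · rw [Finset.sum_eq_single_of_mem 0 (by simp)]
      · simp
      · intro b _ hb
        simp [hb]
  | succ j ih =>
    obtain ⟨r, hr, q, hq⟩ := ih
    refine ⟨fun l => (if l = 0 then 0 else r (l - 1)) - r e * c l, fun l => ?_,
      x * q + ρ (r e), ?_⟩
    · refine hsub _ _ ?_ _ ?_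
      · split_ifs
        exacts [h0 _, hm ((e + 1) * j) _ (by rw [mul_add]; omega) (hr _)]
      · rw [mul_add, mul_one]
        exact hmul _ _ _ (hr _) _ (hc _)
    · have h2 : ∑ l ∈ Finset.range (e + 1), ρ (if l = 0 then 0 else r (l - 1)) * x ^ l =
          x * ∑ l ∈ Finset.range (e + 1), ρ (r l) * x ^ l - ρ (r e) * x ^ (e + 1) := by
        rw [Finset.sum_range_succ', Finset.sum_range_succ (n := e), mul_add, Finset.mul_sum]
        simp only [Nat.add_eq_zero_iff, one_ne_zero, and_false, if_false, Nat.add_sub_cancel,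
          if_true, map_zero, zero_mul, add_zero]
        rw [Finset.sum_congr rfl fun l _ => show ρ (r l) * x ^ (l + 1) = x * (ρ (r l) * x ^ l) by
          ring]
        ring
      simp only [map_sub, sub_mul, Finset.sum_sub_distrib, h2, map_mul]
      have h3 : ∑ l ∈ Finset.range (e + 1), ρ (r e) * ρ (c l) * x ^ l =
          ρ (r e) * (G - x ^ (e + 1)) := by
        rw [hG, add_sub_cancel_left, Finset.mul_sum]
        exact Finset.sum_congr rfl fun l _ => by ring
      rw [h3]
      linear_combination x * hq

theorem exists_division_field {k : Type*} [Field k] [Infinite k] (n : ℕ)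
    (f : MvPolynomial (Fin n) k) : ∃ (θ : MvPolynomial (Fin (n - 1)) k →ₐ[k] MvPolynomial (Fin n) k)
      (x : MvPolynomial (Fin n) k), x.totalDegree ≤ 1 ∧
      (∀ p, (θ p).totalDegree ≤ p.totalDegree) ∧ (f.totalDegree ≠ 0 →
      (∀ g, ∃ (r : Fin f.totalDegree → MvPolynomial (Fin (n - 1)) k) (q : MvPolynomial (Fin n) k),
        g = ∑ j, θ (r j) * x ^ (j : ℕ) + f * q ∧
        (∀ j, (r j).totalDegree ≤ g.totalDegree + f.totalDegree * g.totalDegree)) ∧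
      (∀ (r : Fin f.totalDegree → MvPolynomial (Fin (n - 1)) k) (q : MvPolynomial (Fin n) k),
        ∑ j, θ (r j) * x ^ (j : ℕ) + f * q = 0 → r = 0)) := by
  obtain _ | m := n
  · refine ⟨AlgHom.id k _, 0, by simp, fun p => le_rfl, fun h => absurd ?_ h⟩
    rw [MvPolynomial.eq_C_of_isEmpty f, totalDegree_C]
  by_cases hf : f.totalDegree = 0
  · refine ⟨rename Fin.succ, 0, by simp, totalDegree_rename_le _, fun h => absurd hf h⟩
  have hf0 : f ≠ 0 := by rintro rfl; simp at hf
  obtain ⟨σ, c, hc, hlead, hcoef, hcoef0, hC, hX⟩ := exists_linear_coordinates f hf0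
  obtain ⟨e, he⟩ : ∃ e, e = f.totalDegree := ⟨_, rfl⟩
  rw [← he] at hf hlead ⊢
  obtain ⟨P, hP⟩ : ∃ P, P = σ f := ⟨_, rfl⟩
  rw [← hP] at hlead
  obtain ⟨G, hG⟩ : ∃ G, G = Polynomial.C (C c⁻¹) * P := ⟨_, rfl⟩
  have hGe : G = Polynomial.X ^ e +
      ∑ l ∈ Finset.range e, Polynomial.C (C c⁻¹ * P.coeff l) * Polynomial.X ^ l := by
    have h1 : P.natDegree < e + 1 := by
      rw [Nat.lt_succ_iff, Polynomial.natDegree_le_iff_coeff_eq_zero]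
      intro i hi
      exact hP ▸ hcoef0 f _ (by omega)
    rw [hG]
    conv_lhs => rw [P.as_sum_range' _ h1]
    rw [Finset.sum_range_succ, hlead, mul_add, add_comm, ← Polynomial.C_mul_X_pow_eq_monomial,
      ← mul_assoc, ← Polynomial.C_mul, ← C_mul, inv_mul_cancel₀ hc, C_1, Polynomial.C_1, one_mul,
      Finset.mul_sum]
    refine congrArg (_ + ·) (Finset.sum_congr rfl fun l _ => ?_)
    rw [← Polynomial.C_mul_X_pow_eq_monomial, ← mul_assoc, ← Polynomial.C_mul]
  have hlow : (∑ l ∈ Finset.range e, Polynomial.C (C c⁻¹ * P.coeff l) * Polynomial.X ^ l).degree <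
      (e : WithBot ℕ) := by
    refine (Polynomial.degree_sum_le _ _).trans_lt ((Finset.sup_lt_iff (WithBot.bot_lt_coe e)).2 ?_)
    intro l hl
    exact (Polynomial.degree_C_mul_X_pow_le _ _).trans_lt (Nat.cast_lt.2 (Finset.mem_range.1 hl))
  have hGm : G.Monic := by
    rw [hGe]
    exact Polynomial.monic_X_pow_add hlow
  have hGdeg : G.degree = e := by
    rw [hGe, Polynomial.degree_add_eq_left_of_degree_lt, Polynomial.degree_X_pow]
    rwa [Polynomial.degree_X_pow]
  have hkey : ∀ j, ∃ r : ℕ → MvPolynomial (Fin m) k, (∀ l, (r l).totalDegree ≤ e * j) ∧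
      G ∣ Polynomial.X ^ j - ∑ l ∈ Finset.range e, Polynomial.C (r l) * Polynomial.X ^ l :=
    exists_reduce_pow Polynomial.C Polynomial.X G e (Nat.pos_of_ne_zero hf) _ hGe
      (fun s => {p | p.totalDegree ≤ s}) (by simp) (fun l => by
        refine (totalDegree_mul _ _).trans ?_
        rw [totalDegree_C, zero_add]
        rw [hP, he]
        exact hcoef _ _) (by simp) (fun s t h p hp => le_trans hp h)
      (fun s a ha b hb => (totalDegree_sub _ _).trans (max_le ha hb))
      (fun s t a ha b hb => (totalDegree_mul _ _).trans (add_le_add ha hb))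
  choose r hr hrG using hkey
  have hPG : P ∣ G := ⟨_, hG.trans (mul_comm _ _)⟩
  have hGP : G ∣ P := ⟨Polynomial.C (C c), by
    rw [hG, mul_right_comm, ← Polynomial.C_mul, ← C_mul, inv_mul_cancel₀ hc, C_1, Polynomial.C_1,
      one_mul]⟩
  refine ⟨σ.symm.toAlgHom.comp Polynomial.CAlgHom, σ.symm Polynomial.X,
    hX, fun p => hC p, fun _ => ⟨fun g => ?_, ?_⟩⟩
  · obtain ⟨p, hp⟩ : ∃ p, p = σ g := ⟨_, rfl⟩
    obtain ⟨s, hs⟩ : ∃ s, s = g.totalDegree := ⟨_, rfl⟩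
    have hps : p = ∑ j ∈ Finset.range (s + 1), Polynomial.C (p.coeff j) * Polynomial.X ^ j := by
      simp_rw [Polynomial.C_mul_X_pow_eq_monomial]
      refine p.as_sum_range' _ ?_
      rw [Nat.lt_succ_iff, Polynomial.natDegree_le_iff_coeff_eq_zero]
      intro i hi
      exact hp ▸ hcoef0 g _ (by omega)
    let ρ : ℕ → MvPolynomial (Fin m) k := fun l => ∑ j ∈ Finset.range (s + 1), p.coeff j * r j l
    have hdvd : G ∣ p - ∑ l ∈ Finset.range e, Polynomial.C (ρ l) * Polynomial.X ^ l := by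
      have : p - ∑ l ∈ Finset.range e, Polynomial.C (ρ l) * Polynomial.X ^ l =
          ∑ j ∈ Finset.range (s + 1), Polynomial.C (p.coeff j) * (Polynomial.X ^ j -
            ∑ l ∈ Finset.range e, Polynomial.C (r j l) * Polynomial.X ^ l) := by
        simp_rw [mul_sub, Finset.sum_sub_distrib, ← hps, Finset.mul_sum]
        rw [Finset.sum_comm]
        simp_rw [ρ, map_sum, Finset.sum_mul, Polynomial.C_mul, mul_assoc]
      rw [this]
      exact Finset.dvd_sum fun j _ => (hrG j).mul_left _
    have hdvd' := hPG.trans hdvd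
    obtain ⟨q, hq⟩ := hdvd'
    refine ⟨fun l => ρ l, σ.symm q, ?_, fun l => ?_⟩
    · apply σ.injective
      rw [← hp, map_add, map_mul, ← hP, σ.apply_symm_apply, ← hq, map_sum,
        ← Fin.sum_univ_eq_sum_range (fun l => Polynomial.C (ρ l) * Polynomial.X ^ l)]
      simp only [map_mul, map_pow, σ.apply_symm_apply]
      rw [eq_comm, add_comm]
      refine (congrArg _ ?_).trans (sub_add_cancel _ _)
      exact Finset.sum_congr rfl fun l _ => congrArg (· * _) (σ.apply_symm_apply _)
    · rw [← hs]
      refine totalDegree_finsetSum_le fun j hj => (totalDegree_mul _ _).trans ?_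
      refine add_le_add (hp ▸ hs ▸ hcoef _ _) ((hr j l).trans ?_)
      exact Nat.mul_le_mul_left _ (Nat.lt_succ_iff.1 (Finset.mem_range.1 hj))
  · intro r q h
    have h1 := congrArg σ h
    rw [map_add, map_mul, ← hP, map_sum, map_zero] at h1
    have h4 : ∑ j : Fin e, Polynomial.C (r j) * Polynomial.X ^ (j : ℕ) + P * σ q = 0 := by
      refine Eq.trans ?_ h1
      refine congrArg (· + _) (Finset.sum_congr rfl fun l _ => ?_)
      rw [map_mul, map_pow, σ.apply_symm_apply]
      exact congrArg (· * _) (σ.apply_symm_apply _).symm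
    have h2 : ∑ j : Fin e, Polynomial.C (r j) * Polynomial.X ^ (j : ℕ) = 0 := by
      refine Polynomial.eq_zero_of_dvd_of_degree_lt (p := G) ?_ ?_
      · rw [eq_neg_of_add_eq_zero_left h4]
        exact (hGP.mul_right _).neg_right
      · rw [hGdeg]
        refine (Polynomial.degree_sum_le _ _).trans_lt
          ((Finset.sup_lt_iff (WithBot.bot_lt_coe e)).2 ?_)
        intro l _
        exact (Polynomial.degree_C_mul_X_pow_le _ _).trans_lt (Nat.cast_lt.2 l.2)
    ext1 j
    have h3 := congrArg (fun p => p.coeff (j : ℕ)) h2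
    simp only [Polynomial.finsetSum_coeff, Polynomial.coeff_C_mul, Polynomial.coeff_X_pow,
      Polynomial.coeff_zero] at h3
    simpa [Fin.val_inj] using h3

end Division

section UltraDivision

variable {K : ℕ → Type u} [∀ i, Field (K i)] {n : ℕ → ℕ}

theorem exists_degree {D : Fl K n} (hD : D ∈ Bd K n) :
    ∃ e, ∀ᶠ i in U, (rep D i).totalDegree = e := by
  obtain ⟨d, hd⟩ := hD
  have h1 : ∀ᶠ i in U, ∃ e ∈ Finset.range (d + 1), (rep D i).totalDegree = e := by
    filter_upwards [hd] with i hi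
    exact ⟨_, by simpa [Nat.lt_succ_iff] using hi, rfl⟩
  obtain ⟨e, -, he⟩ := (Ultrafilter.eventually_exists_mem_iff (Finset.finite_toSet _)).1 h1
  exact ⟨e, he⟩

theorem exists_division [∀ i, Infinite (K i)] (D : Fl K n) (hD : D ∈ Bd K n)
    (hD0 : D ∉ Set.range (algebraMap (UP K) (Fl K n))) :
    ∃ (n' : ℕ → ℕ) (θ : Fl K n' →+* Fl K n) (x : Fl K n) (e : ℕ),
      x ∈ Bd K n ∧ (∀ z ∈ Bd K n', θ z ∈ Bd K n) ∧
      (∀ g, ∃ (r : Fin e → Fl K n') (q : Fl K n),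
        g = ∑ j, θ (r j) * x ^ (j : ℕ) + D * q ∧
        (g ∈ Bd K n → (∀ j, r j ∈ Bd K n') ∧ q ∈ Bd K n)) ∧
      (∀ (r : Fin e → Fl K n') (q : Fl K n),
        ∑ j, θ (r j) * x ^ (j : ℕ) + D * q = 0 → r = 0) := by
  obtain ⟨e, he⟩ := exists_degree hD
  have hD1 : D ≠ 0 := by
    rintro rfl
    exact hD0 ⟨0, map_zero _⟩
  have he0 : e ≠ 0 := by
    rintro rfl
    apply hD0
    refine ⟨mk fun i => MvPolynomial.constantCoeff (rep D i), ?_⟩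
    rw [algebraMap_mk, ← mk_rep D, mk_eq_mk]
    filter_upwards [he, rep_mk (rep D)] with i hi h2
    rw [h2, MvPolynomial.constantCoeff_eq]
    exact (MvPolynomial.totalDegree_eq_zero_iff_eq_C.1 hi).symm
  choose θ x hx hθ hdiv using fun i => exists_division_field (n i) (rep D i)
  refine ⟨fun i => n i - 1, rmap fun i => (θ i : _ →+* _), mk x, e, ⟨1, ?_⟩, ?_, ?_, ?_⟩
  · exact degLE_mk.2 (Eventually.of_forall hx)
  · rintro z ⟨d, hd⟩
    refine ⟨d, ?_⟩
    rw [rmap_eq, degLE_mk]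
    filter_upwards [hd] with i hi
    exact (hθ i _).trans hi
  · intro g
    have hg : ∀ i, ∃ (r : Fin e → MvPolynomial (Fin (n i - 1)) (K i))
        (q : MvPolynomial (Fin (n i)) (K i)), (rep D i).totalDegree = e →
        rep g i = ∑ j, θ i (r j) * x i ^ (j : ℕ) + rep D i * q ∧
        (∀ j, (r j).totalDegree ≤ (rep g i).totalDegree + e * (rep g i).totalDegree) := by
      intro i
      by_cases h : (rep D i).totalDegree = e
      · obtain ⟨r, q, h1, h2⟩ := (hdiv i (by omega)).1 (rep g i)
        subst h
        exact ⟨r, q, fun _ => ⟨h1, h2⟩⟩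
      · exact ⟨0, 0, fun h' => absurd h' h⟩
    choose r q hrq using hg
    have hgeq : g = ∑ j, rmap (fun i => (θ i : _ →+* _)) (mk fun i => r i j) * mk x ^ (j : ℕ) +
        D * mk q := by
      conv_lhs => rw [← mk_rep g]
      conv_rhs => rw [← mk_rep D]
      simp_rw [rmap_mk, ← map_pow, ← map_mul, ← map_sum, ← map_add]
      rw [mk_eq_mk]
      filter_upwards [he] with i hi
      simpa using (hrq i hi).1
    refine ⟨fun j => mk fun i => r i j, mk q, hgeq, ?_⟩
    rintro ⟨s, hs⟩
    have hr : ∀ j, DegLE (s + e * s) (mk fun i => r i j : Fl K fun i => n i - 1) := by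
      intro j
      rw [degLE_mk]
      filter_upwards [he, hs] with i h1 h2
      exact ((hrq i h1).2 j).trans (add_le_add h2 (Nat.mul_le_mul_left _ h2))
    refine ⟨fun j => ⟨_, hr j⟩, s + (s + e * s + e), ?_⟩
    rw [degLE_mk]
    filter_upwards [he, hs, ne_zero_iff.1 hD1] with i h1 h2 h3
    have h4 : rep D i * q i = rep g i - ∑ j, θ i (r i j) * x i ^ (j : ℕ) := by
      rw [(hrq i h1).1]; ring
    by_cases hq : q i = 0
    · simp [hq]
    have h5 := MvPolynomial.totalDegree_mul_of_isDomain h3 hq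
    have h6 : (rep D i * q i).totalDegree ≤ s + (s + e * s + e) := by
      rw [h4]
      refine (MvPolynomial.totalDegree_sub _ _).trans (max_le (by omega) ?_)
      refine MvPolynomial.totalDegree_finsetSum_le fun j _ => ?_
      refine (MvPolynomial.totalDegree_mul _ _).trans ?_
      have h7 := (hrq i h1).2 j
      have h8 := (hθ i (r i j))
      have h9 : (x i ^ (j : ℕ)).totalDegree ≤ e := by
        refine (MvPolynomial.totalDegree_pow _ _).trans ?_
        calc (j : ℕ) * (x i).totalDegree ≤ j * 1 := Nat.mul_le_mul_left _ (hx i)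
          _ ≤ e := by omega
      have h10 : e * (rep g i).totalDegree ≤ e * s := Nat.mul_le_mul_left _ h2
      omega
    omega
  · intro r q h
    have h1 : mk (fun i => ∑ j, θ i (rep (r j) i) * x i ^ (j : ℕ) + rep D i * rep q i) =
        (0 : Fl K n) := by
      rw [← h]
      conv_rhs => rw [← mk_rep D, ← mk_rep q]
      simp_rw [rmap_eq, ← map_pow, ← map_mul, ← map_sum, ← map_add]
      rw [mk_eq_mk]
      exact Eventually.of_forall fun i => by simp
    rw [mk_eq_zero] at h1
    ext1 j
    rw [Pi.zero_apply, eq_zero_iff]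
    filter_upwards [h1, he] with i h2 h3
    subst h3
    exact congrFun ((hdiv i he0).2 (fun j => rep (r j) i) (rep q i) h2) j

end UltraDivision

open CategoryTheory

/-- `PD B p M`: the `B`-module `M` has projective dimension at most `p`. -/
def PD (B : Type u) [CommRing B] (p : ℕ) (M : Type u) [AddCommGroup M] [Module B M] : Prop :=
  HasProjectiveDimensionLT (ModuleCat.of B M) (p + 1)

section
variable {B : Type u} [CommRing B] {X Y Z M : Type u} [AddCommGroup X] [AddCommGroup Y]
  [AddCommGroup Z] [AddCommGroup M] [Module B X] [Module B Y] [Module B Z] [Module B M]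

theorem pd_zero_iff : PD B 0 M ↔ Module.Projective B M := by
  unfold PD
  rw [zero_add, ← projective_iff_hasProjectiveDimensionLT_one, ← IsProjective.iff_projective]

theorem PD.mono {p q : ℕ} (h : PD B p M) (hpq : p ≤ q) : PD B q M :=
  have : HasProjectiveDimensionLT (ModuleCat.of B M) (p + 1) := h
  hasProjectiveDimensionLT_of_ge (ModuleCat.of B M) (p + 1) (q + 1) (by omega)

theorem pd_of_projective [h : Module.Projective B M] (p : ℕ) : PD B p M :=
  (pd_zero_iff.2 h).mono (Nat.zero_le p)

theorem PD.of_equiv {p : ℕ} (e : X ≃ₗ[B] Y) (h : PD B p X) : PD B p Y :=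
  have : HasProjectiveDimensionLE (ModuleCat.of B X) p := h
  ModuleCat.hasProjectiveDimensionLE_of_linearEquiv (M := ModuleCat.of B X)
    (N := ModuleCat.of B Y) e p

variable (f : X →ₗ[B] Y) (g : Y →ₗ[B] Z)

theorem shortExact_of (hf : Function.Injective f) (hg : Function.Surjective g)
    (hfg : Function.Exact f g) :
    (ShortComplex.moduleCatMk f g hfg.linearMap_comp_eq_zero).ShortExact where
  exact := (ShortComplex.ShortExact.moduleCat_exact_iff_function_exact _).2 hfg
  mono_f := (ModuleCat.mono_iff_injective _).2 hf
  epi_g := (ModuleCat.epi_iff_surjective _).2 hg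

variable {f g} {p : ℕ}

theorem PD.right (hf : Function.Injective f) (hg : Function.Surjective g)
    (hfg : Function.Exact f g) (h1 : PD B p X) (h2 : PD B (p + 1) Y) : PD B (p + 1) Z :=
  (shortExact_of f g hf hg hfg).hasProjectiveDimensionLT_X₃ (p + 1) h1 h2

theorem PD.left (hf : Function.Injective f) (hg : Function.Surjective g)
    (hfg : Function.Exact f g) (h2 : PD B p Y) (h3 : PD B (p + 1) Z) : PD B p X :=
  (shortExact_of f g hf hg hfg).hasProjectiveDimensionLT_X₁ (p + 1) h2 h3

end

section
variable {B : Type u} [CommRing B] {L M : Type u} [AddCommGroup L] [AddCommGroup M]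
  [Module B L] [Module B M] {p : ℕ}

theorem PD.ker [Module.Projective B L] {g : L →ₗ[B] M} (hg : Function.Surjective g)
    (h : PD B (p + 1) M) : PD B p (LinearMap.ker g) :=
  PD.left (f := (LinearMap.ker g).subtype) (g := g) Subtype.val_injective hg
    (LinearMap.exact_subtype_ker_map g) (pd_of_projective p) h

variable (B M) in
theorem freeCover_surjective :
    Function.Surjective (Finsupp.linearCombination B (id : M → M)) := fun m =>
  ⟨Finsupp.single m 1, by simp⟩

open TensorProduct in
theorem PD.baseChange (A : Type u) [CommRing A] [Algebra B A] [Module.Flat B A] :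
    ∀ {p : ℕ} {M : Type u} [AddCommGroup M] [Module B M], PD B p M → PD A p (A ⊗[B] M) := by
  intro p
  induction p with
  | zero =>
    intro M _ _ h
    have := pd_zero_iff.1 h
    exact pd_of_projective 0
  | succ p ih =>
    intro M _ _ h
    have hs := freeCover_surjective B M
    refine PD.right (f := (LinearMap.ker (Finsupp.linearCombination B
        (id : M → M))).subtype.baseChange A)
      (g := (Finsupp.linearCombination B (id : M → M)).baseChange A) ?_ ?_ ?_
      (ih (h.ker hs)) (pd_of_projective _)
    · exact Module.Flat.lTensor_preserves_injective_linearMap _ Subtype.val_injective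
    · exact LinearMap.lTensor_surjective A hs
    · exact lTensor_exact A (LinearMap.exact_subtype_ker_map _) hs

end

open CategoryTheory

section
open TensorProduct Polynomial
variable {A : Type u} [CommRing A] {N : Type u} [AddCommGroup N] [Module A[X] N] [Module A N]
  [IsScalarTower A A[X] N]

variable (A N) in
/-- Multiplication by `X` on `N`, as an `A`-linear map. -/
noncomputable def xmul : N →ₗ[A] N where
  toFun n := (X : A[X]) • n
  map_add' := smul_add _
  map_smul' a n := by
    simp only [RingHom.id_apply]
    rw [← algebraMap_smul A[X] a n, ← algebraMap_smul A[X] a (X • n), smul_smul, smul_smul,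
      mul_comm]

@[simp] theorem xmul_apply (n : N) : xmul A N n = (X : A[X]) • n := rfl

variable (A N) in
/-- The map `X ⊗ 1 - 1 ⊗ X`. -/
noncomputable def xdiff : A[X] ⊗[A] N →ₗ[A[X]] A[X] ⊗[A] N :=
  LinearMap.lsmul A[X] (A[X] ⊗[A] N) X - (xmul A N).baseChange A[X]

theorem xdiff_tmul (P : A[X]) (n : N) :
    xdiff A N (P ⊗ₜ n) = (X * P) ⊗ₜ n - P ⊗ₜ ((X : A[X]) • n) := by
  simp [xdiff, smul_tmul']

variable (A N) in
/-- The action map. -/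
noncomputable def xact : A[X] ⊗[A] N →ₗ[A[X]] N :=
  AlgebraTensorModule.lift ((LinearMap.lsmul A[X] N).flip.restrictScalars A).flip

theorem xact_tmul (P : A[X]) (n : N) : xact A N (P ⊗ₜ n) = P • n := by
  simp [xact]

variable (A N) in
/-- The coefficients of an element of `A[X] ⊗ N`. -/
noncomputable def xcoeff (i : ℕ) : A[X] ⊗[A] N →ₗ[A] N :=
  (TensorProduct.lid A N).toLinearMap ∘ₗ (lcoeff A i).rTensor N

omit [Module A[X] N] [IsScalarTower A A[X] N] in
theorem xcoeff_tmul (i : ℕ) (P : A[X]) (n : N) : xcoeff A N i (P ⊗ₜ n) = P.coeff i • n := by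
  simp [xcoeff]

omit [Module A[X] N] [IsScalarTower A A[X] N] in
theorem exists_eq_sum_xcoeff (z : A[X] ⊗[A] N) :
    ∃ m, ∀ i, m ≤ i → xcoeff A N i z = 0 ∧
      z = ∑ j ∈ Finset.range i, (X ^ j : A[X]) ⊗ₜ xcoeff A N j z := by
  induction z with
  | zero => exact ⟨0, fun i _ => by simp⟩
  | tmul P n =>
    refine ⟨P.natDegree + 1, fun i hi => ⟨?_, ?_⟩⟩
    · rw [xcoeff_tmul, coeff_eq_zero_of_natDegree_lt (by omega), zero_smul]
    · conv_lhs => rw [P.as_sum_range' i (by omega)]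
      rw [sum_tmul]
      refine Finset.sum_congr rfl fun j _ => ?_
      rw [xcoeff_tmul, ← smul_tmul, smul_X_eq_monomial]
  | add y z hy hz =>
    obtain ⟨a, ha⟩ := hy
    obtain ⟨b, hb⟩ := hz
    refine ⟨max a b, fun i hi => ?_⟩
    obtain ⟨h1, h2⟩ := ha i (le_of_max_le_left hi)
    obtain ⟨h3, h4⟩ := hb i (le_of_max_le_right hi)
    refine ⟨by rw [map_add, h1, h3, add_zero], ?_⟩
    conv_lhs => rw [h2, h4, ← Finset.sum_add_distrib]
    exact Finset.sum_congr rfl fun j _ => by rw [map_add, tmul_add]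

theorem xcoeff_succ_xdiff (i : ℕ) (z : A[X] ⊗[A] N) :
    xcoeff A N (i + 1) (xdiff A N z) = xcoeff A N i z - (X : A[X]) • xcoeff A N (i + 1) z := by
  induction z with
  | zero => simp
  | tmul P n =>
    rw [xdiff_tmul, map_sub, xcoeff_tmul, xcoeff_tmul, xcoeff_tmul, xcoeff_tmul, coeff_X_mul,
      smul_algebra_smul_comm (P.coeff (i + 1)) (X : A[X]) n]
  | add y z hy hz => rw [map_add, map_add, map_add, map_add, hy, hz, smul_add]; abel

theorem xdiff_injective : Function.Injective (xdiff A N) := by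
  rw [← LinearMap.ker_eq_bot, LinearMap.ker_eq_bot']
  intro z hz
  obtain ⟨m, hm⟩ := exists_eq_sum_xcoeff z
  have h : ∀ k i, m ≤ i + k → xcoeff A N i z = 0 := by
    intro k
    induction k with
    | zero => exact fun i hi => (hm i hi).1
    | succ k ih =>
      intro i hi
      have := xcoeff_succ_xdiff i z
      rw [hz, map_zero, ih (i + 1) (by omega), smul_zero, sub_zero] at this
      exact this.symm
  rw [(hm m le_rfl).2]
  exact Finset.sum_eq_zero fun j _ => by rw [h m j (by omega), tmul_zero]

theorem sub_one_tmul_xact_mem (z : A[X] ⊗[A] N) :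
    z - 1 ⊗ₜ xact A N z ∈ LinearMap.range (xdiff A N) := by
  induction z with
  | zero => simp
  | tmul P n =>
    induction P using Polynomial.induction_on' with
    | add p q hp hq =>
      have := Submodule.add_mem _ hp hq
      rw [add_tmul, map_add, tmul_add]
      convert this using 1
      abel
    | monomial k a =>
      have key : ∀ (k : ℕ) (n : N), (X ^ k : A[X]) ⊗ₜ n - 1 ⊗ₜ ((X ^ k : A[X]) • n) ∈
          LinearMap.range (xdiff A N) := by
        intro k
        induction k with
        | zero => intro n; simp
        | succ k ih =>
          intro n
          have h1 := ih ((X : A[X]) • n)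
          have h2 : xdiff A N ((X ^ k : A[X]) ⊗ₜ n) ∈ LinearMap.range (xdiff A N) := ⟨_, rfl⟩
          rw [xdiff_tmul] at h2
          have := Submodule.add_mem _ h1 h2
          convert this using 1
          rw [smul_smul, ← pow_succ, ← pow_succ']
          abel
      have h3 := key k (a • n)
      rw [xact_tmul, ← smul_X_eq_monomial, smul_tmul, smul_assoc]
      rwa [smul_algebra_smul_comm] at h3
  | add y z hy hz =>
    have := Submodule.add_mem _ hy hz
    rw [map_add, tmul_add]
    convert this using 1
    abel

theorem xact_surjective : Function.Surjective (xact A N) := fun n =>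
  ⟨1 ⊗ₜ n, by rw [xact_tmul, one_smul]⟩

theorem exact_xdiff_xact : Function.Exact (xdiff A N) (xact A N) := by
  intro z
  constructor
  · intro hz
    have := sub_one_tmul_xact_mem z
    rwa [hz, tmul_zero, sub_zero] at this
  · rintro ⟨y, rfl⟩
    induction y with
    | zero => simp
    | tmul P n => rw [xdiff_tmul, map_sub, xact_tmul, xact_tmul, smul_smul, mul_comm, sub_self]
    | add y z hy hz => rw [map_add, map_add, hy, hz, add_zero]

theorem PD.polynomial {p : ℕ} (h : PD A p N) : PD A[X] (p + 1) N :=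
  PD.right xdiff_injective xact_surjective exact_xdiff_xact (h.baseChange A[X])
    ((h.baseChange A[X]).mono (Nat.le_succ p))

end

theorem pd_of_ringEquiv {A B : Type u} [CommRing A] [CommRing B] (e : A ≃+* B) {p : ℕ}
    (h : ∀ (M : Type u) [AddCommGroup M] [Module A M], PD A p M)
    (M : Type u) [AddCommGroup M] [Module B M] : PD B p M := by
  let _ := Module.compHom M e.toRingHom
  have : HasProjectiveDimensionLE (ModuleCat.of A M) p := h M
  let _ := RingHomInvPair.of_ringEquiv e
  let _ := (RingHomInvPair.of_ringEquiv e).symm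
  let e' : (ModuleCat.of A M) ≃ₛₗ[RingHomClass.toRingHom e] (ModuleCat.of B M) :=
    { toFun := fun x => x
      invFun := fun x => x
      map_add' := fun _ _ => rfl
      map_smul' := fun _ _ => rfl
      left_inv := fun _ => rfl
      right_inv := fun _ => rfl }
  exact ModuleCat.hasProjectiveDimensionLE_of_semiLinearEquiv e e' p

theorem pd_mvPolynomial (k : Type u) [Field k] (b : ℕ) :
    ∀ (M : Type u) [AddCommGroup M] [Module (MvPolynomial (Fin b) k) M],
      PD (MvPolynomial (Fin b) k) b M := by
  induction b with
  | zero =>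
    intro M _ _
    exact pd_of_ringEquiv (MvPolynomial.isEmptyRingEquiv k (Fin 0)).symm
      (fun M _ _ => pd_of_projective 0) M
  | succ b ih =>
    intro M _ _
    refine pd_of_ringEquiv (MvPolynomial.finSuccEquiv k b).symm.toRingEquiv (fun M _ _ => ?_) M
    let _ := Module.compHom M (Polynomial.C (R := MvPolynomial (Fin b) k))
    have : IsScalarTower (MvPolynomial (Fin b) k) (Polynomial (MvPolynomial (Fin b) k)) M :=
      IsScalarTower.of_algebraMap_smul fun _ _ => rfl
    exact (ih M).polynomial

/-- Every element of `B` has a unique remainder `∑ j < e, r j • x ^ j`, with `r j` in `B'`, modulo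
`D`. -/
structure Division (B' B : Type u) [CommRing B'] [CommRing B] [Algebra B' B] (D x : B) (e : ℕ) :
    Prop where
  exists_eq : ∀ g, ∃ (r : Fin e → B') (q : B), g = ∑ j, r j • x ^ (j : ℕ) + D * q
  unique : ∀ (r : Fin e → B') (q : B), ∑ j, r j • x ^ (j : ℕ) + D * q = 0 → r = 0

theorem exists_factor {B L M P : Type u} [CommRing B] [AddCommGroup L] [AddCommGroup M]
    [AddCommGroup P] [Module B L] [Module B M] [Module B P] {g : L →ₗ[B] M}
    (hg : Function.Surjective g) (τ : L →ₗ[B] P) (h : ∀ l, g l = 0 → τ l = 0) :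
    ∃ i : M →ₗ[B] P, ∀ l, i (g l) = τ l := by
  refine ⟨(LinearMap.ker g).liftQ τ (fun l hl => h l hl) ∘ₗ
    (g.quotKerEquivOfSurjective hg).symm.toLinearMap, fun l => ?_⟩
  have : (g.quotKerEquivOfSurjective hg).symm (g l) = Submodule.Quotient.mk l := by
    rw [LinearEquiv.symm_apply_eq]
    rfl
  simp only [LinearMap.comp_apply, LinearEquiv.coe_coe, this]
  rfl

section
variable {B' B : Type u} [CommRing B'] [CommRing B] [Algebra B' B] {D x : B} {e : ℕ}

variable (B') in
noncomputable def synth (x : B) (e : ℕ) : (Fin e → B') →ₗ[B'] B where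
  toFun r := ∑ j, r j • x ^ (j : ℕ)
  map_add' r s := by simp [add_smul, Finset.sum_add_distrib]
  map_smul' a r := by simp [mul_smul, Finset.smul_sum]

theorem synth_apply (r : Fin e → B') : synth B' x e r = ∑ j, r j • x ^ (j : ℕ) := rfl

variable [IsDomain B]

theorem Division.exists_maps (h : Division B' B D x e) (hD : D ≠ 0) :
    ∃ (rem : B →ₗ[B'] (Fin e → B')) (quo : B →ₗ[B'] B),
      (∀ g, g = synth B' x e (rem g) + D * quo g) ∧ (∀ g, rem (D * g) = 0) ∧
      ∀ g, quo (D * g) = g := by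
  have uniq : ∀ (r r' : Fin e → B') (q q' : B),
      synth B' x e r + D * q = synth B' x e r' + D * q' → r = r' ∧ q = q' := by
    intro r r' q q' hh
    have h1 : r - r' = 0 := by
      apply h.unique _ (q - q')
      rw [← synth_apply, map_sub]
      linear_combination hh
    have h2 := sub_eq_zero.1 h1
    refine ⟨h2, mul_left_cancel₀ hD ?_⟩
    subst h2
    exact add_left_cancel hh
  choose r q hrq using h.exists_eq
  have hrq' : ∀ g, g = synth B' x e (r g) + D * q g := hrq
  have hadd : ∀ a b, r (a + b) = r a + r b ∧ q (a + b) = q a + q b := fun a b => by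
    apply uniq
    rw [← hrq', map_add]
    linear_combination hrq' a + hrq' b
  have hsmul : ∀ (c : B') b, r (c • b) = c • r b ∧ q (c • b) = c • q b := fun c b => by
    apply uniq
    rw [← hrq', map_smul, mul_smul_comm, ← smul_add, ← hrq']
  have hD' : ∀ g, r (D * g) = 0 ∧ q (D * g) = g := fun g => by
    apply uniq
    rw [← hrq', map_zero, zero_add]
  exact ⟨⟨⟨r, fun a b => (hadd a b).1⟩, fun a b => (hsmul a b).1⟩,
    ⟨⟨q, fun a b => (hadd a b).2⟩, fun a b => (hsmul a b).2⟩, hrq', fun g => (hD' g).1,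
    fun g => (hD' g).2⟩

theorem Division.exists_maps_finsupp (h : Division B' B D x e) (hD : D ≠ 0) (ι : Type u) :
    ∃ (rem : (ι →₀ B) →ₗ[B'] (ι →₀ Fin e → B')) (syn : (ι →₀ Fin e → B') →ₗ[B'] (ι →₀ B))
      (quo : (ι →₀ B) →ₗ[B'] (ι →₀ B)), (∀ l, l = syn (rem l) + D • quo l) ∧
      (∀ l, rem (D • l) = 0) ∧ ∀ l, quo (D • l) = l := by
  obtain ⟨rem, quo, h1, h2, h3⟩ := h.exists_maps hD
  refine ⟨Finsupp.mapRange.linearMap rem, Finsupp.mapRange.linearMap (synth B' x e),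
    Finsupp.mapRange.linearMap quo, fun l => ?_, fun l => ?_, fun l => ?_⟩
  · ext i
    simpa using h1 (l i)
  · ext1 i
    simpa using h2 (l i)
  · ext i
    simpa using h3 (l i)

variable {L M : Type u} [AddCommGroup L] [Module B L] [Module B' L]
  [IsScalarTower B' B L] [AddCommGroup M] [Module B M] [Module B' M] [IsScalarTower B' B M]

/-- `D L`. -/
abbrev mulSub (D : B) (L : Type u) [AddCommGroup L] [Module B L] : Submodule B L :=
  LinearMap.range (LinearMap.lsmul B L D)

theorem Division.projective_of_ker (h : Division B' B D x e) (hD : D ≠ 0)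
    [Module.Projective B L] {π : L →ₗ[B] M} (hπ : Function.Surjective π)
    (hk : ∀ l, π l = 0 → ∃ l', l = D • l') (hk' : ∀ l, π (D • l) = 0) :
    Module.Projective B' M := by
  obtain ⟨rem, syn, quo, h1, h2, -⟩ := h.exists_maps_finsupp hD L
  obtain ⟨s, hs⟩ := Module.projective_def.1 ‹Module.Projective B L›
  have hsurj : Function.Surjective (π.restrictScalars B') := hπ
  obtain ⟨i, hi⟩ := exists_factor hsurj (rem ∘ₗ s.restrictScalars B') (by
    intro l hl
    obtain ⟨l, rfl⟩ := hk l hl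
    simp [h2])
  refine Module.Projective.of_split i (π.restrictScalars B' ∘ₗ
    (Finsupp.linearCombination B (id : L → L)).restrictScalars B' ∘ₗ syn) ?_
  ext y
  obtain ⟨l, rfl⟩ := hsurj y
  rw [LinearMap.comp_apply, hi]
  have e1 : syn (rem (s l)) = s l - D • quo (s l) := by
    rw [eq_sub_iff_add_eq, ← h1]
  simp only [LinearMap.comp_apply, LinearMap.restrictScalars_apply, e1, map_sub, map_smul, hs l,
    LinearMap.id_apply]
  rw [sub_eq_self, ← map_smul, hk']

theorem Division.projective_quot (h : Division B' B D x e) (hD : D ≠ 0) [Module.Projective B L] :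
    Module.Projective B' (L ⧸ mulSub D L) := by
  refine h.projective_of_ker hD (mulSub D L).mkQ_surjective (fun l hl => ?_) (fun l => ?_)
  · rw [Submodule.mkQ_apply, Submodule.Quotient.mk_eq_zero] at hl
    obtain ⟨l', rfl⟩ := hl
    exact ⟨l', rfl⟩
  · rw [Submodule.mkQ_apply, Submodule.Quotient.mk_eq_zero]
    exact ⟨l, rfl⟩

theorem Division.projective_of_pd_one (h : Division B' B D x e) (hD : D ≠ 0)
    (hM : ∀ y : M, D • y = 0) (hpd : PD B 1 M) : Module.Projective B' M := by
  have hg := freeCover_surjective B M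
  obtain ⟨g, hgd⟩ : ∃ g : (M →₀ B) →ₗ[B] M, g = Finsupp.linearCombination B (id : M → M) :=
    ⟨_, rfl⟩
  rw [← hgd] at hg
  have hZ : Module.Projective B (LinearMap.ker g) := pd_zero_iff.1 (hpd.ker hg)
  obtain ⟨s, hs⟩ := Module.projective_def.1 hZ
  obtain ⟨rem, syn, quo, h1, h2, -⟩ := h.exists_maps_finsupp hD M
  obtain ⟨-, -, quo', -, -, h6⟩ := h.exists_maps_finsupp hD (LinearMap.ker g)
  obtain ⟨dm, hdm⟩ : ∃ dm : (M →₀ B) →ₗ[B] LinearMap.ker g, ∀ l, (dm l : M →₀ B) = D • l :=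
    ⟨(LinearMap.lsmul B _ D).codRestrict _ (fun l => by simp [hM]), fun l => rfl⟩
  obtain ⟨ρ, hρ⟩ : ∃ ρ : (M →₀ B) →ₗ[B'] LinearMap.ker g, ∀ l, ρ l =
      Finsupp.linearCombination B (id : LinearMap.ker g → LinearMap.ker g) (quo' (s (dm l))) :=
    ⟨(Finsupp.linearCombination B (id : LinearMap.ker g → LinearMap.ker g)).restrictScalars B' ∘ₗ
      quo' ∘ₗ s.restrictScalars B' ∘ₗ dm.restrictScalars B', fun l => rfl⟩
  have hρZ : ∀ z : LinearMap.ker g, ρ z = z := by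
    intro z
    have : dm z = D • z := Subtype.ext (hdm z)
    rw [hρ, this, map_smul, h6, hs]
  have hsurj : Function.Surjective (g.restrictScalars B') := hg
  obtain ⟨i, hi⟩ := exists_factor hsurj
    (rem ∘ₗ (LinearMap.id - ((LinearMap.ker g).subtype.restrictScalars B') ∘ₗ ρ)) (by
    intro l hl
    have := hρZ ⟨l, hl⟩
    simp only at this
    simp [this])
  refine Module.Projective.of_split i (g.restrictScalars B' ∘ₗ syn) ?_
  ext y
  obtain ⟨l, rfl⟩ := hsurj y
  rw [LinearMap.comp_apply, hi]
  have e1 : ∀ l, syn (rem l) = l - D • quo l := fun l => by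
    rw [eq_sub_iff_add_eq, ← h1]
  simp [e1, hM]

theorem Division.pd_drop (h : Division B' B D x e) (hD : D ≠ 0) (p : ℕ) :
    ∀ {M : Type u} [AddCommGroup M] [Module B M] [Module B' M] [IsScalarTower B' B M],
      (∀ y : M, D • y = 0) → PD B (p + 1) M → PD B' p M := by
  induction p with
  | zero => exact fun hM hpd => pd_zero_iff.2 (h.projective_of_pd_one hD hM hpd)
  | succ p ih =>
    intro M _ _ _ _ hM hpd
    have hg := freeCover_surjective B M
    obtain ⟨g, hgd⟩ : ∃ g : (M →₀ B) →ₗ[B] M, g = Finsupp.linearCombination B (id : M → M) :=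
      ⟨_, rfl⟩
    rw [← hgd] at hg
    obtain ⟨Z, hZ⟩ : ∃ Z, Z = LinearMap.ker g := ⟨_, rfl⟩
    obtain ⟨K, hK⟩ : ∃ K, K = mulSub D (M →₀ B) := ⟨_, rfl⟩
    have hKZ : K ≤ Z := by
      rw [hK, hZ]
      rintro _ ⟨l, rfl⟩
      simp [hM]
    have hpdZ : PD B (p + 1) Z := hZ ▸ hpd.ker hg
    obtain ⟨f, hf⟩ : ∃ f : (M →₀ B) →ₗ[B] Z, ∀ l, (f l : M →₀ B) = D • l :=
      ⟨(LinearMap.lsmul B _ D).codRestrict _ (fun l => hKZ (hK ▸ ⟨l, rfl⟩)), fun l => rfl⟩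
    have hpdZ' : PD B (p + 1) (Z.map K.mkQ) := by
      refine PD.right (f := f) (g := K.mkQ.submoduleMap Z) ?_ (K.mkQ.submoduleMap_surjective Z) ?_
        (pd_of_projective p) hpdZ
      · intro a b hab
        have : D • a = D • b := by rw [← hf, ← hf, hab]
        exact smul_right_injective _ hD this
      · intro z
        rw [← Subtype.coe_inj, LinearMap.submoduleMap_coe_apply, Submodule.coe_zero,
          Submodule.mkQ_apply, Submodule.Quotient.mk_eq_zero, hK]
        constructor
        · rintro ⟨l, hl⟩
          exact ⟨l, Subtype.ext ((hf l).trans hl)⟩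
        · rintro ⟨l, rfl⟩
          exact ⟨l, (hf l).symm⟩
    have hkill : ∀ y : Z.map K.mkQ, D • y = 0 := by
      rintro ⟨_, z, hz, rfl⟩
      refine Subtype.ext ?_
      change D • K.mkQ z = 0
      rw [← map_smul, Submodule.mkQ_apply, Submodule.Quotient.mk_eq_zero, hK]
      exact ⟨z, rfl⟩
    have h1 : PD B' p (Z.map K.mkQ) := ih hkill hpdZ'
    have h2 : Module.Projective B' ((M →₀ B) ⧸ K) := hK ▸ h.projective_quot hD
    have hsurj : Function.Surjective (K.liftQ g (hZ ▸ hKZ)) := fun m => by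
      obtain ⟨l, rfl⟩ := hg m
      exact ⟨K.mkQ l, by simp⟩
    refine PD.right (f := (Z.map K.mkQ).subtype.restrictScalars B')
      (g := (K.liftQ g (hZ ▸ hKZ)).restrictScalars B') Subtype.val_injective hsurj ?_ h1
      (pd_of_projective _)
    intro y
    obtain ⟨l, rfl⟩ := K.mkQ_surjective y
    constructor
    · intro hl
      refine ⟨⟨K.mkQ l, l, ?_, rfl⟩, rfl⟩
      rw [hZ]
      simpa using hl
    · rintro ⟨⟨_, z, hz, rfl⟩, hy⟩
      rw [← hy]
      rw [hZ] at hz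
      simpa using hz

end

open TensorProduct

section
variable {B' B F' F : Type u} [CommRing B'] [CommRing B] [CommRing F'] [CommRing F]
  [Algebra B' B] [Algebra B F] [Algebra B' F'] [Algebra F' F] [Algebra B' F]
  [IsScalarTower B' B F] [IsScalarTower B' F' F] {D x : B} {e : ℕ}

section
variable (B' B F' F) (X : Type u) [AddCommGroup X] [Module B X] [Module B' X]
  [IsScalarTower B' B X]

/-- The natural map `F' ⊗[B'] X → F ⊗[B] X`. -/
noncomputable def phi : F' ⊗[B'] X →ₗ[B'] F ⊗[B] X :=
  TensorProduct.lift (LinearMap.mk₂ B' (fun f m => algebraMap F' F f ⊗ₜ[B] m)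
    (fun a b m => by rw [map_add, add_tmul])
    (fun c a m => by rw [algebraMap_smul_eq c a, smul_tmul'])
    (fun a m n => by rw [tmul_add])
    (fun c a m => by
      rw [← algebraMap_smul B c m, tmul_smul, algebraMap_smul]))
where
  algebraMap_smul_eq (c : B') (a : F') : algebraMap F' F (c • a) = c • algebraMap F' F a := by
    rw [Algebra.algebraMap_eq_smul_one, Algebra.algebraMap_eq_smul_one, smul_assoc]

variable {X}

@[simp] theorem phi_tmul (f : F') (m : X) :
    phi B' B F' F X (f ⊗ₜ m) = algebraMap F' F f ⊗ₜ[B] m := rfl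

variable {B' B F' F}

theorem phi_surjective (hF : Division F' F (algebraMap B F D) (algebraMap B F x) e)
    (hX : ∀ m : X, D • m = 0) : Function.Surjective (phi B' B F' F X) := by
  intro z
  induction z with
  | zero => exact ⟨0, map_zero _⟩
  | add y z hy hz =>
    obtain ⟨a, rfl⟩ := hy
    obtain ⟨b, rfl⟩ := hz
    exact ⟨a + b, map_add _ _ _⟩
  | tmul f m =>
    obtain ⟨r, q, hrq⟩ := hF.exists_eq f
    refine ⟨∑ j, r j ⊗ₜ (x ^ (j : ℕ) • m), ?_⟩
    have h0 : (algebraMap B F D * q) ⊗ₜ[B] m = 0 := by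
      rw [← Algebra.smul_def, smul_tmul, hX, tmul_zero]
    rw [hrq, add_tmul, h0, add_zero, sum_tmul, map_sum]
    refine Finset.sum_congr rfl fun j _ => ?_
    rw [phi_tmul, ← smul_tmul, Algebra.smul_def, Algebra.smul_def, map_pow, mul_comm]

omit [Algebra B' B] [Algebra B' F'] [Algebra B' F] [IsScalarTower B' B F]
  [IsScalarTower B' F' F] in
theorem Division.rem_synth (hF : Division F' F (algebraMap B F D) (algebraMap B F x) e)
    {rem : F →ₗ[F'] (Fin e → F')} {quo : F →ₗ[F'] F}
    (hrem : ∀ g, g = synth F' (algebraMap B F x) e (rem g) + algebraMap B F D * quo g)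
    (r : Fin e → F') : rem (synth F' (algebraMap B F x) e r) = r := by
  rw [← sub_eq_zero]
  apply hF.unique _ (quo (synth F' (algebraMap B F x) e r))
  rw [← synth_apply, map_sub]
  linear_combination -hrem (synth F' (algebraMap B F x) e r)

theorem Division.rem_smul {rem : F →ₗ[F'] (Fin e → F')} {quo : F →ₗ[F'] F}
    (hrem : ∀ g, g = synth F' (algebraMap B F x) e (rem g) + algebraMap B F D * quo g)
    (hD0 : ∀ g, rem (algebraMap B F D * g) = 0)
    (hF : Division F' F (algebraMap B F D) (algebraMap B F x) e) (b : B) (s : Fin e → Fin e → B')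
    (q : Fin e → B) (hs : ∀ i : Fin e, x ^ (i : ℕ) * b = ∑ j, s i j • x ^ (j : ℕ) + D * q i) (f : F)
    (j : Fin e) : rem (b • f) j = ∑ i, rem f i * algebraMap B' F' (s i j) := by
  have key := hF.rem_synth hrem
  have e1 : b • f = synth F' (algebraMap B F x) e
      (fun j => ∑ i, rem f i * algebraMap B' F' (s i j)) +
      algebraMap B F D * (algebraMap B F b * quo f +
        ∑ i, algebraMap F' F (rem f i) * algebraMap B F (q i)) := by
    conv_lhs => rw [hrem f]
    rw [Algebra.smul_def, mul_add, mul_add, synth_apply, synth_apply, Finset.mul_sum,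
      Finset.mul_sum]
    have e2 : ∀ i : Fin e, algebraMap B F b * (rem f i • algebraMap B F x ^ (i : ℕ)) =
        ∑ j, (rem f i * algebraMap B' F' (s i j)) • algebraMap B F x ^ (j : ℕ) +
          algebraMap B F D * (algebraMap F' F (rem f i) * algebraMap B F (q i)) := by
      intro i
      have h3 := congrArg (algebraMap B F) (hs i)
      rw [map_mul, map_pow, map_add, map_sum, map_mul] at h3
      rw [Algebra.smul_def, mul_left_comm, mul_comm (algebraMap B F b), h3, mul_add,
        Finset.mul_sum]
      congr 1
      · refine Finset.sum_congr rfl fun j _ => ?_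
        rw [Algebra.smul_def, Algebra.smul_def, map_mul, map_mul, map_pow,
          ← IsScalarTower.algebraMap_apply, ← IsScalarTower.algebraMap_apply B' F' F, mul_assoc]
      · ring
    rw [Finset.sum_congr rfl fun i _ => e2 i, Finset.sum_add_distrib, Finset.sum_comm]
    simp only [Finset.sum_smul]
    ring
  rw [e1, map_add, hD0, add_zero, key]

theorem phi_injective [IsDomain F] (hB : Division B' B D x e)
    (hF : Division F' F (algebraMap B F D) (algebraMap B F x) e) (hD : algebraMap B F D ≠ 0)
    (hX : ∀ m : X, D • m = 0) : Function.Injective (phi B' B F' F X) := by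
  obtain ⟨rem, quo, hrem, hD0, -⟩ := hF.exists_maps hD
  have hx : ∀ (b : B) (s : Fin e → B') (q : B) (m : X), b = ∑ j, s j • x ^ (j : ℕ) + D * q →
      b • m = ∑ j, s j • x ^ (j : ℕ) • m := by
    intro b s q m hb
    rw [hb, add_smul, mul_comm, mul_smul, hX, smul_zero, add_zero, Finset.sum_smul]
    exact Finset.sum_congr rfl fun j _ => smul_assoc _ _ _
  have bal : ∀ (b : B) (f : F) (m : X), ∑ j, rem (b • f) j ⊗ₜ[B'] (x ^ (j : ℕ) • m) =
      ∑ j, rem f j ⊗ₜ[B'] (x ^ (j : ℕ) • b • m) := by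
    intro b f m
    choose s q hs using fun i : Fin e => hB.exists_eq (x ^ (i : ℕ) * b)
    simp only [hF.rem_smul hrem hD0 b s q hs f, sum_tmul]
    rw [Finset.sum_comm]
    refine Finset.sum_congr rfl fun i _ => ?_
    rw [smul_smul, hx _ (s i) (q i) m (hs i), tmul_sum]
    refine Finset.sum_congr rfl fun j _ => ?_
    rw [mul_comm, ← Algebra.smul_def, smul_tmul]
  obtain ⟨ψ, hψ⟩ : ∃ ψ : F ⊗[B] X →+ F' ⊗[B'] X, ∀ f m,
      ψ (f ⊗ₜ m) = ∑ j, rem f j ⊗ₜ[B'] (x ^ (j : ℕ) • m) := by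
    refine ⟨liftAddHom (AddMonoidHom.mk' (fun f => AddMonoidHom.mk'
      (fun m => ∑ j, rem f j ⊗ₜ[B'] (x ^ (j : ℕ) • m)) ?_) ?_) ?_, fun f m => rfl⟩
    · intro m n
      simp [smul_add, tmul_add, Finset.sum_add_distrib]
    · intro f g
      ext m
      simp [add_tmul, Finset.sum_add_distrib]
    · intro b f m
      exact bal b f m
  have inv : ∀ z, ψ (phi B' B F' F X z) = z := by
    intro z
    induction z with
    | zero => simp
    | add y z hy hz => rw [map_add, map_add, hy, hz]
    | tmul f m =>
      rw [phi_tmul, hψ]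
      obtain ⟨s, q, hs⟩ := hB.exists_eq 1
      have key := hF.rem_synth hrem
      have e1 : algebraMap F' F f = synth F' (algebraMap B F x) e
          (fun j => f * algebraMap B' F' (s j)) + algebraMap B F D *
            (algebraMap F' F f * algebraMap B F q) := by
        have h3 := congrArg (algebraMap B F) hs
        rw [map_one, map_add, map_sum, map_mul] at h3
        conv_lhs => rw [← mul_one (algebraMap F' F f), h3, mul_add, Finset.mul_sum]
        rw [synth_apply]
        congr 1
        · refine Finset.sum_congr rfl fun j _ => ?_
          rw [Algebra.smul_def, Algebra.smul_def, map_mul, map_mul, map_pow,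
            ← IsScalarTower.algebraMap_apply, ← IsScalarTower.algebraMap_apply B' F' F, mul_assoc]
        · ring
      rw [e1, map_add, hD0, add_zero, key]
      conv_rhs => rw [← one_smul B m, hx 1 s q m hs, tmul_sum]
      refine Finset.sum_congr rfl fun j _ => ?_
      rw [mul_comm, ← Algebra.smul_def, smul_tmul]
  exact Function.LeftInverse.injective inv

end
end

open TensorProduct

/-- `Tor₁(F, M) = 0` for all finite `M` of projective dimension at most `p`, phrased by
presentations. -/
def TorVanish (B F : Type u) [CommRing B] [CommRing F] [Algebra B F] (p : ℕ) : Prop :=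
  ∀ (Z L M : Type u) [AddCommGroup Z] [AddCommGroup L] [AddCommGroup M] [Module B Z] [Module B L]
    [Module B M] (f : Z →ₗ[B] L) (g : L →ₗ[B] M), Function.Injective f → Function.Exact f g →
    Function.Surjective g → Module.Projective B L → Module.Finite B M → PD B p M →
    Function.Injective (f.lTensor F)

section
variable {B' B F' F : Type u} [CommRing B'] [CommRing B] [CommRing F'] [CommRing F]
  [Algebra B' B] [Algebra B F] [Algebra B' F'] [Algebra F' F] [Algebra B' F]
  [IsScalarTower B' B F] [IsScalarTower B' F' F] {D x : B} {e : ℕ}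

theorem Division.finite (hB : Division B' B D x e) {M : Type u} [AddCommGroup M] [Module B M]
    [Module B' M] [IsScalarTower B' B M] [Module.Finite B M] (hM : ∀ m : M, D • m = 0) :
    Module.Finite B' M := by
  obtain ⟨k, g, hg⟩ := Module.Finite.exists_fin' B M
  refine Module.Finite.of_surjective (g.restrictScalars B' ∘ₗ
    LinearMap.pi (fun i => synth B' x e ∘ₗ LinearMap.proj i) : (Fin k → Fin e → B') →ₗ[B'] M) ?_
  intro m
  obtain ⟨b, rfl⟩ := hg m
  choose r q hrq using hB.exists_eq
  refine ⟨fun i => r (b i), ?_⟩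
  have : b = (fun i => synth B' x e (r (b i))) + D • fun i => q (b i) := by
    ext i
    exact hrq (b i)
  conv_rhs => rw [this, map_add, map_smul, hM, add_zero]
  rfl

theorem lTensor_injective_of_torsion [IsDomain B] [IsDomain F] (hB : Division B' B D x e)
    (hF : Division F' F (algebraMap B F D) (algebraMap B F x) e) (hD : algebraMap B F D ≠ 0)
    {Z L M : Type u} [AddCommGroup Z] [AddCommGroup L] [AddCommGroup M] [Module B Z] [Module B L]
    [Module B M] [Module B' M] [IsScalarTower B' B M] [Module B' L] [IsScalarTower B' B L]
    (f : Z →ₗ[B] L) (g : L →ₗ[B] M)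
    (hf : Function.Injective f) (hfg : Function.Exact f g)
    (hg : Function.Surjective g) [Module.Projective B L] [Module.Finite B M] {p : ℕ}
    (hpd : PD B (p + 1) M) (hM : ∀ m : M, D • m = 0) (ih : TorVanish B' F' p) :
    Function.Injective (f.lTensor F) := by
  have hD0 : D ≠ 0 := fun h => hD (by rw [h, map_zero])
  obtain ⟨K, hK⟩ : ∃ K, K = mulSub D L := ⟨_, rfl⟩
  have hKg : K ≤ LinearMap.ker g := by
    rw [hK]
    rintro _ ⟨l, rfl⟩
    simp [hM]
  have hkill : ∀ y : L ⧸ K, D • y = 0 := by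
    intro y
    obtain ⟨l, rfl⟩ := K.mkQ_surjective y
    rw [← map_smul, Submodule.mkQ_apply, Submodule.Quotient.mk_eq_zero, hK]
    exact ⟨l, rfl⟩
  obtain ⟨W, hW⟩ : ∃ W, W = LinearMap.range (K.mkQ ∘ₗ f) := ⟨_, rfl⟩
  have hkillW : ∀ y : W, D • y = 0 := fun y => Subtype.ext (hkill y)
  have h2 : Module.Projective B' (L ⧸ K) := hK ▸ hB.projective_quot hD0
  have hinj' : Function.Injective ((W.subtype.restrictScalars B').lTensor F') := by
    refine ih W (L ⧸ K) M (W.subtype.restrictScalars B') ((K.liftQ g hKg).restrictScalars B')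
      Subtype.val_injective ?_ ?_ h2 (hB.finite hM) (hB.pd_drop hD0 p hM hpd)
    · intro y
      obtain ⟨l, rfl⟩ := K.mkQ_surjective y
      constructor
      · intro hl
        have hl' : g l = 0 := by simpa using hl
        obtain ⟨z, rfl⟩ := (hfg l).1 hl'
        exact ⟨⟨K.mkQ (f z), hW ▸ ⟨z, rfl⟩⟩, rfl⟩
      · rintro ⟨⟨w, hw⟩, hy⟩
        rw [← hy]
        rw [hW] at hw
        obtain ⟨z, rfl⟩ := hw
        simpa using hfg.apply_apply_eq_zero z
    · intro m
      obtain ⟨l, rfl⟩ := hg m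
      exact ⟨K.mkQ l, by simp⟩
  have hinj : Function.Injective (W.subtype.lTensor F) := by
    have comm : ∀ z, W.subtype.lTensor F (phi B' B F' F W z) =
        phi B' B F' F (L ⧸ K) ((W.subtype.restrictScalars B').lTensor F' z) := by
      intro z
      induction z with
      | zero => simp
      | tmul a b => rfl
      | add y z hy hz => simp only [map_add, hy, hz]
    intro a b hab
    obtain ⟨a, rfl⟩ := phi_surjective (B' := B') (F' := F') hF hkillW a
    obtain ⟨b, rfl⟩ := phi_surjective (B' := B') (F' := F') hF hkillW b
    rw [comm, comm] at hab
    rw [hinj' (phi_injective hB hF hD hkill hab)]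
  -- the exact sequence `L → Z → W → 0`
  obtain ⟨π, hπ⟩ : ∃ π : Z →ₗ[B] W, ∀ z, (π z : L ⧸ K) = K.mkQ (f z) :=
    ⟨(K.mkQ ∘ₗ f).codRestrict W (fun z => hW ▸ ⟨z, rfl⟩), fun z => rfl⟩
  have hπs : Function.Surjective π := by
    rintro ⟨w, hw⟩
    obtain ⟨z, rfl⟩ := hW ▸ hw
    exact ⟨z, Subtype.ext (hπ z)⟩
  have hex : ∀ l, ∃ z, f z = D • l := fun l => (hfg _).1 (hKg (hK ▸ ⟨l, rfl⟩))
  obtain ⟨δ, hδ⟩ : ∃ δ : L →ₗ[B] Z, ∀ l, f (δ l) = D • l := by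
    choose d hd using hex
    exact ⟨⟨⟨d, fun a b => hf (by simp [hd])⟩, fun c a => hf (by
      simp only [hd, map_smul, RingHom.id_apply]; exact smul_comm _ _ _)⟩, hd⟩
  have hex2 : Function.Exact δ π := by
    intro z
    rw [← Subtype.coe_inj, hπ, Submodule.coe_zero, Submodule.mkQ_apply,
      Submodule.Quotient.mk_eq_zero, hK]
    constructor
    · rintro ⟨l, hl⟩
      exact ⟨l, hf ((hδ l).trans hl)⟩
    · rintro ⟨l, rfl⟩
      exact ⟨l, (hδ l).symm⟩
  have hex3 := lTensor_exact F hex2 hπs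
  rw [← LinearMap.ker_eq_bot, LinearMap.ker_eq_bot']
  intro z hz
  have h4 : π.lTensor F z = 0 := by
    apply hinj
    rw [map_zero, ← LinearMap.comp_apply, ← LinearMap.lTensor_comp]
    have : W.subtype ∘ₗ π = K.mkQ ∘ₗ f := LinearMap.ext hπ
    rw [this, LinearMap.lTensor_comp, LinearMap.comp_apply, hz, map_zero]
  obtain ⟨y, rfl⟩ := (hex3 z).1 h4
  have h5 : D • y = 0 := by
    rw [← LinearMap.comp_apply, ← LinearMap.lTensor_comp] at hz
    have : f ∘ₗ δ = D • LinearMap.id := LinearMap.ext hδ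
    rw [this, LinearMap.lTensor_smul, LinearMap.lTensor_id] at hz
    exact hz
  have h6 : algebraMap B F D • y = 0 := by rw [algebraMap_smul, h5]
  have h7 : Module.Projective F (F ⊗[B] L) := inferInstance
  rw [(smul_eq_zero.1 h6).resolve_left hD, map_zero]

end

theorem torVanish_zero (B F : Type u) [CommRing B] [CommRing F] [Algebra B F] :
    TorVanish B F 0 := by
  intro Z L M _ _ _ _ _ _ f g hf hfg hg _ _ hpd
  have := pd_zero_iff.1 hpd
  exact LinearMap.lTensor_injective_of_exact_of_flat g hg f hf hfg F

theorem exists_free_torsion (B M : Type u) [CommRing B] [IsDomain B] [AddCommGroup M] [Module B M]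
    [Module.Finite B M] :
    ∃ (M₀ : Submodule B M) (D : B), Module.Free B M₀ ∧ D ≠ 0 ∧ ∀ m : M ⧸ M₀, D • m = 0 := by
  obtain ⟨k, v, hv⟩ := Module.Finite.exists_fin (R := B) (M := M)
  obtain ⟨I, hI, hmax⟩ := exists_maximal_linearIndepOn B v
  have : ∀ i, ∃ a : B, a ≠ 0 ∧ a • v i ∈ Submodule.span B (v '' I) := by
    intro i
    by_cases h : i ∈ I
    · exact ⟨1, one_ne_zero, by
        rw [one_smul]; exact Submodule.subset_span ⟨i, h, rfl⟩⟩
    · exact hmax i h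
  choose a ha0 ha using this
  refine ⟨Submodule.span B (v '' I), ∏ i, a i, ?_, Finset.prod_ne_zero_iff.2 fun i _ => ha0 i, ?_⟩
  · rw [Set.image_eq_range]
    exact Module.Free.of_basis (Module.Basis.span hI)
  · intro m
    obtain ⟨m, rfl⟩ := Submodule.mkQ_surjective _ m
    rw [← map_smul, Submodule.mkQ_apply, Submodule.Quotient.mk_eq_zero]
    have hm : m ∈ Submodule.span B (Set.range v) := hv ▸ Submodule.mem_top
    induction hm using Submodule.span_induction with
    | mem y hy =>
      obtain ⟨i, rfl⟩ := hy
      rw [← Finset.prod_erase_mul _ _ (Finset.mem_univ i), mul_smul]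
      exact Submodule.smul_mem _ _ (ha i)
    | zero => simp
    | add y z _ _ hy hz => rw [smul_add]; exact Submodule.add_mem _ hy hz
    | smul c y _ hy => rw [smul_comm]; exact Submodule.smul_mem _ _ hy

/-- It suffices to treat modules killed by a nonzero element. -/
theorem torVanish_succ_of_torsion (B F : Type u) [CommRing B] [CommRing F] [Algebra B F]
    [IsDomain B] {p : ℕ}
    (h : ∀ (D : B), D ≠ 0 → ∀ (Z L M : Type u) [AddCommGroup Z] [AddCommGroup L] [AddCommGroup M]
      [Module B Z] [Module B L] [Module B M] (f : Z →ₗ[B] L) (g : L →ₗ[B] M),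
      Function.Injective f → Function.Exact f g → Function.Surjective g → Module.Projective B L →
      Module.Finite B M → PD B (p + 1) M → (∀ m : M, D • m = 0) →
      Function.Injective (f.lTensor F)) : TorVanish B F (p + 1) := by
  intro Z L M _ _ _ _ _ _ f g hf hfg hg hL hM hpd
  obtain ⟨M₀, D, hfree, hD, hkill⟩ := exists_free_torsion B M
  have hpd' : PD B (p + 1) (M ⧸ M₀) := PD.right (f := M₀.subtype) (g := M₀.mkQ)
    Subtype.val_injective M₀.mkQ_surjective (LinearMap.exact_subtype_mkQ M₀)
    (pd_of_projective p) hpd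
  obtain ⟨W, hW⟩ : ∃ W : Submodule B L, W = M₀.comap g := ⟨_, rfl⟩
  have hfW : ∀ z, f z ∈ W := fun z => by
    rw [hW, Submodule.mem_comap, hfg.apply_apply_eq_zero]
    exact M₀.zero_mem
  have h1 : Function.Injective (W.subtype.lTensor F) := by
    refine h D hD W L (M ⧸ M₀) W.subtype (M₀.mkQ ∘ₗ g) Subtype.val_injective ?_
      (M₀.mkQ_surjective.comp hg) hL inferInstance hpd' hkill
    intro l
    rw [LinearMap.comp_apply, Submodule.mkQ_apply, Submodule.Quotient.mk_eq_zero]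
    constructor
    · intro hl
      exact ⟨⟨l, hW ▸ hl⟩, rfl⟩
    · rintro ⟨⟨w, hw⟩, rfl⟩
      rw [hW] at hw
      exact hw
  have h2 : Function.Injective ((f.codRestrict W hfW).lTensor F) := by
    have hgW : ∀ w : W, g w ∈ M₀ := fun w => hW.le w.2
    refine LinearMap.lTensor_injective_of_exact_of_flat
      ((g ∘ₗ W.subtype).codRestrict M₀ hgW) ?_ _ ?_ ?_ F
    · rintro ⟨m, hm⟩
      obtain ⟨l, rfl⟩ := hg m
      exact ⟨⟨l, hW ▸ hm⟩, rfl⟩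
    · intro a b hab
      exact hf (congrArg Subtype.val hab)
    · rintro ⟨l, hl⟩
      constructor
      · intro h0
        obtain ⟨z, rfl⟩ := (hfg l).1 (congrArg Subtype.val h0)
        exact ⟨z, rfl⟩
      · rintro ⟨z, hz⟩
        rw [← hz]
        exact Subtype.ext (hfg.apply_apply_eq_zero z)
  have h3 : f = W.subtype ∘ₗ f.codRestrict W hfW := rfl
  rw [h3, LinearMap.lTensor_comp]
  exact h1.comp h2

open TensorProduct

section
variable (K : ℕ → Type u) [∀ i, Field (K i)]

theorem exists_division_algebra [∀ i, Infinite (K i)] (n : ℕ → ℕ) (D : Bd K n)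
    (hD : (D : Fl K n) ∉ Set.range (algebraMap (UP K) (Fl K n))) :
    ∃ (n' : ℕ → ℕ) (e : ℕ) (x : Bd K n) (_ : Algebra (Bd K n') (Bd K n))
      (_ : Algebra (Fl K n') (Fl K n)), IsScalarTower (Bd K n') (Bd K n) (Fl K n) ∧
      Division (Bd K n') (Bd K n) D x e ∧
      Division (Fl K n') (Fl K n) (algebraMap (Bd K n) (Fl K n) D)
        (algebraMap (Bd K n) (Fl K n) x) e := by
  obtain ⟨n', θ, x, e, hx, hθ, hex, huniq⟩ := exists_division (D : Fl K n) D.2 hD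
  obtain ⟨θB, hθB⟩ : ∃ θB : Bd K n' →+* Bd K n, ∀ z, (θB z : Fl K n) = θ z :=
    ⟨(θ.comp (Bd K n').val.toRingHom).codRestrict (Bd K n) (fun z => hθ z z.2), fun z => rfl⟩
  let _ := θB.toAlgebra
  let _ := θ.toAlgebra
  refine ⟨n', e, ⟨x, hx⟩, θB.toAlgebra, θ.toAlgebra, ?_, ?_, ?_⟩
  · exact IsScalarTower.of_algebraMap_eq fun z => (hθB z).symm
  · constructor
    · intro g
      obtain ⟨r, q, h1, h2⟩ := hex g
      obtain ⟨hr, hq⟩ := h2 g.2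
      refine ⟨fun j => ⟨r j, hr j⟩, ⟨q, hq⟩, Subtype.ext ?_⟩
      rw [h1]
      simp [Algebra.smul_def, RingHom.algebraMap_toAlgebra, hθB]
    · intro r q h0
      have h1 := huniq (fun j => (r j : Fl K n')) (q : Fl K n) (by
        have := congrArg Subtype.val h0
        simpa [Algebra.smul_def, RingHom.algebraMap_toAlgebra, hθB] using this)
      funext j
      exact Subtype.ext (congrFun h1 j)
  · constructor
    · intro g
      obtain ⟨r, q, h1, -⟩ := hex g
      exact ⟨r, q, h1⟩
    · intro r q h0
      exact huniq r q h0

theorem isUnit_of_mem_range (n : ℕ → ℕ) (D : Bd K n) (hD0 : D ≠ 0)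
    (hD : (D : Fl K n) ∈ Set.range (algebraMap (UP K) (Fl K n))) : IsUnit D := by
  obtain ⟨c, hc⟩ := hD
  have : D = algebraMap (UP K) (Bd K n) c := Subtype.ext hc.symm
  rw [this]
  refine (IsUnit.mk0 c fun h => hD0 ?_).map _
  rw [this, h, map_zero]

theorem torVanish_Bd [∀ i, Infinite (K i)] (p : ℕ) :
    ∀ n : ℕ → ℕ, TorVanish (Bd K n) (Fl K n) p := by
  induction p with
  | zero => exact fun n => torVanish_zero _ _
  | succ p ih =>
    intro n
    refine torVanish_succ_of_torsion _ _ ?_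
    intro D hD0 Z L M _ _ _ _ _ _ f g hf hfg hg hL hM hpd hkill
    by_cases hD : (D : Fl K n) ∈ Set.range (algebraMap (UP K) (Fl K n))
    · have hu := isUnit_of_mem_range K n D hD0 hD
      have : Subsingleton M := subsingleton_of_forall_eq 0 fun m =>
        (hu.smul_eq_zero).1 (hkill m)
      exact torVanish_zero _ _ Z L M f g hf hfg hg hL hM (pd_of_projective 0)
    · obtain ⟨n', e, x, a1, a2, t1, hB, hF⟩ := exists_division_algebra K n D hD
      let _ := Module.compHom M (algebraMap (Bd K n') (Bd K n))
      let _ := Module.compHom L (algebraMap (Bd K n') (Bd K n))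
      have : IsScalarTower (Bd K n') (Bd K n) M := IsScalarTower.of_algebraMap_smul fun _ _ => rfl
      have : IsScalarTower (Bd K n') (Bd K n) L := IsScalarTower.of_algebraMap_smul fun _ _ => rfl
      refine lTensor_injective_of_torsion hB hF ?_ f g hf hfg hg hpd hkill (ih n')
      exact fun h => hD0 (Subtype.ext h)

end

open TensorProduct

theorem isPrime_map_C {σ A : Type u} [CommRing A] (P : Ideal A) [P.IsPrime] :
    (P.map (MvPolynomial.C : A →+* MvPolynomial σ A)).IsPrime := by
  rw [← Ideal.Quotient.isDomain_iff_prime]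
  exact (MvPolynomial.quotientEquivQuotientMvPolynomial P).symm.toMulEquiv.isDomain _

theorem exists_polynomial_model {J k B : Type u} [Field k] [CommRing B]
    (ε : B ≃+* MvPolynomial J k) (T : Finset B) :
    ∃ (b : ℕ) (_ : Algebra (MvPolynomial (Fin b) k) B), Module.Flat (MvPolynomial (Fin b) k) B ∧
      Function.Injective (algebraMap (MvPolynomial (Fin b) k) B) ∧
      (∀ t ∈ T, t ∈ Set.range (algebraMap (MvPolynomial (Fin b) k) B)) ∧
      ∀ P : Ideal (MvPolynomial (Fin b) k), P.IsPrime →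
        (P.map (algebraMap (MvPolynomial (Fin b) k) B)).IsPrime := by
  classical
  obtain ⟨s, hs⟩ : ∃ s : Finset J, ∀ t ∈ T, (ε t).vars ⊆ s :=
    ⟨T.biUnion fun t => (ε t).vars, fun t ht =>
      Finset.subset_biUnion_of_mem (fun t => (ε t).vars) ht⟩
  obtain ⟨c, hc⟩ : ∃ c : ({j // j ∉ s} ⊕ Fin s.card) ≃ J, ∀ i, c (Sum.inr i) = s.equivFin.symm i :=
    ⟨((Equiv.sumComm _ _).trans (Equiv.sumCongr s.equivFin.symm (Equiv.refl _))).trans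
      (Equiv.sumCompl (fun j => j ∈ s)), fun i => rfl⟩
  obtain ⟨δ, hδ⟩ : ∃ δ : MvPolynomial {j // j ∉ s} (MvPolynomial (Fin s.card) k) ≃+* B,
      ∀ p, δ (MvPolynomial.C p) =
        ε.symm (MvPolynomial.rename (fun i => (s.equivFin.symm i : J)) p) := by
    refine ⟨((MvPolynomial.sumAlgEquiv k _ _).symm.toRingEquiv.trans
      (MvPolynomial.renameEquiv k c).toRingEquiv).trans ε.symm, fun p => ?_⟩
    simp only [RingEquiv.trans_apply]
    congr 1
    have : ((MvPolynomial.renameEquiv k c).toAlgHom.comp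
        (MvPolynomial.sumAlgEquiv k {j // j ∉ s} (Fin s.card)).symm.toAlgHom).comp
        (Algebra.algHom k _ _) = MvPolynomial.rename (R := k)
          (fun i => (s.equivFin.symm i : J)) := by
      apply MvPolynomial.algHom_ext
      intro i
      simp [Algebra.algHom, MvPolynomial.algebraMap_eq, hc]
    exact DFunLike.congr_fun this p
  refine ⟨s.card, (δ.toRingHom.comp MvPolynomial.C).toAlgebra, ?_⟩
  let _ := (δ.toRingHom.comp (MvPolynomial.C (R := MvPolynomial (Fin s.card) k))).toAlgebra
  have hmap : algebraMap (MvPolynomial (Fin s.card) k) B = δ.toRingHom.comp MvPolynomial.C := rfl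
  refine ⟨?_, ?_, ?_, ?_⟩
  · exact Module.Flat.of_linearEquiv
      (AlgEquiv.ofRingEquiv (f := δ) (fun _ => rfl)).symm.toLinearEquiv
  · exact δ.injective.comp (MvPolynomial.C_injective _ _)
  · intro t ht
    obtain ⟨q, hq⟩ := MvPolynomial.exists_rename_eq_of_vars_subset_range (ε t)
      (fun i => (s.equivFin.symm i : J))
      (Subtype.val_injective.comp s.equivFin.symm.injective) (fun j hj =>
        ⟨s.equivFin ⟨j, hs t ht hj⟩, by simp⟩)
    exact ⟨q, (hδ q).trans (by rw [hq, RingEquiv.symm_apply_apply])⟩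
  · intro P hP
    rw [hmap, ← Ideal.map_map]
    have := isPrime_map_C (σ := {j // j ∉ s}) P
    exact Ideal.map_isPrime_of_equiv δ

theorem pd_quot_map {B k : Type u} [Field k] [CommRing B] {b : ℕ}
    [Algebra (MvPolynomial (Fin b) k) B] [Module.Flat (MvPolynomial (Fin b) k) B]
    (I : Ideal (MvPolynomial (Fin b) k)) :
    PD B b (B ⧸ I.map (algebraMap (MvPolynomial (Fin b) k) B)) :=
  PD.of_equiv (Algebra.TensorProduct.quotIdealMapEquivTensorQuot B I).symm.toLinearEquiv
    ((pd_mvPolynomial k b (MvPolynomial (Fin b) k ⧸ I)).baseChange B)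

theorem TorVanish.lTensor_subtype_injective {B F : Type u} [CommRing B] [CommRing F] [Algebra B F]
    {p : ℕ} (h : TorVanish B F p) {I : Ideal B} (hI : PD B p (B ⧸ I)) :
    Function.Injective (I.subtype.lTensor F) :=
  h I B (B ⧸ I) I.subtype (Submodule.mkQ I) Subtype.val_injective
    (LinearMap.exact_subtype_mkQ I) (Submodule.mkQ_surjective I) inferInstance inferInstance hI

theorem flat_of_torVanish {J k B F : Type u} [Field k] [CommRing B] [CommRing F] [Algebra B F]
    (ε : B ≃+* MvPolynomial J k) (h : ∀ p, TorVanish B F p) : Module.Flat B F := by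
  rw [Module.Flat.iff_lTensor_injective]
  rintro I ⟨T, rfl⟩
  obtain ⟨b, a, hflat, -, hT, -⟩ := exists_polynomial_model ε T
  have hpd : PD B b (B ⧸ Ideal.span (T : Set B)) := by
    have h : (Ideal.span (algebraMap (MvPolynomial (Fin b) k) B ⁻¹' T)).map
        (algebraMap (MvPolynomial (Fin b) k) B) = Ideal.span (T : Set B) := by
      rw [Ideal.map_span, Set.image_preimage_eq_of_subset fun t ht => hT t ht]
    rw [← h]
    exact pd_quot_map _
  exact (h b).lTensor_subtype_injective hpd

theorem flat_Bd (K : ℕ → Type u) [∀ i, Field (K i)] [∀ i, IsAlgClosed (K i)] (n : ℕ → ℕ) :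
    Module.Flat (Bd K n) (Fl K n) := by
  obtain ⟨J, ⟨ε⟩⟩ := exists_Bd_equiv K n
  have : ∀ i, Infinite (K i) := fun i => IsAlgClosed.instInfinite
  exact flat_of_torVanish ε.symm.toRingEquiv fun p => torVanish_Bd K p n

open TensorProduct

section
variable {k₀ k₁ L : Type u} [Field k₀] [Field k₁] [Algebra k₀ k₁] [Field L] [Algebra k₀ L]

theorem irreducible_map_of_closed (h : ∀ z : k₁, IsIntegral k₀ z → z ∈ Set.range (algebraMap k₀ k₁))
    {f : Polynomial k₀} (hf : Irreducible f) (hm : f.Monic) :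
    Irreducible (f.map (algebraMap k₀ k₁)) := by
  have hu : ¬ IsUnit (f.map (algebraMap k₀ k₁)) := fun hu =>
    hf.not_isUnit (Polynomial.isUnit_map _ |>.1 hu)
  obtain ⟨g, hgm, hg, hdvd⟩ := Polynomial.exists_monic_irreducible_factor _ hu
  have hl := integralClosure.mem_lifts_of_monic_of_dvd_map k₁ hm hgm hdvd
  have : g ∈ Polynomial.lifts (algebraMap k₀ k₁) := by
    rw [Polynomial.lifts_iff_coeff_lifts] at hl ⊢
    intro j
    obtain ⟨c, hc⟩ := hl j
    rw [← hc]
    exact h _ c.2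
  obtain ⟨e, rfl⟩ := (Polynomial.mem_lifts _).1 this
  have he : e ∣ f := (Polynomial.map_dvd_map' _).1 hdvd
  have hue : ¬ IsUnit e := fun hu => hg.not_isUnit ((Polynomial.isUnit_map _).2 hu)
  have := (hf.dvd_iff.1 he).resolve_left hue
  exact (this.symm.map (Polynomial.mapRingHom (algebraMap k₀ k₁))).irreducible hg

theorem isDomain_tensor_of_isSeparable [FiniteDimensional k₀ L] [Algebra.IsSeparable k₀ L]
    (h : ∀ z : k₁, IsIntegral k₀ z → z ∈ Set.range (algebraMap k₀ k₁)) : IsDomain (k₁ ⊗[k₀] L) := by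
  obtain ⟨α, hα⟩ := Field.exists_primitive_element k₀ L
  have hintegral : IsIntegral k₀ α := Algebra.IsIntegral.isIntegral α
  have hirr := irreducible_map_of_closed h (minpoly.irreducible hintegral) (minpoly.monic hintegral)
  have : Fact (Irreducible ((minpoly k₀ α).map (algebraMap k₀ k₁))) := ⟨hirr⟩
  have hroot : ((minpoly k₀ α).map (algebraMap k₀ k₁)).aeval
      (1 ⊗ₜ α : k₁ ⊗[k₀] L) = 0 := by
    rw [Polynomial.aeval_map_algebraMap]
    have := Polynomial.aeval_algHom_apply
      (Algebra.TensorProduct.includeRight : L →ₐ[k₀] k₁ ⊗[k₀] L) α (minpoly k₀ α)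
    simpa using this
  obtain ⟨ψ, hψ⟩ : ∃ ψ : AdjoinRoot ((minpoly k₀ α).map (algebraMap k₀ k₁)) →ₐ[k₁] k₁ ⊗[k₀] L,
      ψ (AdjoinRoot.root _) = 1 ⊗ₜ α :=
    ⟨AdjoinRoot.liftAlgHom _ (Algebra.ofId _ _) _ hroot, AdjoinRoot.liftAlgHom_root _ _ _ hroot⟩
  have hsurj : Function.Surjective ψ := by
    intro z
    change z ∈ ψ.range
    induction z with
    | zero => exact zero_mem _
    | add x y hx hy => exact add_mem hx hy
    | tmul a l =>
      have hl : l ∈ IntermediateField.adjoin k₀ {α} := hα ▸ IntermediateField.mem_top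
      rw [← IntermediateField.mem_toSubalgebra,
        IntermediateField.adjoin_simple_toSubalgebra_of_isAlgebraic hintegral.isAlgebraic] at hl
      have : (ψ.restrictScalars k₀).range.comap
          (Algebra.TensorProduct.includeRight : L →ₐ[k₀] k₁ ⊗[k₀] L) ≥ Algebra.adjoin k₀ {α} := by
        rw [ge_iff_le, Algebra.adjoin_le_iff]
        rintro _ rfl
        exact ⟨_, hψ⟩
      obtain ⟨y, hy⟩ := this hl
      refine ⟨a • y, ?_⟩
      have hy' : ψ y = 1 ⊗ₜ l := hy
      simp [hy', TensorProduct.smul_tmul']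
  have : Nontrivial (k₁ ⊗[k₀] L) := inferInstance
  exact (RingEquiv.ofBijective ψ.toRingHom
    ⟨ψ.toRingHom.injective, hsurj⟩).symm.toMulEquiv.isDomain _

theorem isDomain_tensor [FiniteDimensional k₀ L]
    (h : ∀ z : k₁, IsIntegral k₀ z → z ∈ Set.range (algebraMap k₀ k₁))
    (q : ℕ) [ExpChar k₀ q] (hred : ∀ z : k₁ ⊗[k₀] L, z ^ q = 0 → z = 0) :
    IsDomain (k₁ ⊗[k₀] L) := by
  have : IsDomain (k₁ ⊗[k₀] separableClosure k₀ L) := isDomain_tensor_of_isSeparable h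
  obtain ⟨ι, hι, hιt⟩ : ∃ ι : k₁ ⊗[k₀] separableClosure k₀ L →ₐ[k₀] k₁ ⊗[k₀] L,
      Function.Injective ι ∧ ∀ a l, ι (a ⊗ₜ l) = a ⊗ₜ (l : L) :=
    ⟨Algebra.TensorProduct.map (AlgHom.id _ _) (separableClosure k₀ L).val,
      Module.Flat.lTensor_preserves_injective_linearMap
        (separableClosure k₀ L).val.toLinearMap Subtype.val_injective, fun a l => rfl⟩
  have hexp : ExpChar (k₁ ⊗[k₀] L) q :=
    expChar_of_injective_ringHom (algebraMap k₀ (k₁ ⊗[k₀] L)).injective q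
  have hpow : ∀ z : k₁ ⊗[k₀] L, ∃ n, ∀ m ≥ n, ∃ y, ι y = z ^ q ^ m := by
    intro z
    induction z with
    | zero => exact ⟨0, fun m _ => ⟨0, by rw [map_zero, zero_pow (expChar_pow_pos k₀ q m).ne']⟩⟩
    | add x y hx hy =>
      obtain ⟨n, hn⟩ := hx
      obtain ⟨n', hn'⟩ := hy
      refine ⟨max n n', fun m hm => ?_⟩
      obtain ⟨a, ha⟩ := hn m (le_of_max_le_left hm)
      obtain ⟨b, hb⟩ := hn' m (le_of_max_le_right hm)
      exact ⟨a + b, by rw [map_add, ha, hb, add_pow_expChar_pow]⟩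
    | tmul a l =>
      obtain ⟨n, c, hc⟩ := IsPurelyInseparable.pow_mem (separableClosure k₀ L) q l
      refine ⟨n, fun m hm => ⟨(a ^ q ^ m) ⊗ₜ (c ^ q ^ (m - n)), ?_⟩⟩
      have hc' : ((c : separableClosure k₀ L) : L) = l ^ q ^ n := hc
      rw [hιt, Algebra.TensorProduct.tmul_pow]
      congr 1
      rw [SubmonoidClass.coe_pow, hc', ← pow_mul, ← pow_add, Nat.add_sub_cancel' hm]
  have hred' : ∀ m, ∀ z : k₁ ⊗[k₀] L, z ^ q ^ m = 0 → z = 0 := by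
    intro m
    induction m with
    | zero => simp
    | succ m ih => exact fun z hz => ih z (hred _ (by rwa [← pow_mul, ← pow_succ]))
  have hz := IsDomain.to_noZeroDivisors (k₁ ⊗[k₀] separableClosure k₀ L)
  have : NoZeroDivisors (k₁ ⊗[k₀] L) := ⟨fun {z w} hzw => by
    obtain ⟨n, hn⟩ := hpow z
    obtain ⟨n', hn'⟩ := hpow w
    obtain ⟨a, ha⟩ := hn (max n n') (le_max_left _ _)
    obtain ⟨b, hb⟩ := hn' (max n n') (le_max_right _ _)
    have : a * b = 0 := by
      apply hι
      rw [map_mul, ha, hb, map_zero, ← mul_pow, hzw, zero_pow (expChar_pow_pos k₀ q _).ne']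
    rcases mul_eq_zero.1 this with h0 | h0
    · left; exact hred' _ _ (by rw [← ha, h0, map_zero])
    · right; exact hred' _ _ (by rw [← hb, h0, map_zero])⟩
  exact NoZeroDivisors.to_isDomain _

end

open TensorProduct

/-- Roots in `Frac F` of monic polynomials over `B` lie in `B`. -/
def RootClosed (B F : Type u) [CommRing B] [CommRing F] [Algebra B F] : Prop :=
  ∀ (n : ℕ) (c : Fin n → B) (a b : F), b ≠ 0 →
    a ^ n + ∑ j : Fin n, algebraMap B F (c j) * a ^ (j : ℕ) * b ^ (n - j) = 0 →
    ∃ f : B, a = b * algebraMap B F f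

/-- Frobenius-linear systems over `B` which are solvable in `F` are solvable in `B`. -/
def FrobeniusClosed (B F : Type u) [CommRing B] [CommRing F] [Algebra B F] (q : ℕ) : Prop :=
  ∀ (r s : ℕ) (a : Fin r → Fin s → B) (t : Fin r → F), t ≠ 0 →
    (∀ l, ∑ j, t j ^ q * algebraMap B F (a j l) = 0) →
    ∃ v : Fin r → B, v ≠ 0 ∧ ∀ l, ∑ j, v j ^ q * a j l = 0

section
variable {B F k₀ k₁ : Type u} [CommRing B] [IsDomain B] [CommRing F] [IsDomain F] [Algebra B F]
  [Field k₀] [Algebra B k₀] [IsFractionRing B k₀] [Field k₁] [Algebra F k₁] [IsFractionRing F k₁]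
  [Algebra B k₁] [IsScalarTower B F k₁] [Algebra k₀ k₁] [IsScalarTower B k₀ k₁]

include B F in
theorem RootClosed.mem_range (h : RootClosed B F) {z : k₁} (hz : IsIntegral k₀ z) :
    z ∈ Set.range (algebraMap k₀ k₁) := by
  have halg : IsAlgebraic B z := (IsFractionRing.isAlgebraic_iff B k₀ k₁).2 hz.isAlgebraic
  obtain ⟨y, hy, p, hp, hpz⟩ := halg.exists_integral_multiple
  obtain ⟨a, b, hb, hab⟩ := IsFractionRing.div_surjective F (y • z)
  have hb0 : b ≠ 0 := nonZeroDivisors.ne_zero hb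
  have hb1 : algebraMap F k₁ b ≠ 0 := by
    simpa using hb0
  have hy1 : algebraMap B k₀ y ≠ 0 := by simpa using hy
  obtain ⟨n, hn⟩ : ∃ n, n = p.natDegree := ⟨_, rfl⟩
  obtain ⟨f, hf⟩ := h n (fun j => p.coeff j) a b hb0 (by
    apply IsFractionRing.injective F k₁
    have h1 := hpz
    rw [Polynomial.eval₂_eq_sum_range, ← hn, Finset.sum_range_succ, hn, hp.coeff_natDegree, ← hn,
      map_one, one_mul, Finset.sum_range, ← hab] at h1
    have h2 : (algebraMap F k₁ b) ^ n * _ = _ * 0 := congrArg _ h1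
    rw [mul_zero, mul_add, Finset.mul_sum] at h2
    rw [map_zero, ← h2, map_add, map_sum, add_comm]
    congr 1
    · refine Finset.sum_congr rfl fun j _ => ?_
      have : algebraMap F k₁ b ^ n = algebraMap F k₁ b ^ (n - j) * algebraMap F k₁ b ^ (j : ℕ) := by
        rw [← pow_add, Nat.sub_add_cancel j.2.le]
      rw [this, map_mul, map_mul, map_pow, map_pow, ← IsScalarTower.algebraMap_apply, div_pow]
      field_simp
    · rw [map_pow, div_pow]
      field_simp)
  refine ⟨algebraMap B k₀ f / algebraMap B k₀ y, ?_⟩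
  rw [map_div₀, ← IsScalarTower.algebraMap_apply, ← IsScalarTower.algebraMap_apply]
  have hy2 : algebraMap B k₁ y ≠ 0 := by
    rw [IsScalarTower.algebraMap_apply B k₀ k₁]
    simpa using hy1
  rw [div_eq_iff hy2, mul_comm, ← Algebra.smul_def, ← hab, hf, map_mul,
    ← IsScalarTower.algebraMap_apply]
  field_simp

include B F in
theorem FrobeniusClosed.eq_zero {L : Type u} [Field L] [Algebra k₀ L] [FiniteDimensional k₀ L]
    {q : ℕ} [ExpChar k₀ q] (h : FrobeniusClosed B F q) {z : k₁ ⊗[k₀] L} (hz : z ^ q = 0) :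
    z = 0 := by
  have hq : q ≠ 0 := (expChar_pos k₀ q).ne'
  have hexp : ExpChar (k₁ ⊗[k₀] L) q :=
    expChar_of_injective_ringHom (algebraMap k₀ (k₁ ⊗[k₀] L)).injective q
  have hexpL : ExpChar L q := expChar_of_injective_ringHom (algebraMap k₀ L).injective q
  obtain ⟨r, ⟨b⟩⟩ : ∃ r, Nonempty (Module.Basis (Fin r) k₀ L) := ⟨_, ⟨Module.finBasis k₀ L⟩⟩
  by_contra hne
  obtain ⟨t, ht⟩ : ∃ t : Fin r → k₁, z = ∑ j, t j • b.baseChange k₁ j :=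
    ⟨_, ((b.baseChange k₁).sum_repr z).symm⟩
  obtain ⟨⟨s, hs⟩, ht'⟩ := IsLocalization.exist_integer_multiples_of_finite (nonZeroDivisors F) t
  choose t' ht' using ht'
  obtain ⟨⟨e, he⟩, ha⟩ := IsLocalization.exist_integer_multiples_of_finite (nonZeroDivisors B)
    (fun jl : Fin r × Fin r => b.repr (b jl.1 ^ q) jl.2)
  choose a ha using ha
  have hs1 : algebraMap F k₁ s ≠ 0 := by simpa using nonZeroDivisors.ne_zero hs
  have he1 : algebraMap B k₀ e ≠ 0 := by simpa using nonZeroDivisors.ne_zero he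
  have htt (j) : algebraMap F k₁ (t' j) = algebraMap F k₁ s * t j := by
    rw [ht', Algebra.smul_def]
  have haa (j l) : algebraMap B k₀ (a (j, l)) = algebraMap B k₀ e * b.repr (b j ^ q) l := by
    rw [ha, Algebra.smul_def]
  have hb (j) : b j ^ q = ∑ l, b.repr (b j ^ q) l • b l := (b.sum_repr _).symm
  have hsys (l) : ∑ j, t j ^ q * algebraMap k₀ k₁ (b.repr (b j ^ q) l) = 0 := by
    have : z ^ q = ∑ l, (∑ j, t j ^ q * algebraMap k₀ k₁ (b.repr (b j ^ q) l)) •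
        b.baseChange k₁ l := by
      rw [ht, sum_pow_char]
      simp_rw [Finset.sum_smul]
      rw [Finset.sum_comm]
      refine Finset.sum_congr rfl fun j _ => ?_
      rw [smul_pow, Module.Basis.baseChange_apply, Algebra.TensorProduct.tmul_pow, one_pow]
      conv_lhs => rw [hb j]
      rw [tmul_sum, Finset.smul_sum]
      refine Finset.sum_congr rfl fun l _ => ?_
      rw [Module.Basis.baseChange_apply, mul_smul, algebraMap_smul, tmul_smul]
    rw [hz] at this
    exact Fintype.linearIndependent_iff.1 (b.baseChange k₁).linearIndependent _ this.symm l
  obtain ⟨v, hv0, hv⟩ := h r r (fun j l => a (j, l)) t' (by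
    intro h0
    apply hne
    rw [ht]
    refine Finset.sum_eq_zero fun j _ => ?_
    have := htt j
    rw [h0, Pi.zero_apply, map_zero] at this
    rw [(mul_eq_zero.1 this.symm).resolve_left hs1, zero_smul]) (fun l => by
    apply IsFractionRing.injective F k₁
    have : algebraMap F k₁ (∑ j, t' j ^ q * algebraMap B F (a (j, l))) =
        (algebraMap F k₁ s ^ q * algebraMap k₀ k₁ (algebraMap B k₀ e)) *
          ∑ j, t j ^ q * algebraMap k₀ k₁ (b.repr (b j ^ q) l) := by
      rw [map_sum, Finset.mul_sum]
      refine Finset.sum_congr rfl fun j _ => ?_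
      rw [map_mul, map_pow, htt, ← IsScalarTower.algebraMap_apply,
        IsScalarTower.algebraMap_apply B k₀ k₁, haa, map_mul]
      ring
    rw [this, hsys, mul_zero, map_zero])
  apply hv0
  have key : (∑ j, algebraMap B k₀ (v j) • b j) ^ q = 0 := by
    rw [sum_pow_char]
    have : ∑ j, (algebraMap B k₀ (v j) • b j) ^ q =
        ∑ l, (∑ j, algebraMap B k₀ (v j) ^ q * b.repr (b j ^ q) l) • b l := by
      simp_rw [Finset.sum_smul]
      rw [Finset.sum_comm]
      refine Finset.sum_congr rfl fun j _ => ?_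
      rw [smul_pow]
      conv_lhs => rw [hb j]
      rw [Finset.smul_sum]
      exact Finset.sum_congr rfl fun l _ => (mul_smul _ _ _).symm
    rw [this]
    refine Finset.sum_eq_zero fun l _ => ?_
    have : algebraMap B k₀ e * ∑ j, algebraMap B k₀ (v j) ^ q * b.repr (b j ^ q) l = 0 := by
      rw [← map_zero (algebraMap B k₀), ← hv l, map_sum, Finset.mul_sum]
      refine Finset.sum_congr rfl fun j _ => ?_
      rw [map_mul, map_pow (algebraMap B k₀), haa]
      ring
    rw [(mul_eq_zero.1 this).resolve_left he1, zero_smul]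
  have key2 := Fintype.linearIndependent_iff.1 b.linearIndependent _ (pow_eq_zero_iff hq |>.1 key)
  ext j
  simpa using key2 j

end

theorem isDomain_tensor_of_injective {B F C : Type u} [CommRing B] [IsDomain B] [CommRing F]
    [IsDomain F] [Algebra B F] [Module.Flat B F] [CommRing C] [IsDomain C] [Algebra B C]
    [Module.Finite B C] (hF : Function.Injective (algebraMap B F))
    (hC : Function.Injective (algebraMap B C)) {q : ℕ} [ExpChar B q] (h1 : RootClosed B F)
    (h2 : FrobeniusClosed B F q) : IsDomain (F ⊗[B] C) := by
  have : FaithfulSMul B C := (faithfulSMul_iff_algebraMap_injective B C).2 hC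
  have : FaithfulSMul B F := (faithfulSMul_iff_algebraMap_injective B F).2 hF
  let k₀ := FractionRing B
  let k₁ := FractionRing F
  let L := FractionRing C
  let _ : Algebra k₀ k₁ := FractionRing.liftAlgebra B k₁
  let _ : Algebra k₀ L := FractionRing.liftAlgebra B L
  have : Module.Finite k₀ L := Module.Finite.of_isLocalization B C (nonZeroDivisors B)
  have : ExpChar k₀ q := expChar_of_injective_algebraMap (IsFractionRing.injective B k₀) q
  have hdom : IsDomain (k₁ ⊗[k₀] L) := isDomain_tensor (fun z hz => h1.mem_range hz) q
    (fun z hz => h2.eq_zero hz)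
  have : IsDomain (k₁ ⊗[B] L) :=
    (IsLocalization.algebraTensorEquiv (nonZeroDivisors B) k₀ k₁ L).symm.toMulEquiv.isDomain _
  have : Module.Flat B L := Module.Flat.trans B k₀ L
  have i1 : Function.Injective (Algebra.TensorProduct.map (AlgHom.id B F)
      (IsScalarTower.toAlgHom B C L)) :=
    Module.Flat.lTensor_preserves_injective_linearMap (M := F)
      (IsScalarTower.toAlgHom B C L).toLinearMap (IsFractionRing.injective C L)
  have i2 : Function.Injective (Algebra.TensorProduct.map (IsScalarTower.toAlgHom B F k₁)
      (AlgHom.id B L)) :=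
    Module.Flat.rTensor_preserves_injective_linearMap (M := L)
      (IsScalarTower.toAlgHom B F k₁).toLinearMap (IsFractionRing.injective F k₁)
  exact (i2.comp i1).isDomain ((Algebra.TensorProduct.map (IsScalarTower.toAlgHom B F k₁)
      (AlgHom.id B L)).comp (Algebra.TensorProduct.map (AlgHom.id B F)
      (IsScalarTower.toAlgHom B C L))).toRingHom

theorem dvd_of_monic_relation {R : Type*} [CommRing R] [IsDomain R] [IsIntegrallyClosed R] {n : ℕ}
    {c : Fin n → R} {a b : R} (hb : b ≠ 0)
    (h : a ^ n + ∑ j : Fin n, c j * a ^ (j : ℕ) * b ^ (n - j) = 0) :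
    ∃ f, a = b * f ∧ f ^ n + ∑ j : Fin n, c j * f ^ (j : ℕ) = 0 := by
  have hb1 : algebraMap R (FractionRing R) b ≠ 0 := by simpa using hb
  obtain ⟨z, hz⟩ : ∃ z, z = algebraMap R (FractionRing R) a / algebraMap R (FractionRing R) b :=
    ⟨_, rfl⟩
  have haz : algebraMap R (FractionRing R) a = algebraMap R (FractionRing R) b * z := by
    rw [hz]
    field_simp
  have hrel : z ^ n + ∑ j : Fin n, algebraMap R (FractionRing R) (c j) * z ^ (j : ℕ) = 0 := by
    have h1 := congrArg (algebraMap R (FractionRing R)) h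
    rw [map_add, map_sum, map_pow, haz, map_zero] at h1
    have h2 : (algebraMap R (FractionRing R) b) ^ n *
        (z ^ n + ∑ j : Fin n, algebraMap R (FractionRing R) (c j) * z ^ (j : ℕ)) = 0 := by
      rw [← h1, mul_add, mul_pow, Finset.mul_sum]
      refine congrArg _ (Finset.sum_congr rfl fun j _ => ?_)
      have : algebraMap R (FractionRing R) b ^ n = algebraMap R (FractionRing R) b ^ (n - j) *
          algebraMap R (FractionRing R) b ^ (j : ℕ) := by
        rw [← pow_add, Nat.sub_add_cancel j.2.le]
      rw [this, map_mul, map_mul, map_pow, map_pow, haz]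
      ring
    exact (mul_eq_zero.1 h2).resolve_left (pow_ne_zero _ hb1)
  have hintegral : IsIntegral R z := by
    refine ⟨Polynomial.X ^ n + ∑ j : Fin n, Polynomial.C (c j) * Polynomial.X ^ (j : ℕ), ?_, ?_⟩
    · refine Polynomial.monic_X_pow_add ?_
      refine (Polynomial.degree_sum_le _ _).trans_lt ?_
      rw [Finset.sup_lt_iff (WithBot.bot_lt_coe _)]
      intro j _
      exact (Polynomial.degree_C_mul_X_pow_le _ _).trans_lt (by exact_mod_cast j.2)
    · simpa [Polynomial.eval₂_finsetSum] using hrel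
  obtain ⟨f, rfl⟩ := IsIntegrallyClosed.isIntegral_iff.1 hintegral
  refine ⟨f, IsFractionRing.injective R (FractionRing R) (by rw [haz, map_mul]),
    IsFractionRing.injective R (FractionRing R) ?_⟩
  simpa using hrel

theorem totalDegree_le_of_monic_relation {σ k : Type*} [Field k] {n β : ℕ}
    {c : Fin n → MvPolynomial σ k} (hc : ∀ j, (c j).totalDegree ≤ β) {f : MvPolynomial σ k}
    (h : f ^ n + ∑ j : Fin n, c j * f ^ (j : ℕ) = 0) : f.totalDegree ≤ β := by
  by_contra! hlt
  have hn : n ≠ 0 := by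
    rintro rfl
    simp at h
  have h1 : (f ^ n).totalDegree ≤ β + (n - 1) * f.totalDegree := by
    rw [eq_neg_of_add_eq_zero_left h, MvPolynomial.totalDegree_neg]
    refine MvPolynomial.totalDegree_finsetSum_le fun j _ => ?_
    refine (MvPolynomial.totalDegree_mul _ _).trans (add_le_add (hc j) ?_)
    refine (MvPolynomial.totalDegree_pow _ _).trans (Nat.mul_le_mul_right _ ?_)
    have := j.2
    omega
  rw [totalDegree_pow_eq] at h1
  obtain ⟨m, rfl⟩ := Nat.exists_eq_succ_of_ne_zero hn
  simp only [Nat.succ_eq_add_one, Nat.add_sub_cancel] at h1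
  nlinarith

theorem rootClosed_Bd (K : ℕ → Type u) [∀ i, Field (K i)] (n : ℕ → ℕ) :
    RootClosed (Bd K n) (Fl K n) := by
  intro r c a b hb h
  choose d hd using fun j => (c j).2
  obtain ⟨β, hβ⟩ : ∃ β, ∀ j, d j ≤ β :=
    ⟨Finset.univ.sup d, fun j => Finset.le_sup (Finset.mem_univ j)⟩
  have hdeg : ∀ᶠ i in U, ∀ j, (rep (c j : Fl K n) i).totalDegree ≤ β :=
    Filter.eventually_all.2 fun j => (hd j).mono (hβ j)
  have hrel : ∀ᶠ i in U, rep a i ^ r +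
      ∑ j : Fin r, rep (c j : Fl K n) i * rep a i ^ (j : ℕ) * rep b i ^ (r - j) = 0 := by
    have : mk (rep a ^ r + ∑ j : Fin r, rep (c j : Fl K n) * rep a ^ (j : ℕ) * rep b ^ (r - j)) =
        (0 : Fl K n) := by
      simpa [map_sum] using h
    simpa using mk_eq_zero.1 this
  have key : ∀ᶠ i in U, ∃ f, rep a i = rep b i * f ∧ f.totalDegree ≤ β := by
    filter_upwards [hdeg, hrel, ne_zero_iff.1 hb] with i h1 h2 h3
    obtain ⟨f, hf, hf'⟩ := dvd_of_monic_relation h3 h2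
    exact ⟨f, hf, totalDegree_le_of_monic_relation h1 hf'⟩
  obtain ⟨f, hf⟩ : ∃ f : ∀ i, MvPolynomial (Fin (n i)) (K i), ∀ᶠ i in U,
      rep a i = rep b i * f i ∧ (f i).totalDegree ≤ β := by
    classical
    refine ⟨fun i => if h : ∃ f, rep a i = rep b i * f ∧ f.totalDegree ≤ β then h.choose else 0, ?_⟩
    filter_upwards [key] with i hi
    rw [dif_pos hi]
    exact hi.choose_spec
  refine ⟨⟨mk f, β, degLE_mk.2 (hf.mono fun i hi => hi.2)⟩, ?_⟩
  change a = b * mk f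
  nth_rewrite 1 [← mk_rep a, ← mk_rep b]
  rw [← map_mul, mk_eq_mk]
  exact hf.mono fun i hi => hi.1

section FrobeniusTrace

variable {σ K : Type*} [Field K] (q : ℕ) [ExpChar K q] [PerfectRing K q]

/-- The additive map sending `c x ^ (q m + e)` to `c ^ (1 / q) x ^ m` and killing all other
monomials. -/
noncomputable def frobTrace (e : σ →₀ ℕ) : MvPolynomial σ K →+ MvPolynomial σ K := by
  classical
  exact (Finsupp.liftAddHom fun m => if ∀ k, m k % q = e k then
    (MvPolynomial.monomial (m.mapRange (· / q) (Nat.zero_div q))).toAddMonoidHom.comp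
      ((frobeniusEquiv K q).symm : K →+ K) else 0).comp
    (AddMonoidAlgebra.coeffAddEquiv : AddMonoidAlgebra K (σ →₀ ℕ) ≃+ _).toAddMonoidHom

open Classical in
theorem frobTrace_monomial (e m : σ →₀ ℕ) (c : K) :
    frobTrace q e (MvPolynomial.monomial m c) = if ∀ k, m k % q = e k then
      MvPolynomial.monomial (m.mapRange (· / q) (Nat.zero_div q)) ((frobeniusEquiv K q).symm c)
      else 0 := by
  have : frobTrace q e (MvPolynomial.monomial m c) = Finsupp.liftAddHom _ (Finsupp.single m c) :=
    rfl
  rw [this, Finsupp.liftAddHom_apply_single]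
  split_ifs <;> rfl

theorem frobTrace_pow_mul (e : σ →₀ ℕ) (s a : MvPolynomial σ K) :
    frobTrace q e (s ^ q * a) = s * frobTrace q e a := by
  classical
  have hq := expChar_pos K q
  induction s using MvPolynomial.induction_on' with
  | add s t hs ht => rw [add_pow_expChar, add_mul, map_add, hs, ht, add_mul]
  | monomial m c =>
    induction a using MvPolynomial.induction_on' with
    | add a b ha hb => rw [mul_add, map_add, ha, hb, map_add, mul_add]
    | monomial l b =>
      rw [MvPolynomial.monomial_pow, MvPolynomial.monomial_mul, frobTrace_monomial,
        frobTrace_monomial]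
      have h1 : (∀ k, (q • m + l) k % q = e k) ↔ ∀ k, l k % q = e k := by
        refine forall_congr' fun k => ?_
        simp
      refine (if_congr h1 rfl rfl).trans ?_
      split_ifs
      · rw [MvPolynomial.monomial_mul, map_mul, map_pow, frobeniusEquiv_symm_pow_p]
        congr 2
        ext k
        simp [Nat.mul_add_div hq]
      · rw [mul_zero]

theorem coeff_frobTrace {e : σ →₀ ℕ} (he : ∀ k, e k < q) (m : σ →₀ ℕ) (a : MvPolynomial σ K) :
    (frobTrace q e a).coeff m = (frobeniusEquiv K q).symm (a.coeff (q • m + e)) := by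
  classical
  have hq := expChar_pos K q
  induction a using MvPolynomial.induction_on' with
  | add a b ha hb => rw [map_add, MvPolynomial.coeff_add, ha, hb, MvPolynomial.coeff_add, map_add]
  | monomial l b =>
    have h1 : l = q • m + e ↔
        (∀ k, l k % q = e k) ∧ l.mapRange (· / q) (Nat.zero_div q) = m := by
      constructor
      · rintro rfl
        refine ⟨fun k => by simp [Nat.mod_eq_of_lt (he k)], ?_⟩
        ext k
        simp [Nat.mul_add_div hq, Nat.div_eq_of_lt (he k)]
      · rintro ⟨h1, rfl⟩
        ext k
        simp [← h1, Nat.div_add_mod]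
    rw [frobTrace_monomial, MvPolynomial.coeff_monomial]
    simp only [h1]
    by_cases h2 : ∀ k, l k % q = e k
    · simp only [h2, implies_true, if_true, true_and, MvPolynomial.coeff_monomial]
      split_ifs <;> simp
    · simp [h2]

theorem totalDegree_frobTrace_le (e : σ →₀ ℕ) (a : MvPolynomial σ K) :
    (frobTrace q e a).totalDegree ≤ a.totalDegree := by
  classical
  conv_lhs => rw [a.as_sum, map_sum]
  refine MvPolynomial.totalDegree_finsetSum_le fun m hm => ?_
  rw [frobTrace_monomial]
  split_ifs
  · refine (MvPolynomial.totalDegree_monomial_le _ _).trans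
      (le_trans ?_ (MvPolynomial.le_totalDegree hm))
    rw [Finsupp.sum_mapRange_index (fun _ => rfl)]
    exact Finset.sum_le_sum fun k _ => Nat.div_le_self _ _
  · simp

theorem eq_zero_of_frobTrace {a : MvPolynomial σ K} (h : ∀ e, frobTrace q e a = 0) : a = 0 := by
  ext m
  have hq := expChar_pos K q
  have h1 := coeff_frobTrace q (e := m.mapRange (· % q) (Nat.zero_mod q))
    (fun k => by simpa using Nat.mod_lt _ hq) (m.mapRange (· / q) (Nat.zero_div q)) a
  have h2 : q • m.mapRange (· / q) (Nat.zero_div q) + m.mapRange (· % q) (Nat.zero_mod q) = m := by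
    ext k
    simp [Nat.div_add_mod]
  rw [h, h2, MvPolynomial.coeff_zero, eq_comm, map_eq_zero_iff _ (RingEquiv.injective _)] at h1
  rw [h1, MvPolynomial.coeff_zero]

end FrobeniusTrace

theorem exists_specialization {B F : Type u} [CommRing B] [IsDomain B] [CommRing F] [IsDomain F]
    [Algebra B F] (hF : Function.Injective (algebraMap B F)) {r : ℕ} {t : Fin r → F} (ht : t ≠ 0) :
    ∃ v : Fin r → B, v ≠ 0 ∧ ∀ c : Fin r → B, ∑ j, t j * algebraMap B F (c j) = 0 →
      ∑ j, v j * c j = 0 := by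
  have : FaithfulSMul B F := (faithfulSMul_iff_algebraMap_injective B F).2 hF
  let _ : Algebra (FractionRing B) (FractionRing F) := FractionRing.liftAlgebra B (FractionRing F)
  obtain ⟨j₀, hj₀⟩ := Function.ne_iff.1 ht
  have hj₁ : algebraMap F (FractionRing F) (t j₀) ≠ 0 := by simpa using hj₀
  obtain ⟨φ, hφ⟩ := Module.Projective.exists_dual_ne_zero (FractionRing B) hj₁
  obtain ⟨⟨s, hs⟩, hv⟩ := IsLocalization.exist_integer_multiples_of_finite (nonZeroDivisors B)
    (fun j => φ (algebraMap F (FractionRing F) (t j)))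
  choose v hv using hv
  have hs1 : algebraMap B (FractionRing B) s ≠ 0 := by simpa using nonZeroDivisors.ne_zero hs
  have hv' (j) : algebraMap B (FractionRing B) (v j) =
      algebraMap B (FractionRing B) s * φ (algebraMap F (FractionRing F) (t j)) := by
    rw [hv, Algebra.smul_def]
  refine ⟨v, fun h0 => ?_, fun c hc => ?_⟩
  · have := hv' j₀
    rw [h0, Pi.zero_apply, map_zero] at this
    exact mul_ne_zero hs1 hφ this.symm
  · apply IsFractionRing.injective B (FractionRing B)
    have h1 := congrArg (fun x => algebraMap B (FractionRing B) s *
      φ (algebraMap F (FractionRing F) x)) hc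
    simp only [map_sum, map_mul, map_zero, mul_zero] at h1 ⊢
    rw [← h1, Finset.mul_sum]
    refine Finset.sum_congr rfl fun j _ => ?_
    have h2 : algebraMap F (FractionRing F) (t j) *
        algebraMap F (FractionRing F) (algebraMap B F (c j)) =
        algebraMap B (FractionRing B) (c j) • algebraMap F (FractionRing F) (t j) := by
      rw [Algebra.smul_def, mul_comm, ← IsScalarTower.algebraMap_apply,
        ← IsScalarTower.algebraMap_apply]
    rw [hv', h2, map_smul, smul_eq_mul]
    ring

theorem frobeniusClosed_of_additive {B F : Type u} [CommRing B] [IsDomain B] [CommRing F]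
    [IsDomain F] [Algebra B F] (hF : Function.Injective (algebraMap B F)) {q : ℕ} {ι : Type*}
    (α : ι → F →+ F) (hB : ∀ e b, α e (algebraMap B F b) ∈ Set.range (algebraMap B F))
    (hmul : ∀ e s a, α e (s ^ q * a) = s * α e a) (hα : ∀ a, (∀ e, α e a = 0) → a = 0) :
    FrobeniusClosed B F q := by
  intro r s a t ht h
  obtain ⟨v, hv0, hv⟩ := exists_specialization hF ht
  choose β hβ using hB
  refine ⟨v, hv0, fun l => hF ?_⟩
  rw [map_zero]
  refine hα _ fun e => ?_
  have h1 := congrArg (α e) (h l)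
  rw [map_sum, map_zero] at h1
  simp only [hmul, ← hβ] at h1
  have h2 := congrArg (algebraMap B F) (hv _ h1)
  rw [map_sum, map_zero] at h2
  rw [map_sum, map_sum, ← h2]
  refine Finset.sum_congr rfl fun j _ => ?_
  rw [map_mul, map_pow, hmul, ← hβ, map_mul]

theorem eventually_charP {K : ℕ → Type u} [∀ i, Field (K i)] {p : ℕ} [hp : Fact p.Prime]
    [CharP (UP K) p] : ∀ᶠ i in U, CharP (K i) p := by
  have h : ((p : ℕ) : UP K) = 0 := CharP.cast_eq_zero _ _
  rw [← map_natCast mk, mk_eq_zero] at h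
  filter_upwards [h] with i hi
  exact (CharP.charP_iff_prime_eq_zero hp.out).2 hi

theorem frobeniusClosed_Bd (K : ℕ → Type u) [∀ i, Field (K i)] [∀ i, IsAlgClosed (K i)]
    (n : ℕ → ℕ) (q : ℕ) [hq : ExpChar (UP K) q] : FrobeniusClosed (Bd K n) (Fl K n) q := by
  classical
  have hinj : Function.Injective (algebraMap (Bd K n) (Fl K n)) := Subtype.val_injective
  rcases hq with _ | hp
  · refine frobeniusClosed_of_additive hinj (ι := Unit) (fun _ => AddMonoidHom.id _)
      (fun _ b => ⟨b, rfl⟩) (fun _ s a => ?_) (fun a h => h ())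
    simp
  · have : Fact q.Prime := ⟨hp⟩
    have hch := eventually_charP (K := K) (p := q)
    obtain ⟨α, hα⟩ : ∃ α : ∀ i, (Fin (n i) →₀ ℕ) →
        MvPolynomial (Fin (n i)) (K i) →+ MvPolynomial (Fin (n i)) (K i), ∀ i, CharP (K i) q →
        (∀ e s a, α i e (s ^ q * a) = s * α i e a) ∧
        (∀ e a, (α i e a).totalDegree ≤ a.totalDegree) ∧
        ∀ a, (∀ e, α i e a = 0) → a = 0 := by
      have h (i) : ∃ α : (Fin (n i) →₀ ℕ) →
        MvPolynomial (Fin (n i)) (K i) →+ MvPolynomial (Fin (n i)) (K i), CharP (K i) q →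
        (∀ e s a, α e (s ^ q * a) = s * α e a) ∧
        (∀ e a, (α e a).totalDegree ≤ a.totalDegree) ∧
        ∀ a, (∀ e, α e a = 0) → a = 0 := by
        by_cases hi : CharP (K i) q
        · have : ExpChar (K i) q := ExpChar.prime hp
          exact ⟨frobTrace q, fun _ => ⟨frobTrace_pow_mul q, totalDegree_frobTrace_le q,
            fun a => eq_zero_of_frobTrace q⟩⟩
        · exact ⟨0, fun h => (hi h).elim⟩
      choose α hα using h
      exact ⟨α, hα⟩
    refine frobeniusClosed_of_additive hinj (ι := ∀ i, (Fin (n i) →₀ ℕ))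
      (fun e => amap fun i => α i (e i)) ?_ ?_ ?_
    · rintro e ⟨b, d, hd⟩
      refine ⟨⟨amap (fun i => α i (e i)) b, d, degLE_mk.2 ?_⟩, rfl⟩
      filter_upwards [hd, hch] with i h1 h2
      exact ((hα i h2).2.1 _ _).trans h1
    · intro e s a
      obtain ⟨s, rfl⟩ := mk_surjective s
      obtain ⟨a, rfl⟩ := mk_surjective a
      rw [← map_pow, ← map_mul, amap_mk, amap_mk, ← map_mul, mk_eq_mk]
      filter_upwards [hch] with i h2
      exact (hα i h2).1 _ _ _
    · intro a h
      obtain ⟨a, rfl⟩ := mk_surjective a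
      have h' (i) : ∃ e, CharP (K i) q → α i e (a i) = 0 → a i = 0 := by
        by_contra! h
        exact (h 0).2.2 ((hα i (h 0).1).2.2 _ fun e => (h e).2.1)
      choose e he using h'
      have h1 := h e
      rw [amap_mk, mk_eq_zero] at h1
      rw [mk_eq_zero]
      filter_upwards [h1, hch] with i h1 h2
      exact he i h2 h1

open scoped TensorProduct

/-- Finite algebras over `B` which are domains of projective dimension at most `p` remain domains
after tensoring with `F`. -/
def TensorDomain (B F : Type u) [CommRing B] [CommRing F] [Algebra B F] (p : ℕ) : Prop :=
  ∀ (C : Type u) [CommRing C] [IsDomain C] [Algebra B C] [Module.Finite B C], PD B p C →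
    IsDomain (F ⊗[B] C)

theorem isDomain_tensor_of_division {B' B F' F C : Type u} [CommRing B'] [CommRing B] [CommRing F']
    [CommRing F] [Algebra B' B] [Algebra B F] [Algebra B' F'] [Algebra F' F] [Algebra B' F]
    [IsScalarTower B' B F] [IsScalarTower B' F' F] {D x : B} {e p : ℕ} [IsDomain B] [IsDomain F]
    [CommRing C] [IsDomain C] [Algebra B C] [Module.Finite B C] (hB : Division B' B D x e)
    (hF : Division F' F (algebraMap B F D) (algebraMap B F x) e) (hD : algebraMap B F D ≠ 0)
    (hC : ∀ c : C, D • c = 0) (hpd : PD B (p + 1) C) (h : TensorDomain B' F' p) :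
    IsDomain (F ⊗[B] C) := by
  let _ : Algebra B' C := ((algebraMap B C).comp (algebraMap B' B)).toAlgebra
  have : IsScalarTower B' B C := IsScalarTower.of_algebraMap_eq fun _ => rfl
  have : Module.Finite B' C := hB.finite hC
  have hD' : D ≠ 0 := fun h => hD (by rw [h, map_zero])
  have hdom : IsDomain (F' ⊗[B'] C) := h C (hB.pd_drop hD' p hC hpd)
  have hmul (y z : F' ⊗[B'] C) :
      phi B' B F' F C (y * z) = phi B' B F' F C y * phi B' B F' F C z := by
    induction y with
    | zero => simp
    | add y y' hy hy' => rw [add_mul, map_add, hy, hy', map_add, add_mul]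
    | tmul f c =>
      induction z with
      | zero => simp
      | add z z' hz hz' => rw [mul_add, map_add, hz, hz', map_add, mul_add]
      | tmul f' c' => simp
  exact (MulEquiv.ofBijective (⟨phi B' B F' F C, hmul⟩ : F' ⊗[B'] C →ₙ* F ⊗[B] C)
    ⟨phi_injective hB hF hD hC, phi_surjective hF hC⟩).symm.isDomain _

theorem algebraMap_injective_of_projective {B C : Type u} [CommRing B] [IsDomain B] [CommRing C]
    [Nontrivial C] [Algebra B C] [Module.Projective B C] : Function.Injective (algebraMap B C) := by
  rw [injective_iff_map_eq_zero]
  intro b hb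
  by_contra h0
  have h1 : b • (1 : C) = b • (0 : C) := by rw [Algebra.smul_def, hb, zero_mul, smul_zero]
  exact one_ne_zero (smul_right_injective C h0 h1)

theorem tensorDomain_Bd (K : ℕ → Type u) [∀ i, Field (K i)] [∀ i, IsAlgClosed (K i)] (p : ℕ) :
    ∀ n : ℕ → ℕ, TensorDomain (Bd K n) (Fl K n) p := by
  have : ∀ i, Infinite (K i) := fun i => IsAlgClosed.instInfinite
  obtain ⟨q, hq⟩ := ExpChar.exists (UP K)
  induction p with
  | zero =>
    intro n C _ _ _ _ hpd
    have := pd_zero_iff.1 hpd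
    have := flat_Bd K n
    have : ExpChar (Bd K n) q :=
      expChar_of_injective_ringHom (algebraMap (UP K) (Bd K n)).injective q
    exact isDomain_tensor_of_injective Subtype.val_injective algebraMap_injective_of_projective
      (rootClosed_Bd K n) (frobeniusClosed_Bd K n q)
  | succ p ih =>
    intro n C _ _ _ _ hpd
    by_cases hinj : Function.Injective (algebraMap (Bd K n) C)
    · have := flat_Bd K n
      have : ExpChar (Bd K n) q :=
        expChar_of_injective_ringHom (algebraMap (UP K) (Bd K n)).injective q
      exact isDomain_tensor_of_injective Subtype.val_injective hinj
        (rootClosed_Bd K n) (frobeniusClosed_Bd K n q)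
    · obtain ⟨D, hD, hD0⟩ : ∃ D, algebraMap (Bd K n) C D = 0 ∧ D ≠ 0 := by
        rw [injective_iff_map_eq_zero] at hinj
        push Not at hinj
        exact hinj
      have hkill (c : C) : D • c = 0 := by rw [Algebra.smul_def, hD, zero_mul]
      have hDr : (D : Fl K n) ∉ Set.range (algebraMap (UP K) (Fl K n)) := by
        intro h
        have := (isUnit_of_mem_range K n D hD0 h).map (algebraMap (Bd K n) C)
        rw [hD] at this
        exact not_isUnit_zero this
      obtain ⟨n', e, x, a1, a2, t1, hB, hF⟩ := exists_division_algebra K n D hDr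
      exact isDomain_tensor_of_division hB hF (fun h => hD0 (Subtype.ext h)) hkill hpd (ih n')

theorem isPrime_map_of_isDomain_tensor {B F : Type u} [CommRing B] [CommRing F] [Algebra B F]
    {P : Ideal B} [IsDomain (F ⊗[B] (B ⧸ P))] : (P.map (algebraMap B F)).IsPrime := by
  rw [← Ideal.Quotient.isDomain_iff_prime]
  exact (Algebra.TensorProduct.quotIdealMapEquivTensorQuot F P).toMulEquiv.isDomain _

theorem TensorDomain.isPrime_map {B F k : Type u} [Field k] [CommRing B] [CommRing F] [Algebra B F]
    {b : ℕ} [Algebra (MvPolynomial (Fin b) k) B] [Module.Flat (MvPolynomial (Fin b) k) B]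
    (h : TensorDomain B F b) {P : Ideal (MvPolynomial (Fin b) k)}
    (hP : (P.map (algebraMap (MvPolynomial (Fin b) k) B)).IsPrime) :
    ((P.map (algebraMap (MvPolynomial (Fin b) k) B)).map (algebraMap B F)).IsPrime := by
  have := h (B ⧸ P.map (algebraMap (MvPolynomial (Fin b) k) B)) (pd_quot_map P)
  exact isPrime_map_of_isDomain_tensor

/-- A noetherian model of finitely many elements of bounded degree, over which the ultraproduct is
flat with prime fibres. -/
theorem exists_model (K : ℕ → Type u) [∀ i, Field (K i)] [∀ i, IsAlgClosed (K i)] (n : ℕ → ℕ)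
    (T : Finset (Fl K n)) (hT : ∀ t ∈ T, t ∈ Bd K n) :
    ∃ (b : ℕ) (_ : Algebra (MvPolynomial (Fin b) (UP K)) (Fl K n)),
      Module.Flat (MvPolynomial (Fin b) (UP K)) (Fl K n) ∧
      (∀ a : MvPolynomial (Fin b) (UP K), algebraMap _ (Fl K n) a ∈ Bd K n) ∧
      (∀ t ∈ T, t ∈ Set.range (algebraMap (MvPolynomial (Fin b) (UP K)) (Fl K n))) ∧
      ∀ P : Ideal (MvPolynomial (Fin b) (UP K)), P.IsPrime →
        (P.map (algebraMap _ (Fl K n))).IsPrime := by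
  classical
  obtain ⟨J, ⟨ε⟩⟩ := exists_Bd_equiv K n
  obtain ⟨b, a, hflat, -, hrange, hprime⟩ := exists_polynomial_model ε.symm.toRingEquiv
    (Finset.univ.image fun t : {t // t ∈ T} => (⟨t.1, hT t.1 t.2⟩ : Bd K n))
  let a' := ((algebraMap (Bd K n) (Fl K n)).comp
    (algebraMap (MvPolynomial (Fin b) (UP K)) (Bd K n))).toAlgebra
  have tower : IsScalarTower (MvPolynomial (Fin b) (UP K)) (Bd K n) (Fl K n) :=
    IsScalarTower.of_algebraMap_eq fun _ => rfl
  have := flat_Bd K n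
  refine ⟨b, a', Module.Flat.trans _ (Bd K n) _, fun a => Subtype.prop _, fun t ht => ?_,
    fun P hP => ?_⟩
  · obtain ⟨y, hy⟩ := hrange ⟨t, hT t ht⟩
      (Finset.mem_image_of_mem (fun t : {t // t ∈ T} => (⟨t.1, hT t.1 t.2⟩ : Bd K n))
        (Finset.mem_univ ⟨t, ht⟩))
    exact ⟨y, congrArg Subtype.val hy⟩
  · have h := (tensorDomain_Bd K b n).isPrime_map (hprime P hP)
    rwa [Ideal.map_map] at h

theorem exists_injective_pi_quot {A : Type u} [CommRing A] [IsNoetherianRing A] (P : Ideal A)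
    [P.IsPrime] (X : Type u) [AddCommGroup X] [Module A X] [Module.Finite A X]
    (hP : ∀ r ∈ P, ∀ x : X, r • x = 0) (hreg : ∀ r ∉ P, IsSMulRegular X r) :
    ∃ (k : ℕ) (f : X →ₗ[A] (Fin k → A ⧸ P)), Function.Injective f := by
  have hT : Module.IsTorsionBySet A X P := fun x r => hP r r.2 x
  let _ : Module (A ⧸ P) X := hT.module
  have : IsScalarTower A (A ⧸ P) X := IsScalarTower.of_algebraMap_smul fun r x => rfl
  have : Module.Finite (A ⧸ P) X := Module.Finite.of_restrictScalars_finite A _ _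
  obtain ⟨M₀, D, hfree, hD, hkill⟩ := exists_free_torsion (A ⧸ P) X
  have : Module.Finite (A ⧸ P) M₀ := inferInstance
  obtain ⟨k, ⟨b⟩⟩ : ∃ k, Nonempty (Module.Basis (Fin k) (A ⧸ P) M₀) :=
    ⟨_, ⟨Module.finBasis (A ⧸ P) M₀⟩⟩
  have hmem (x : X) : LinearMap.lsmul (A ⧸ P) X D x ∈ M₀ := by
    have := hkill (M₀.mkQ x)
    rwa [← map_smul, Submodule.mkQ_apply, Submodule.Quotient.mk_eq_zero] at this
  refine ⟨k, (b.equivFun.toLinearMap ∘ₗ (LinearMap.lsmul (A ⧸ P) X D).codRestrict M₀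
    hmem).restrictScalars A, b.equivFun.injective.comp fun x y hxy => ?_⟩
  have hxy : D • x = D • y := congrArg Subtype.val hxy
  obtain ⟨d, rfl⟩ := Ideal.Quotient.mk_surjective D
  refine hreg d (fun h => hD (Ideal.Quotient.eq_zero_iff_mem.2 h)) ?_
  exact hxy

variable {A S : Type u} [CommRing A] [CommRing S] [Algebra A S] [Module.Flat A S]

theorem isSMulRegular_tensor_of_injective {X Y : Type u} [AddCommGroup X] [Module A X]
    [AddCommGroup Y] [Module A Y] {f : X →ₗ[A] Y} (hf : Function.Injective f) {s : S}
    (h : IsSMulRegular (S ⊗[A] Y) s) : IsSMulRegular (S ⊗[A] X) s :=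
  h.of_injective (f.baseChange S) (Module.Flat.lTensor_preserves_injective_linearMap f hf)

omit [Module.Flat A S] in
theorem isSMulRegular_tensor_pi_quot {P : Ideal A} (hPS : (P.map (algebraMap A S)).IsPrime) {s : S}
    (hs : s ∉ P.map (algebraMap A S)) (k : ℕ) : IsSMulRegular (S ⊗[A] (Fin k → A ⧸ P)) s := by
  rw [(TensorProduct.piRight A S S fun _ : Fin k => A ⧸ P).isSMulRegular_congr]
  refine IsSMulRegular.pi fun _ => ?_
  rw [← (Algebra.TensorProduct.quotIdealMapEquivTensorQuot S P).toLinearEquiv.isSMulRegular_congr,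
    isSMulRegular_quotient_iff_mem_of_smul_mem]
  exact fun x hx => (hPS.mem_or_mem hx).resolve_left hs

theorem isSMulRegular_tensor [IsNoetherianRing A] {P : Ideal A} [P.IsPrime]
    (hPS : (P.map (algebraMap A S)).IsPrime) {s : S} (hs : s ∉ P.map (algebraMap A S)) (k : ℕ) :
    ∀ (X : Type u) [AddCommGroup X] [Module A X] [Module.Finite A X]
      (_ : ∀ r ∈ P ^ k, ∀ x : X, r • x = 0) (_ : ∀ r ∉ P, IsSMulRegular X r),
      IsSMulRegular (S ⊗[A] X) s := by
  induction k with
  | zero =>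
    intro X _ _ _ hP _
    have : Subsingleton X := subsingleton_of_forall_eq 0 fun x => by
      simpa using hP 1 (by simp) x
    intro x y _
    exact Subsingleton.elim x y
  | succ k ih =>
    intro X _ _ _ hP hreg
    let X' : Submodule A X :=
      { carrier := {x | ∀ r ∈ P, r • x = 0}
        zero_mem' := by simp
        add_mem' := fun ha hb r hr => by rw [smul_add, ha r hr, hb r hr, add_zero]
        smul_mem' := fun c x hx r hr => by rw [smul_comm, hx r hr, smul_zero] }
    have h1 : IsSMulRegular (S ⊗[A] X') s := by
      obtain ⟨l, f, hf⟩ := exists_injective_pi_quot P X' (fun r hr x => Subtype.ext (x.2 r hr))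
        (fun r hr => (hreg r hr).submodule X' r)
      exact isSMulRegular_tensor_of_injective hf (isSMulRegular_tensor_pi_quot hPS hs l)
    have h2 : IsSMulRegular (S ⊗[A] (X ⧸ X')) s := by
      refine ih (X ⧸ X') (fun r hr x => ?_) (fun r hr => ?_)
      · obtain ⟨x, rfl⟩ := X'.mkQ_surjective x
        rw [← map_smul, Submodule.mkQ_apply, Submodule.Quotient.mk_eq_zero]
        intro r' hr'
        rw [smul_smul]
        exact hP _ (by rw [pow_succ']; exact Ideal.mul_mem_mul hr' hr) x
      · rw [isSMulRegular_quotient_iff_mem_of_smul_mem]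
        intro x hx r' hr'
        refine (hreg r hr).right_eq_zero_of_smul ?_
        rw [smul_comm]
        exact hx r' hr'
    refine isSMulRegular_of_range_eq_ker (f := X'.subtype.baseChange S)
      (g := X'.mkQ.baseChange S)
      (Module.Flat.lTensor_preserves_injective_linearMap _ X'.subtype_injective) ?_ h1 h2
    exact SetLike.ext fun x => (lTensor_exact S (LinearMap.exact_subtype_mkQ X')
      X'.mkQ_surjective x).symm

section

variable {A : Type u} (S : Type u) [CommRing A] [CommRing S] [Algebra A S] {m : ℕ}

/-- The coordinatewise algebra map `A ^ m → S ^ m`. -/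
def vmap (v : Fin m → A) : Fin m → S := fun l => algebraMap A S (v l)

/-- The submodule of `S ^ m` generated by a submodule of `A ^ m`. -/
def ext (Q : Submodule A (Fin m → A)) : Submodule S (Fin m → S) :=
  Submodule.span S (vmap S '' (Q : Set (Fin m → A)))

variable {S}

theorem vmap_mem_ext {Q : Submodule A (Fin m → A)} {v : Fin m → A} (hv : v ∈ Q) :
    vmap S v ∈ ext S Q :=
  Submodule.subset_span ⟨v, hv, rfl⟩

theorem ext_mono {Q Q' : Submodule A (Fin m → A)} (h : Q ≤ Q') : ext S Q ≤ ext S Q' :=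
  Submodule.span_mono (Set.image_mono h)

theorem ext_span (T : Set (Fin m → A)) :
    ext S (Submodule.span A T) = Submodule.span S (vmap S '' T) := by
  refine le_antisymm (Submodule.span_le.2 ?_) (Submodule.span_mono
    (Set.image_mono Submodule.subset_span))
  rintro _ ⟨v, hv, rfl⟩
  induction hv using Submodule.span_induction with
  | mem x hx => exact Submodule.subset_span ⟨x, hx, rfl⟩
  | zero =>
    have h : vmap S (0 : Fin m → A) = 0 := by ext; simp [vmap]
    rw [h]
    exact Submodule.zero_mem _
  | add x y _ _ hx hy =>
    have h : vmap S (x + y) = vmap S x + vmap S y := by ext; simp [vmap]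
    rw [h]
    exact Submodule.add_mem _ hx hy
  | smul a x _ hx =>
    have h : vmap S (a • x) = algebraMap A S a • vmap S x := by ext; simp [vmap]
    rw [h]
    exact Submodule.smul_mem _ _ hx

theorem piScalarRight_one_tmul (v : Fin m → A) :
    TensorProduct.piScalarRight A S S (Fin m) (1 ⊗ₜ v) = vmap S v := by
  ext l
  simp [vmap, Algebra.smul_def]

theorem piScalarRight_mem_ext {Q : Submodule A (Fin m → A)} (z : S ⊗[A] (Fin m → A)) :
    TensorProduct.piScalarRight A S S (Fin m) z ∈ ext S Q ↔ Q.mkQ.baseChange S z = 0 := by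
  have h1 : ext S Q = (Q.baseChange S).map
      (TensorProduct.piScalarRight A S S (Fin m)).toLinearMap := by
    rw [Submodule.baseChange_eq_span, Submodule.map_span, ext]
    congr 1
    ext v
    constructor
    · rintro ⟨w, hw, rfl⟩
      exact ⟨1 ⊗ₜ w, ⟨w, hw, rfl⟩, piScalarRight_one_tmul w⟩
    · rintro ⟨_, ⟨w, hw, rfl⟩, rfl⟩
      exact ⟨w, hw, (piScalarRight_one_tmul w).symm⟩
  rw [h1]
  refine (Submodule.mem_map_equiv _).trans ?_
  rw [LinearEquiv.symm_apply_apply]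
  exact (lTensor_exact S (LinearMap.exact_subtype_mkQ Q) Q.mkQ_surjective z).symm

theorem ext_iInf [Module.Flat A S] {ι : Type} [Fintype ι] (Q : ι → Submodule A (Fin m → A)) :
    ext S (⨅ i, Q i) = ⨅ i, ext S (Q i) := by
  classical
  refine le_antisymm (le_iInf fun i => ext_mono (iInf_le _ i)) fun v hv => ?_
  obtain ⟨z, rfl⟩ := (TensorProduct.piScalarRight A S S (Fin m)).surjective v
  simp only [Submodule.mem_iInf, piScalarRight_mem_ext] at hv
  rw [piScalarRight_mem_ext]
  obtain ⟨N, hN⟩ : ∃ N, N = ⨅ i, Q i := ⟨_, rfl⟩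
  rw [← hN]
  have hker : N = LinearMap.ker (LinearMap.pi fun i => (Q i).mkQ) := by
    rw [LinearMap.ker_pi, hN]
    simp
  obtain ⟨g, hg, hgN⟩ : ∃ g : ((Fin m → A) ⧸ N) →ₗ[A] (∀ i, (Fin m → A) ⧸ Q i),
      Function.Injective g ∧ g ∘ₗ N.mkQ = LinearMap.pi fun i => (Q i).mkQ :=
    ⟨N.liftQ _ hker.le, LinearMap.ker_eq_bot.1 (Submodule.ker_liftQ_eq_bot _ _ _ hker.ge),
      Submodule.liftQ_mkQ _ _ _⟩
  have hgS : Function.Injective (g.baseChange S) :=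
    Module.Flat.lTensor_preserves_injective_linearMap g hg
  apply hgS
  rw [map_zero, ← LinearMap.comp_apply, ← LinearMap.baseChange_comp, hgN]
  apply (TensorProduct.piRight A S S fun i => (Fin m → A) ⧸ Q i).injective
  rw [map_zero]
  ext i
  have h2 : ∀ y : S ⊗[A] (Fin m → A), TensorProduct.piRight A S S (fun i => (Fin m → A) ⧸ Q i)
      ((LinearMap.pi fun i => (Q i).mkQ).baseChange S y) i = (Q i).mkQ.baseChange S y := by
    intro y
    induction y with
    | zero => simp
    | add a b ha hb => simp only [map_add, Pi.add_apply, ha, hb]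
    | tmul a b => simp
  rw [h2, hv]
  rfl

theorem mem_ext_of_mem_map {Q : Submodule A (Fin m → A)} {I : Ideal A}
    (h : ∀ r ∈ I, ∀ v, r • v ∈ Q) {s : S} (hs : s ∈ I.map (algebraMap A S)) (v : Fin m → S) :
    s • v ∈ ext S Q := by
  have h1 : I.map (algebraMap A S) ≤ (ext S Q).colon Set.univ := by
    rw [Ideal.map_le_iff_le_comap]
    intro r hr
    rw [Ideal.mem_comap, Submodule.mem_colon]
    intro v _
    obtain ⟨z, rfl⟩ := (TensorProduct.piScalarRight A S S (Fin m)).surjective v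
    rw [← map_smul, piScalarRight_mem_ext, map_smul]
    have h2 (y : S ⊗[A] ((Fin m → A) ⧸ Q)) : algebraMap A S r • y = 0 := by
      rw [algebraMap_smul]
      induction y with
      | zero => simp
      | add a b ha hb => rw [smul_add, ha, hb, add_zero]
      | tmul a b =>
        obtain ⟨b, rfl⟩ := Q.mkQ_surjective b
        rw [← TensorProduct.tmul_smul, ← map_smul, Submodule.mkQ_apply,
          (Submodule.Quotient.mk_eq_zero _).2 (h r hr b), TensorProduct.tmul_zero]
    exact h2 _
  exact Submodule.mem_colon.1 (h1 hs) v trivial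

theorem ext_mem_or_mem [Module.Flat A S] [IsNoetherianRing A] {Q : Submodule A (Fin m → A)}
    {P : Ideal A} [P.IsPrime] (hPS : (P.map (algebraMap A S)).IsPrime) {k : ℕ}
    (hk : ∀ r ∈ P ^ k, ∀ v, r • v ∈ Q) (hQ : ∀ r ∉ P, ∀ v, r • v ∈ Q → v ∈ Q) {s : S}
    {v : Fin m → S} (h : s • v ∈ ext S Q) : s ∈ P.map (algebraMap A S) ∨ v ∈ ext S Q := by
  by_contra! hne
  obtain ⟨z, rfl⟩ := (TensorProduct.piScalarRight A S S (Fin m)).surjective v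
  rw [← map_smul, piScalarRight_mem_ext, map_smul] at h
  rw [piScalarRight_mem_ext] at hne
  refine hne.2 ((isSMulRegular_tensor hPS hne.1 k ((Fin m → A) ⧸ Q) ?_ ?_).right_eq_zero_of_smul h)
  · intro r hr x
    obtain ⟨x, rfl⟩ := Q.mkQ_surjective x
    rw [← map_smul, Submodule.mkQ_apply, Submodule.Quotient.mk_eq_zero]
    exact hk r hr x
  · intro r hr
    rw [isSMulRegular_quotient_iff_mem_of_smul_mem]
    exact hQ r hr

theorem mem_of_vmap_mem_ext [Module.FaithfullyFlat A S] {Q : Submodule A (Fin m → A)}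
    {v : Fin m → A} (h : vmap S v ∈ ext S Q) : v ∈ Q := by
  rw [← piScalarRight_one_tmul, piScalarRight_mem_ext, LinearMap.baseChange_tmul] at h
  rw [← Submodule.Quotient.mk_eq_zero, ← Submodule.mkQ_apply]
  exact Module.FaithfullyFlat.tensorProduct_mk_injective (A := A) (B := S) _
    (h.trans (TensorProduct.tmul_zero _ _).symm)

theorem faithfullyFlat_of_isPrime_map [Module.Flat A S]
    (h : ∀ P : Ideal A, P.IsPrime → (P.map (algebraMap A S)).IsPrime) :
    Module.FaithfullyFlat A S := by
  refine (Module.FaithfullyFlat.iff_flat_and_proper_ideal A S).2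
    ⟨inferInstance, fun I hI htop => ?_⟩
  obtain ⟨M, hM, hIM⟩ := Ideal.exists_le_maximal I hI
  rw [Ideal.smul_top_eq_map, Submodule.restrictScalars_eq_top_iff] at htop
  exact (h M hM.isPrime).ne_top (top_le_iff.1 (htop ▸ Ideal.map_mono hIM))

variable (S) in
theorem exists_extended_decomposition [IsNoetherianRing A] [Module.Flat A S]
    (h : ∀ P : Ideal A, P.IsPrime → (P.map (algebraMap A S)).IsPrime)
    (N : Submodule A (Fin m → A)) :
    ∃ (t : ℕ) (Q : Fin t → Submodule A (Fin m → A)) (P : Fin t → Ideal A) (e : ℕ),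
      ext S N = ⨅ j, ext S (Q j) ∧ (∀ j, ((P j).map (algebraMap A S)).IsPrime) ∧
      (∀ j s v, s • v ∈ ext S (Q j) → s ∈ (P j).map (algebraMap A S) ∨ v ∈ ext S (Q j)) ∧
      (∀ j, ∀ s ∈ (P j).map (algebraMap A S) ^ e, ∀ v, s • v ∈ ext S (Q j)) ∧
      Function.Injective (fun j => (P j).map (algebraMap A S)) ∧
      ∀ j, ∃ v, (∀ i, i ≠ j → v ∈ ext S (Q i)) ∧ v ∉ ext S (Q j) := by
  classical
  have : Module.FaithfullyFlat A S := faithfullyFlat_of_isPrime_map h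
  obtain ⟨T, hT⟩ := Submodule.IsLasker.exists_isMinimalPrimaryDecomposition
    (Submodule.isLasker A (Fin m → A)) N
  obtain ⟨Q, hQ⟩ : ∃ Q : Fin T.card → Submodule A (Fin m → A), Q = fun j => (T.equivFin.symm j).1 :=
    ⟨_, rfl⟩
  have hQT (j) : Q j ∈ T := hQ ▸ (T.equivFin.symm j).2
  have hQinj : Function.Injective Q := by
    rw [hQ]
    exact Subtype.val_injective.comp T.equivFin.symm.injective
  have hQsurj (J) (hJ : J ∈ T) : ∃ j, Q j = J := ⟨T.equivFin ⟨J, hJ⟩, by simp [hQ]⟩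
  obtain ⟨P, hP⟩ : ∃ P : Fin T.card → Ideal A, ∀ j, P j = ((Q j).colon Set.univ).radical :=
    ⟨_, fun _ => rfl⟩
  have hprime (j) : (P j).IsPrime := hP j ▸ (hT.primary (hQT j)).isPrime_radical_colon
  have hexp (j) : ∃ k, P j ^ k ≤ (Q j).colon Set.univ := by
    rw [hP j]
    exact Ideal.exists_radical_pow_le_of_fg _ (IsNoetherian.noetherian _)
  choose k hk using hexp
  have hk' (j) : ∀ r ∈ P j ^ k j, ∀ v, r • v ∈ Q j := fun r hr v =>
    Submodule.mem_colon.1 (hk j hr) v trivial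
  have hinf : N = ⨅ j, Q j := by
    rw [← hT.inf_eq]
    refine le_antisymm (le_iInf fun j => Finset.inf_le (hQT j)) (Finset.le_inf fun J hJ => ?_)
    obtain ⟨j, rfl⟩ := hQsurj J hJ
    exact iInf_le _ j
  refine ⟨T.card, Q, P, ∑ j, k j, by rw [hinf, ext_iInf], fun j => h _ (hprime j),
    fun j s v hs => ?_, fun j s hs v => ?_, fun i j hij => ?_, fun j => ?_⟩
  · have := hprime j
    refine ext_mem_or_mem (h _ (hprime j)) (hk' j) (fun r hr v hv => ?_) hs
    refine ((hT.primary (hQT j)).mem_or_mem hv).resolve_right ?_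
    rwa [← hP j]
  · rw [← Ideal.map_pow] at hs
    refine mem_ext_of_mem_map (fun r hr v => hk' j r ?_ v) hs v
    exact Ideal.pow_le_pow_right (Finset.single_le_sum (fun _ _ => Nat.zero_le _)
      (Finset.mem_univ j)) hr
  · by_contra hne
    refine hT.distinct (hQT i) (hQT j) (hQinj.ne hne) ?_
    have := congrArg (Ideal.comap (algebraMap A S)) hij
    simp only [Ideal.comap_map_eq_self_of_faithfullyFlat] at this
    simpa [hP] using this
  · obtain ⟨v, hv, hvj⟩ := SetLike.not_le_iff_exists.1 (hT.minimal (hQT j))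
    refine ⟨vmap S v, fun i hi => vmap_mem_ext ?_, fun hv' => hvj (mem_of_vmap_mem_ext hv')⟩
    exact Finset.inf_le (f := id) (Finset.mem_erase.2 ⟨hQinj.ne hi, hQT i⟩) hv

end

open scoped Pointwise

theorem eventually_forall {X : ℕ → Type*} [∀ i, Nonempty (X i)] {p : ∀ i, X i → Prop}
    (h : ∀ f : ∀ i, X i, ∀ᶠ i in U, p i (f i)) : ∀ᶠ i in U, ∀ x, p i x := by
  have h1 (i) : ∃ x, p i x → ∀ y, p i y := by
    by_cases hy : ∃ y, ¬ p i y
    · obtain ⟨y, hy⟩ := hy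
      exact ⟨y, fun h => absurd h hy⟩
    · exact ⟨Classical.arbitrary _, fun _ => not_exists_not.1 hy⟩
  choose f hf using h1
  filter_upwards [h f] with i hi using hf i hi

section Transfer

variable {A : ℕ → Type u} [∀ i, CommRing (A i)] {m r s : ℕ}

/-- The class of a sequence of vectors. -/
noncomputable def mkv (v : ∀ i, Fin m → A i) : Fin m → UP A := fun l => mk fun i => v i l

/-- The components of the submodule generated by a family of vectors over an ultraproduct. -/
def spn (g : Fin r → Fin m → UP A) (i : ℕ) : Submodule (A i) (Fin m → A i) :=
  Submodule.span (A i) (Set.range fun a l => rep (g a l) i)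

/-- The components of the ideal generated by a family of elements of an ultraproduct. -/
def idl (g : Fin r → UP A) (i : ℕ) : Ideal (A i) := Ideal.span (Set.range fun a => rep (g a) i)

theorem mk_smul_mkv (x : ∀ i, A i) (v : ∀ i, Fin m → A i) :
    mk x • mkv v = mkv fun i => x i • v i := by
  ext l
  exact (map_mul mk x fun i => v i l).symm

theorem mkv_rep (v : Fin m → UP A) : mkv (fun i l => rep (v l) i) = v := by
  ext l
  exact mk_rep _

theorem exists_sum_mul_eq_iff {ι : Type*} [Finite ι] (g : Fin r → ι → UP A) (v : ∀ i, ι → A i) :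
    (∃ c : Fin r → UP A, ∀ l, ∑ a, c a * g a l = mk fun i => v i l) ↔
      ∀ᶠ i in U, ∃ c : Fin r → A i, ∀ l, ∑ a, c a * rep (g a l) i = v i l := by
  have key (c : Fin r → ∀ i, A i) : (∀ l, ∑ a, mk (c a) * g a l = mk fun i => v i l) ↔
      ∀ᶠ i in U, ∀ l, ∑ a, c a i * rep (g a l) i = v i l := by
    rw [eventually_all]
    refine forall_congr' fun l => ?_
    have : ∑ a, mk (c a) * g a l = mk (∑ a, c a * rep (g a l)) := by simp [map_sum]
    rw [this, mk_eq_mk]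
    simp
  constructor
  · rintro ⟨c, hc⟩
    have := (key fun a => rep (c a)).1 (by simpa using hc)
    exact this.mono fun i hi => ⟨_, hi⟩
  · intro h
    have h1 (i) : ∃ c : Fin r → A i, (∃ c : Fin r → A i, ∀ l, ∑ a, c a * rep (g a l) i = v i l) →
        ∀ l, ∑ a, c a * rep (g a l) i = v i l := by
      by_cases hi : ∃ c : Fin r → A i, ∀ l, ∑ a, c a * rep (g a l) i = v i l
      · exact ⟨hi.choose, fun _ => hi.choose_spec⟩
      · exact ⟨0, fun h => absurd h hi⟩
    choose c hc using h1
    exact ⟨fun a => mk fun i => c i a, (key _).2 (h.mono fun i hi => hc i hi)⟩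

theorem mkv_mem_span_iff (g : Fin r → Fin m → UP A) (v : ∀ i, Fin m → A i) :
    mkv v ∈ Submodule.span (UP A) (Set.range g) ↔ ∀ᶠ i in U, v i ∈ spn g i := by
  simp only [spn, Submodule.mem_span_range_iff_exists_fun, funext_iff, Finset.sum_apply,
    Pi.smul_apply, smul_eq_mul]
  exact exists_sum_mul_eq_iff g v

theorem mk_mem_span_iff (g : Fin r → UP A) (x : ∀ i, A i) :
    mk x ∈ Ideal.span (Set.range g) ↔ ∀ᶠ i in U, x i ∈ idl g i := by
  simp only [idl, Ideal.mem_span_range_iff_exists_fun]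
  simpa using exists_sum_mul_eq_iff (ι := Unit) (fun a _ => g a) (fun i _ => x i)

theorem eventually_idl_isPrime (g : Fin r → UP A) (h : (Ideal.span (Set.range g)).IsPrime) :
    ∀ᶠ i in U, (idl g i).IsPrime := by
  have h1 : ∀ᶠ i in U, (1 : A i) ∉ idl g i := by
    rw [Ultrafilter.eventually_not]
    intro h1
    refine h.ne_top ((Ideal.eq_top_iff_one _).2 ?_)
    rw [← map_one mk]
    exact (mk_mem_span_iff g _).2 h1
  have h2 : ∀ᶠ i in U, ∀ x : A i × A i, x.1 * x.2 ∈ idl g i → x.1 ∈ idl g i ∨ x.2 ∈ idl g i := by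
    refine eventually_forall fun f => ?_
    rw [Ultrafilter.eventually_imp, Ultrafilter.eventually_or]
    intro h2
    rw [← mk_mem_span_iff, ← mk_mem_span_iff]
    refine h.mem_or_mem ?_
    rw [← map_mul]
    exact (mk_mem_span_iff g _).2 h2
  filter_upwards [h1, h2] with i h1 h2
  exact ⟨fun h => h1 (h ▸ trivial), fun {x y} h => h2 (x, y) h⟩

theorem eventually_mem_or_mem (g : Fin r → Fin m → UP A) (p : Fin s → UP A)
    (h : ∀ (x : UP A) v, x • v ∈ Submodule.span (UP A) (Set.range g) →
      x ∈ Ideal.span (Set.range p) ∨ v ∈ Submodule.span (UP A) (Set.range g)) :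
    ∀ᶠ i in U, ∀ (x : A i) v, x • v ∈ spn g i → x ∈ idl p i ∨ v ∈ spn g i := by
  have : ∀ᶠ i in U, ∀ x : A i × (Fin m → A i),
      x.1 • x.2 ∈ spn g i → x.1 ∈ idl p i ∨ x.2 ∈ spn g i := by
    refine eventually_forall fun f => ?_
    rw [Ultrafilter.eventually_imp, Ultrafilter.eventually_or]
    intro h2
    rw [← mk_mem_span_iff, ← mkv_mem_span_iff]
    refine h _ _ ?_
    rw [mk_smul_mkv]
    exact (mkv_mem_span_iff g _).2 h2
  exact this.mono fun i hi x v => hi (x, v)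

theorem span_range_pow_le {B : Type*} [CommRing B] (p : Fin s → B) (e : ℕ) (J : Ideal B)
    (h : ∀ f : Fin e → Fin s, ∏ k, p (f k) ∈ J) : Ideal.span (Set.range p) ^ e ≤ J := by
  have h1 : Ideal.span (Set.range p) ^ e = Ideal.span (Set.range p ^ e) := Submodule.span_pow _ _
  rw [h1, Ideal.span_le]
  intro x hx
  obtain ⟨f, rfl⟩ := Set.mem_pow.1 hx
  choose f' hf' using fun k => (f k).2
  rw [List.prod_ofFn]
  simpa [hf'] using h f'

theorem eventually_pow_smul_le (g : Fin r → Fin m → UP A) (p : Fin s → UP A) (e : ℕ)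
    (h : ∀ x ∈ Ideal.span (Set.range p) ^ e, ∀ v, x • v ∈ Submodule.span (UP A) (Set.range g)) :
    ∀ᶠ i in U, idl p i ^ e • (⊤ : Submodule (A i) (Fin m → A i)) ≤ spn g i := by
  have h1 : ∀ᶠ i in U, ∀ f : Fin e → Fin s, ∀ v : Fin m → A i,
      (∏ k, rep (p (f k)) i) • v ∈ spn g i := by
    rw [eventually_all]
    refine fun f => eventually_forall fun v => ?_
    rw [← mkv_mem_span_iff g fun i => (∏ k, rep (p (f k)) i) • v i, ← mk_smul_mkv]
    refine h _ ?_ _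
    have : mk (fun i => ∏ k, rep (p (f k)) i) = ∏ k, p (f k) := by
      have h2 : (fun i => ∏ k, rep (p (f k)) i) = ∏ k, rep (p (f k)) := by
        ext i
        simp
      rw [h2, map_prod]
      simp
    rw [this]
    have h3 := Ideal.prod_mem_prod (s := Finset.univ)
      (I := fun _ : Fin e => Ideal.span (Set.range p))
      (x := fun k => p (f k)) fun k _ => Ideal.subset_span ⟨f k, rfl⟩
    simpa using h3
  filter_upwards [h1] with i hi
  have h4 : idl p i ^ e ≤ (spn g i).colon Set.univ :=
    span_range_pow_le _ _ _ fun f => Submodule.mem_colon.2 fun v _ => hi f v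
  exact Submodule.smul_le.2 fun x hx v _ => Submodule.mem_colon.1 (h4 hx) v trivial

theorem eventually_idl_ne (p : Fin r → UP A) (q : Fin s → UP A)
    (h : Ideal.span (Set.range p) ≠ Ideal.span (Set.range q)) : ∀ᶠ i in U, idl p i ≠ idl q i := by
  rw [Ultrafilter.eventually_not]
  refine fun he => h ?_
  ext x
  obtain ⟨x, rfl⟩ := mk_surjective x
  rw [mk_mem_span_iff, mk_mem_span_iff]
  exact eventually_congr (he.mono fun i hi => by rw [hi])

end Transfer

theorem associatedPrimes_quotient_eq_singleton {R M : Type*} [CommRing R] [IsNoetherianRing R]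
    [AddCommGroup M] [Module R M] {Q : Submodule R M} {P : Ideal R} [P.IsPrime] {e : ℕ}
    (hQ : Q ≠ ⊤) (h1 : ∀ (r : R) (v : M), r • v ∈ Q → r ∈ P ∨ v ∈ Q)
    (h2 : P ^ e • (⊤ : Submodule R M) ≤ Q) : associatedPrimes R (M ⧸ Q) = {P} := by
  have : Nontrivial (M ⧸ Q) := Submodule.Quotient.nontrivial_iff.2 hQ
  have h3 (I) (hI : I ∈ associatedPrimes R (M ⧸ Q)) : I = P := by
    obtain ⟨hp, x, hx⟩ := isAssociatedPrime_iff.1 hI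
    obtain ⟨v, rfl⟩ := Q.mkQ_surjective x
    have hmem (r) : r ∈ I ↔ r • v ∈ Q := by
      rw [hx, Submodule.mem_colon_singleton, ← map_smul, Submodule.mem_bot, Submodule.mkQ_apply,
        Submodule.Quotient.mk_eq_zero]
    have hv : v ∉ Q := fun hv => hp.ne_top ((Ideal.eq_top_iff_one _).2 ((hmem 1).2 (by simpa)))
    refine le_antisymm (fun r hr => (h1 r v ((hmem r).1 hr)).resolve_right hv) fun r hr => ?_
    refine hp.mem_of_pow_mem e ((hmem _).2 (h2 ?_))
    exact Submodule.smul_mem_smul (Ideal.pow_mem_pow hr e) trivial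
  obtain ⟨I, hI⟩ := associatedPrimes.nonempty R (M ⧸ Q)
  exact Set.eq_singleton_iff_unique_mem.2 ⟨h3 I hI ▸ hI, h3⟩

/-- The column space of `𝓜` has an irredundant primary decomposition all of whose numerical
data are bounded by `B`. -/
def HasBoundedDecomposition {K : Type u} [Field K] {N m n : ℕ}
    (𝓜 : Matrix (Fin m) (Fin n) (MvPolynomial (Fin N) K)) (B : ℕ) : Prop :=
  ∃ (t : ℕ) (Q : Fin t → Submodule (MvPolynomial (Fin N) K) (Fin m → MvPolynomial (Fin N) K))
    (P : Fin t → Ideal (MvPolynomial (Fin N) K)),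
    t ≤ B ∧
    LinearMap.range 𝓜.mulVecLin = ⨅ i, Q i ∧
    (∀ i, associatedPrimes (MvPolynomial (Fin N) K)
      ((Fin m → MvPolynomial (Fin N) K) ⧸ Q i) = {P i}) ∧
    (∀ i, ∃ r ≤ B, ∃ gp : Fin r → MvPolynomial (Fin N) K,
      (∀ a, (gp a).totalDegree ≤ B) ∧ Ideal.span (Set.range gp) = P i) ∧
    (∀ i, ∃ r ≤ B, ∃ gq : Fin r → (Fin m → MvPolynomial (Fin N) K),
      (∀ a l, (gq a l).totalDegree ≤ B) ∧
      Submodule.span (MvPolynomial (Fin N) K) (Set.range gq) = Q i) ∧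
    (∀ i, (P i) ^ B •
      (⊤ : Submodule (MvPolynomial (Fin N) K) (Fin m → MvPolynomial (Fin N) K)) ≤ Q i) ∧
    Function.Injective P ∧
    (∀ j : Fin t, LinearMap.range 𝓜.mulVecLin < ⨅ (i : Fin t) (_ : i ≠ j), Q i)

theorem HasBoundedDecomposition.mono {K : Type u} [Field K] {N m n : ℕ}
    {𝓜 : Matrix (Fin m) (Fin n) (MvPolynomial (Fin N) K)} {B B' : ℕ}
    (h : HasBoundedDecomposition 𝓜 B) (hB : B ≤ B') : HasBoundedDecomposition 𝓜 B' := by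
  obtain ⟨t, Q, P, h1, h2, h3, h4, h5, h6, h7, h8⟩ := h
  refine ⟨t, Q, P, h1.trans hB, h2, h3, fun i => ?_, fun i => ?_, fun i => ?_, h7, h8⟩
  · obtain ⟨r, hr, g, hg, hs⟩ := h4 i
    exact ⟨r, hr.trans hB, g, fun a => (hg a).trans hB, hs⟩
  · obtain ⟨r, hr, g, hg, hs⟩ := h5 i
    exact ⟨r, hr.trans hB, g, fun a l => (hg a l).trans hB, hs⟩
  · exact (Submodule.smul_mono_left (Ideal.pow_le_pow_right hB)).trans (h6 i)

theorem exists_pad {R M : Type*} [Semiring R] [AddCommMonoid M] [Module R M] {r B : ℕ}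
    (hr : r ≤ B) (g : Fin r → M) : ∃ g' : Fin B → M,
      (∀ a, g' a = 0 ∨ ∃ b, g' a = g b) ∧
      Submodule.span R (Set.range g') = Submodule.span R (Set.range g) := by
  have h1 (a : Fin B) :
      (if h : a.1 < r then g ⟨a, h⟩ else 0) = 0 ∨
        ∃ b, (if h : a.1 < r then g ⟨a, h⟩ else 0) = g b := by
    split_ifs with h
    · exact Or.inr ⟨_, rfl⟩
    · exact Or.inl rfl
  refine ⟨fun a => if h : a.1 < r then g ⟨a, h⟩ else 0, h1, le_antisymm ?_ ?_⟩
  · rw [Submodule.span_le]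
    rintro _ ⟨a, rfl⟩
    obtain h | ⟨b, h⟩ := h1 a
    · simp only [h]
      exact Submodule.zero_mem _
    · simp only [h]
      exact Submodule.subset_span ⟨b, rfl⟩
  · rw [Submodule.span_le]
    rintro _ ⟨a, rfl⟩
    exact Submodule.subset_span ⟨⟨a, a.2.trans_le hr⟩, by simp⟩

theorem exists_forall_le {ι : Type*} [Finite ι] (f : ι → ℕ) : ∃ B, ∀ j, f j ≤ B := by
  obtain ⟨B, hB⟩ := (Set.finite_range f).bddAbove
  exact ⟨B, fun j => hB ⟨j, rfl⟩⟩

theorem exists_generators {A S : Type u} [CommRing A] [CommRing S] [Algebra A S]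
    [IsNoetherianRing A] {m : ℕ} (Q : Submodule A (Fin m → A)) :
    ∃ (r : ℕ) (g : Fin r → Fin m → A),
      Submodule.span S (Set.range fun a l => algebraMap A S (g a l)) = ext S Q := by
  obtain ⟨r, g, rfl⟩ := Submodule.fg_iff_exists_fin_generating_family.1
    (IsNoetherian.noetherian Q)
  refine ⟨r, g, ?_⟩
  rw [ext_span, ← Set.range_comp]
  rfl

theorem exists_ideal_generators {A S : Type u} [CommRing A] [CommRing S] [Algebra A S]
    [IsNoetherianRing A] (P : Ideal A) :
    ∃ (r : ℕ) (g : Fin r → A),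
      Ideal.span (Set.range fun a => algebraMap A S (g a)) = P.map (algebraMap A S) := by
  obtain ⟨r, g, rfl⟩ := Submodule.fg_iff_exists_fin_generating_family.1
    (IsNoetherian.noetherian P)
  refine ⟨r, g, ?_⟩
  change _ = Ideal.map (algebraMap A S) (Ideal.span (Set.range g))
  rw [Ideal.map_span, ← Set.range_comp]
  rfl

/-- The decomposition over an ultraproduct of polynomial rings provided by a polynomial model
of the relevant finite data. -/
theorem exists_decomposition_Fl (K : ℕ → Type u) [∀ i, Field (K i)] [∀ i, IsAlgClosed (K i)]
    (N : ℕ → ℕ) {m n : ℕ} (c : Fin n → Fin m → Fl K N) (hc : ∀ k l, c k l ∈ Bd K N) :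
    ∃ (t : ℕ) (rq rp : Fin t → ℕ) (gq : ∀ j, Fin (rq j) → Fin m → Fl K N)
      (gp : ∀ j, Fin (rp j) → Fl K N) (e : ℕ),
      (∀ j a l, gq j a l ∈ Bd K N) ∧ (∀ j a, gp j a ∈ Bd K N) ∧
      Submodule.span (Fl K N) (Set.range c) =
        ⨅ j, Submodule.span (Fl K N) (Set.range (gq j)) ∧
      (∀ j, (Ideal.span (Set.range (gp j))).IsPrime) ∧
      (∀ j (s : Fl K N) v, s • v ∈ Submodule.span (Fl K N) (Set.range (gq j)) →
        s ∈ Ideal.span (Set.range (gp j)) ∨ v ∈ Submodule.span (Fl K N) (Set.range (gq j))) ∧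
      (∀ j, ∀ s ∈ Ideal.span (Set.range (gp j)) ^ e, ∀ v,
        s • v ∈ Submodule.span (Fl K N) (Set.range (gq j))) ∧
      Function.Injective (fun j => Ideal.span (Set.range (gp j))) ∧
      ∀ j, ∃ v, (∀ i, i ≠ j → v ∈ Submodule.span (Fl K N) (Set.range (gq i))) ∧
        v ∉ Submodule.span (Fl K N) (Set.range (gq j)) := by
  classical
  obtain ⟨b, _, _, hBd, hT, hprime⟩ := exists_model K N
    (Finset.univ.image fun x : Fin n × Fin m => c x.1 x.2) (by
      intro x hx
      obtain ⟨y, -, rfl⟩ := Finset.mem_image.1 hx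
      exact hc _ _)
  choose c' hc' using fun k l => hT (c k l) (Finset.mem_image.2 ⟨(k, l), Finset.mem_univ _, rfl⟩)
  obtain ⟨t, Q, P, e, h1, h2, h3, h4, h5, h6⟩ :=
    exists_extended_decomposition (Fl K N) hprime (Submodule.span _ (Set.range c'))
  choose rq gq hgq using fun j => exists_generators (S := Fl K N) (Q j)
  choose rp gp hgp using fun j => exists_ideal_generators (S := Fl K N) (P j)
  have hcc : ext (Fl K N) (Submodule.span _ (Set.range c')) =
      Submodule.span (Fl K N) (Set.range c) := by
    rw [ext_span, ← Set.range_comp]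
    congr 2
    ext k l
    exact hc' k l
  refine ⟨t, rq, rp, fun j a l => algebraMap _ _ (gq j a l), fun j a => algebraMap _ _ (gp j a),
    e, fun _ _ _ => hBd _, fun _ _ => hBd _, ?_⟩
  simp only [hgq, hgp]
  exact ⟨hcc ▸ h1, h2, h3, h4, h5, h6⟩

theorem spn_columns {K : ℕ → Type u} [∀ i, Field (K i)] {N : ℕ → ℕ} {m n : ℕ}
    (𝓜 : ∀ i, Matrix (Fin m) (Fin n) (MvPolynomial (Fin (N i)) (K i))) :
    ∀ᶠ i in U, spn (A := fun i => MvPolynomial (Fin (N i)) (K i))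
      (fun (k : Fin n) (l : Fin m) => mk fun i => 𝓜 i l k) i =
        LinearMap.range (𝓜 i).mulVecLin := by
  have : ∀ᶠ i in U, ∀ (k : Fin n) (l : Fin m),
      rep (A := fun i => MvPolynomial (Fin (N i)) (K i)) (mk fun i => 𝓜 i l k) i = 𝓜 i l k := by
    simp only [eventually_all]
    exact fun k l => rep_mk _
  filter_upwards [this] with i hi
  rw [Matrix.range_mulVecLin, spn]
  simp only [hi]
  rfl

theorem eventually_hasBoundedDecomposition (K : ℕ → Type u) [∀ i, Field (K i)]
    [∀ i, IsAlgClosed (K i)] (N : ℕ → ℕ) {m n d : ℕ}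
    (𝓜 : ∀ i, Matrix (Fin m) (Fin n) (MvPolynomial (Fin (N i)) (K i)))
    (hd : ∀ i k l, (𝓜 i k l).totalDegree ≤ d) :
    ∃ B, ∀ᶠ i in U, HasBoundedDecomposition (𝓜 i) B := by
  obtain ⟨t, rq, rp, gq, gp, e, hq, hp, h1, h2, h3, h4, h5, h6⟩ := exists_decomposition_Fl K N
    (fun (k : Fin n) (l : Fin m) => mk fun i => 𝓜 i l k)
    (fun k l => mem_Bd.2 ⟨d, degLE_mk.2 (Eventually.of_forall fun i => hd i l k)⟩)
  choose dq hdq using fun j a l => mem_Bd.1 (hq j a l)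
  choose dp hdp using fun j a => mem_Bd.1 (hp j a)
  choose w hw hw' using h6
  obtain ⟨B1, hB1⟩ := exists_forall_le rq
  obtain ⟨B2, hB2⟩ := exists_forall_le rp
  obtain ⟨B3, hB3⟩ := exists_forall_le fun x : Σ j, Fin (rq j) × Fin m => dq x.1 x.2.1 x.2.2
  obtain ⟨B4, hB4⟩ := exists_forall_le fun x : Σ j, Fin (rp j) => dp x.1 x.2
  have e1 : ∀ᶠ i in U, ∀ j a l, (rep (gq j a l) i).totalDegree ≤ dq j a l := by
    simp only [eventually_all]
    exact hdq
  have e2 : ∀ᶠ i in U, ∀ j a, (rep (gp j a) i).totalDegree ≤ dp j a := by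
    simp only [eventually_all]
    exact hdp
  have e3 : ∀ᶠ i in U, ∀ j, (idl (gp j) i).IsPrime :=
    eventually_all.2 fun j => eventually_idl_isPrime _ (h2 j)
  have e4 : ∀ᶠ i in U, ∀ j (x : MvPolynomial (Fin (N i)) (K i)) v, x • v ∈ spn (gq j) i →
      x ∈ idl (gp j) i ∨ v ∈ spn (gq j) i :=
    eventually_all.2 fun j => eventually_mem_or_mem _ _ (h3 j)
  have e5 : ∀ᶠ i in U, ∀ j, idl (gp j) i ^ e • (⊤ : Submodule (MvPolynomial (Fin (N i)) (K i))
      (Fin m → MvPolynomial (Fin (N i)) (K i))) ≤ spn (gq j) i :=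
    eventually_all.2 fun j => eventually_pow_smul_le _ _ e (h4 j)
  have e6 : ∀ᶠ i in U, ∀ j k, j ≠ k → idl (gp j) i ≠ idl (gp k) i := by
    simp only [eventually_all]
    exact fun j k hjk => eventually_idl_ne _ _ (h5.ne hjk)
  have e7 : ∀ᶠ i in U, ∀ j k, k ≠ j → (fun l => rep (w j l) i) ∈ spn (gq k) i := by
    simp only [eventually_all]
    intro j k hjk
    rw [← mkv_mem_span_iff, mkv_rep]
    exact hw j k hjk
  have e8 : ∀ᶠ i in U, ∀ j, (fun l => rep (w j l) i) ∉ spn (gq j) i := by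
    rw [eventually_all]
    intro j
    rw [Ultrafilter.eventually_not, ← mkv_mem_span_iff, mkv_rep]
    exact hw' j
  have e9 : ∀ᶠ i in U, ∀ v, v ∈ LinearMap.range (𝓜 i).mulVecLin ↔ ∀ j, v ∈ spn (gq j) i := by
    refine eventually_forall fun v => ?_
    have h7 : mkv v ∈ Submodule.span (Fl K N)
        (Set.range fun (k : Fin n) (l : Fin m) => mk fun i => 𝓜 i l k) ↔
        ∀ j, mkv v ∈ Submodule.span (Fl K N) (Set.range (gq j)) := by
      rw [h1, Submodule.mem_iInf]
    have h8 : (∀ᶠ i in U, v i ∈ LinearMap.range (𝓜 i).mulVecLin) ↔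
        ∀ᶠ i in U, ∀ j, v i ∈ spn (gq j) i := by
      rw [eventually_all]
      refine Iff.trans ?_ (h7.trans (forall_congr' fun j => mkv_mem_span_iff _ _))
      refine Iff.trans ?_ (mkv_mem_span_iff _ _).symm
      exact eventually_congr ((spn_columns 𝓜).mono fun i hi => by rw [hi])
    by_cases h9 : ∀ᶠ i in U, ∀ j, v i ∈ spn (gq j) i
    · filter_upwards [h9, h8.2 h9] with i h10 h11 using iff_of_true h11 h10
    · filter_upwards [Ultrafilter.eventually_not.2 h9,
        Ultrafilter.eventually_not.2 (mt h8.1 h9)] with i h10 h11 using iff_of_false h11 h10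
  refine ⟨t + B1 + B2 + B3 + B4 + e, ?_⟩
  filter_upwards [e1, e2, e3, e4, e5, e6, e7, e8, e9] with i e1 e2 e3 e4 e5 e6 e7 e8 e9
  have hrange : LinearMap.range (𝓜 i).mulVecLin = ⨅ j, spn (gq j) i := by
    ext v
    rw [Submodule.mem_iInf, e9]
  refine ⟨t, fun j => spn (gq j) i, fun j => idl (gp j) i, by omega, hrange, fun j => ?_,
    fun j => ⟨rp j, (hB2 j).trans (by omega), _, fun a => ?_, rfl⟩,
    fun j => ⟨rq j, (hB1 j).trans (by omega), _, fun a l => ?_, rfl⟩, fun j => ?_,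
    fun j k hjk => ?_, fun j => ?_⟩
  · have := e3 j
    exact associatedPrimes_quotient_eq_singleton (fun h => e8 j (h.ge trivial)) (e4 j) (e5 j)
  · exact (e2 j a).trans ((hB4 ⟨j, a⟩).trans (by omega))
  · exact (e1 j a l).trans ((hB3 ⟨j, a, l⟩).trans (by omega))
  · exact (Submodule.smul_mono_left (Ideal.pow_le_pow_right (by omega))).trans (e5 j)
  · by_contra hne
    exact e6 j k hne hjk
  · rw [hrange]
    refine lt_of_le_of_ne (le_iInf₂ fun k _ => iInf_le _ k) fun h => e8 j ?_
    have h7 : (fun l => rep (w j l) i) ∈ ⨅ j, spn (gq j) i := by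
      rw [h]
      simp only [Submodule.mem_iInf]
      exact fun k hk => e7 j k hk
    exact (Submodule.mem_iInf _).1 h7 j

/-- Uniform bounds for irredundant primary decompositions of column spaces. -/
theorem exists_bound (m n d : ℕ) : ∃ B, ∀ (K : Type u) [Field K] [IsAlgClosed K] (N : ℕ)
    (𝓜 : Matrix (Fin m) (Fin n) (MvPolynomial (Fin N) K)),
    (∀ i j, (𝓜 i j).totalDegree ≤ d) → HasBoundedDecomposition 𝓜 B := by
  by_contra! h
  choose K hK hKc N 𝓜 hd hbad using h
  obtain ⟨B, hB⟩ := eventually_hasBoundedDecomposition K N 𝓜 hd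
  have h1 : ∀ᶠ i in U, B ≤ i := by
    have : ∀ᶠ i in cofinite, B ≤ i := by
      rw [Nat.cofinite_eq_atTop]
      exact eventually_ge_atTop B
    exact hyperfilter_le_cofinite this
  obtain ⟨i, hi, hBi⟩ := (hB.and h1).exists
  exact hbad i (hi.mono hBi)

end Ultra

/-- There is a function `E`, independent of `N` and `K`, such that for every
algebraically closed field `K` and every `m × n` matrix `𝓜` over `R = K[x_1, …, x_N]` with
entries of degree at most `d`, the column space `M ⊆ R^m` of `𝓜` admits an irredundant primary
decomposition `M = Q_1 ∩ ⋯ ∩ Q_t` with `t ≤ E m n d`, where each `Q i` is `P i`-coprimary,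
each prime `P i` is generated by at most `E m n d` polynomials of degree at most `E m n d`,
each `Q i` is generated by at most `E m n d` elements of `R^m` with entries of degree at most
`E m n d`, and `(P i)^(E m n d) · R^m ⊆ Q i`.  Irredundance: the `P i` are pairwise distinct
and omitting any component gives a strictly larger intersection. -/
theorem statement9 :
    ∃ E : ℕ → ℕ → ℕ → ℕ,
      ∀ (K : Type u) [Field K] [IsAlgClosed K] (N m n d : ℕ)
        (𝓜 : Matrix (Fin m) (Fin n) (MvPolynomial (Fin N) K)),
        (∀ i j, (𝓜 i j).totalDegree ≤ d) →
        ∃ (t : ℕ)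
          (Q : Fin t → Submodule (MvPolynomial (Fin N) K) (Fin m → MvPolynomial (Fin N) K))
          (P : Fin t → Ideal (MvPolynomial (Fin N) K)),
          t ≤ E m n d ∧
          LinearMap.range 𝓜.mulVecLin = ⨅ i, Q i ∧
          (∀ i, associatedPrimes (MvPolynomial (Fin N) K)
              ((Fin m → MvPolynomial (Fin N) K) ⧸ Q i) = {P i}) ∧
          (∀ i, ∃ gp : Fin (E m n d) → MvPolynomial (Fin N) K,
            (∀ a, (gp a).totalDegree ≤ E m n d) ∧ Ideal.span (Set.range gp) = P i) ∧
          (∀ i, ∃ gq : Fin (E m n d) → (Fin m → MvPolynomial (Fin N) K),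
            (∀ a l, (gq a l).totalDegree ≤ E m n d) ∧
            Submodule.span (MvPolynomial (Fin N) K) (Set.range gq) = Q i) ∧
          (∀ i, (P i) ^ (E m n d) •
              (⊤ : Submodule (MvPolynomial (Fin N) K) (Fin m → MvPolynomial (Fin N) K))
              ≤ Q i) ∧
          Function.Injective P ∧
          (∀ j : Fin t,
            LinearMap.range 𝓜.mulVecLin < ⨅ (i : Fin t) (_ : i ≠ j), Q i) := by
  choose E hE using Ultra.exists_bound.{u}
  refine ⟨E, fun K _ _ N m n d 𝓜 hd => ?_⟩
  obtain ⟨t, Q, P, h1, h2, h3, h4, h5, h6, h7, h8⟩ := hE m n d K N 𝓜 hd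
  refine ⟨t, Q, P, h1, h2, h3, fun i => ?_, fun i => ?_, h6, h7, h8⟩
  · obtain ⟨r, hr, g, hg, hs⟩ := h4 i
    obtain ⟨g', hg', hs'⟩ := Ultra.exists_pad (R := MvPolynomial (Fin N) K) hr g
    refine ⟨g', fun a => ?_, hs'.trans hs⟩
    obtain h | ⟨b, h⟩ := hg' a
    · simp [h]
    · exact h ▸ hg b
  · obtain ⟨r, hr, g, hg, hs⟩ := h5 i
    obtain ⟨g', hg', hs'⟩ := Ultra.exists_pad (R := MvPolynomial (Fin N) K) hr g
    refine ⟨g', fun a l => ?_, hs'.trans hs⟩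
    obtain h | ⟨b, h⟩ := hg' a
    · simp [h]
    · exact h ▸ hg b l
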